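/- Fix a > 1/2 and α > 0. Then as τ → +∞, ∫_{τ^{1/a}}^{τ^{1/a}+τ} ( ∫_t^{t + a^{−α}·(ln τ)^α} X(u) du )² dt = (1 + o(1)) · √(2π³) · a^{−α} · τ · (ln τ)^α; that is, the quotient of the left-hand side by √(2π³)·a^{−α}·τ·(ln τ)^α tends to 1. -/

import Mathlib

open Filter Topology

noncomputable def XiF (t : ℝ) : ℝ :=
  (((1/2 + Complex.I * t) * ((1/2 + Complex.I * t) - 1) / 2) *
    (Real.pi : ℂ) ^ (-(1/2 + Complex.I * t) / 2) *
    Complex.Gamma ((1/2 + Complex.I * t) / 2) *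
    riemannZeta (1/2 + Complex.I * t)).re

noncomputable def XHL (t : ℝ) : ℝ :=
  -(t ^ ((1:ℝ)/4) * Real.exp (Real.pi * t / 4) / (1/4 + t ^ 2)) * XiF t

namespace HardyLittlewood

section ThetaRay

open Complex MeasureTheory Set
open scoped Real

/-- The Jacobi theta function `∑ exp (-π n² x e^{iφ})` along the ray of argument `φ`. -/
noncomputable def thetaRay (φ x : ℝ) : ℂ := jacobiTheta (I * (x * exp (φ * I)))

lemma thetaRay_arg_im (φ x : ℝ) : (I * (x * exp (φ * I))).im = x * Real.cos φ := by
  simp [exp_ofReal_mul_I_re]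

lemma hasSum_thetaRay {φ x : ℝ} (hφ : 0 < Real.cos φ) (hx : 0 < x) :
    HasSum (fun n : ℕ ↦ 2 * exp (-(π * ((n : ℂ) + 1) ^ 2 * x * exp (φ * I))))
      (thetaRay φ x - 1) := by
  have h := (hasSum_nat_jacobiTheta (τ := I * (x * exp (φ * I)))
    (by rw [thetaRay_arg_im]; positivity)).mul_left 2
  rw [mul_div_cancel₀ _ (two_ne_zero' ℂ)] at h
  refine h.congr_fun ?_
  intro n
  congr 2
  linear_combination (-(π * ((n : ℂ) + 1) ^ 2 * x * exp (φ * I))) * I_sq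

lemma thetaRay_one_div {φ x : ℝ} (hφ : 0 < Real.cos φ) (hφ₁ : -π < φ) (hφ₂ : φ < π)
    (hx : 0 < x) :
    thetaRay φ (1 / x) = (exp (-(φ / 2 : ℝ) * I) * ↑(x ^ (1 / 2 : ℝ))) • thetaRay (-φ) x := by
  have him : 0 < (I * (x * exp (((-φ : ℝ) : ℂ) * I))).im := by
    rw [thetaRay_arg_im, Real.cos_neg]; positivity
  have h := jacobiTheta_S_smul ⟨_, him⟩
  rw [UpperHalfPlane.modular_S_smul] at h
  have hx0 : (x : ℂ) ≠ 0 := ofReal_ne_zero.mpr hx.ne'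
  have e1 : (-(I * (x * exp (((-φ : ℝ) : ℂ) * I))))⁻¹ = I * ((1 / x : ℝ) * exp (φ * I)) := by
    have : exp (((-φ : ℝ) : ℂ) * I) * exp (φ * I) = 1 := by
      rw [← exp_add]; simp
    apply inv_eq_of_mul_eq_one_right
    have hx1 : (x : ℂ) * ((1 / x : ℝ) : ℂ) = 1 := by push_cast; field_simp
    linear_combination (-(I ^ 2) * (exp (((-φ : ℝ) : ℂ) * I) * exp (φ * I))) * hx1 - I ^ 2 * this - I_sq
  have e2 : -I * (I * (x * exp (((-φ : ℝ) : ℂ) * I))) = (x : ℂ) * exp (((-φ : ℝ) : ℂ) * I) := by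
    linear_combination (-(x * exp (((-φ : ℝ) : ℂ) * I))) * I_sq
  have e3 : ((x : ℂ) * exp (((-φ : ℝ) : ℂ) * I)) ^ (1 / 2 : ℂ)
      = exp (-(φ / 2 : ℝ) * I) * ↑(x ^ (1 / 2 : ℝ)) := by
    rw [cpow_def_of_ne_zero (mul_ne_zero hx0 (exp_ne_zero _)), log_ofReal_mul hx (exp_ne_zero _),
      log_exp (by simp; linarith) (by simp; linarith), add_mul, exp_add, mul_comm]
    congr 1
    · congr 1; push_cast; ring
    · rw [ofReal_cpow hx.le, cpow_def_of_ne_zero hx0, ofReal_log hx.le]; norm_num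
  simp only at h
  rw [e1, e2, e3] at h
  simpa [thetaRay] using h

lemma norm_thetaRay_sub_one_le {φ x : ℝ} (hφ : 0 < Real.cos φ) (hx : 1 ≤ x) :
    ‖thetaRay φ x - 1‖ ≤ 2 / (1 - rexp (-(π * Real.cos φ))) * rexp (-(π * Real.cos φ) * x) := by
  have h := norm_jacobiTheta_sub_one_le (τ := I * (x * exp (φ * I)))
    (by rw [thetaRay_arg_im]; positivity)
  rw [thetaRay_arg_im] at h
  refine h.trans ?_
  have e : -π * (x * Real.cos φ) = -(π * Real.cos φ) * x := by ring
  rw [e]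
  have h1 : rexp (-(π * Real.cos φ) * x) ≤ rexp (-(π * Real.cos φ)) := by
    apply Real.exp_le_exp.mpr
    have := mul_pos Real.pi_pos hφ
    nlinarith
  have h2 : rexp (-(π * Real.cos φ)) < 1 := by
    apply Real.exp_lt_one_iff.mpr
    have := mul_pos Real.pi_pos hφ
    linarith
  gcongr

lemma isBigO_thetaRay_sub_one {φ : ℝ} (hφ : 0 < Real.cos φ) (r : ℝ) :
    (fun x ↦ thetaRay φ x - 1) =O[atTop] (· ^ r) := by
  have h : (fun x ↦ thetaRay φ x - 1) =O[atTop] fun x ↦ rexp (-(π * Real.cos φ) * x) := by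
    refine Asymptotics.IsBigO.of_bound (2 / (1 - rexp (-(π * Real.cos φ)))) ?_
    filter_upwards [eventually_ge_atTop 1] with x hx
    rw [Real.norm_of_nonneg (Real.exp_pos _).le]
    exact norm_thetaRay_sub_one_le hφ hx
  exact h.trans (isLittleO_exp_neg_mul_rpow_atTop (mul_pos Real.pi_pos hφ) r).isBigO

lemma continuousOn_thetaRay {φ : ℝ} (hφ : 0 < Real.cos φ) :
    ContinuousOn (thetaRay φ) (Ioi 0) := by
  intro x hx
  refine ContinuousAt.continuousWithinAt ?_
  refine ContinuousAt.comp (f := fun x : ℝ ↦ I * ((x : ℂ) * exp (φ * I)))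
    (continuousAt_jacobiTheta ?_) (by fun_prop)
  rw [thetaRay_arg_im]
  exact mul_pos hx hφ

/-- The theta functions along two conjugate rays form a functional equation pair. -/
noncomputable def thetaPair (φ : ℝ) (hφ : 0 < Real.cos φ) (hφ₁ : -π < φ) (hφ₂ : φ < π) :
    WeakFEPair ℂ where
  f := thetaRay φ
  g := thetaRay (-φ)
  k := 1 / 2
  ε := exp (-(φ / 2 : ℝ) * I)
  f₀ := 1
  g₀ := 1
  hf_int := (continuousOn_thetaRay hφ).locallyIntegrableOn measurableSet_Ioi
  hg_int := (continuousOn_thetaRay (by rwa [Real.cos_neg])).locallyIntegrableOn measurableSet_Ioi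
  hk := by norm_num
  hε := exp_ne_zero _
  h_feq x hx := thetaRay_one_div hφ hφ₁ hφ₂ hx
  hf_top := isBigO_thetaRay_sub_one hφ
  hg_top := isBigO_thetaRay_sub_one (by rwa [Real.cos_neg])

/-- The Gamma integral with a complex scale parameter in the right half-plane. -/
lemma integral_cpow_mul_exp_neg_mul_Ioi_of_re_pos {s : ℂ} (hs : 0 < s.re) {r : ℂ} (hr : 0 < r.re) :
    ∫ x in Ioi (0 : ℝ), (x : ℂ) ^ (s - 1) * exp (-(r * x)) = r ^ (-s) * Gamma s := by
  set U : Set ℂ := {r | 0 < r.re} with hU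
  have hUo : IsOpen U := isOpen_lt continuous_const continuous_re
  have hnorm (s r : ℂ) {x : ℝ} (hx : 0 < x) :
      ‖(x : ℂ) ^ (s - 1) * exp (-(r * x))‖ = x ^ (s.re - 1) * rexp (-r.re * x) := by
    rw [norm_mul, norm_cpow_eq_rpow_re_of_pos hx, norm_exp]
    simp
  have hmeas (s r : ℂ) : AEStronglyMeasurable (fun x : ℝ ↦ (x : ℂ) ^ (s - 1) * exp (-(r * x)))
      (volume.restrict (Ioi 0)) := by
    refine ContinuousOn.aestronglyMeasurable (fun x hx ↦ ?_) measurableSet_Ioi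
    refine ContinuousAt.continuousWithinAt (ContinuousAt.mul ?_ (by fun_prop))
    exact continuous_ofReal.continuousAt.cpow continuousAt_const (Or.inl (by simpa using hx))
  have hreal {p q : ℝ} (hp : 0 < p) (hq : 0 < q) :
      IntegrableOn (fun x : ℝ ↦ x ^ (p - 1) * rexp (-q * x)) (Ioi 0) := by
    have := integrableOn_rpow_mul_exp_neg_mul_rpow (p := 1) (s := p - 1) (b := q) (by linarith) one_pos hq
    simpa using this
  have hdiff : DifferentiableOn ℂ
      (fun r ↦ ∫ x in Ioi (0 : ℝ), (x : ℂ) ^ (s - 1) * exp (-(r * x))) U := by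
    intro r₀ hr₀
    refine DifferentiableAt.differentiableWithinAt ?_
    have hr₀' : 0 < r₀.re := hr₀
    refine (hasDerivAt_integral_of_dominated_loc_of_deriv_le
      (F' := fun r (x : ℝ) ↦ -((x : ℂ) ^ (s + 1 - 1) * exp (-(r * x))))
      (bound := fun x ↦ x ^ (s.re + 1 - 1) * rexp (-(r₀.re / 2) * x))
      (Metric.ball_mem_nhds r₀ (half_pos hr₀')) (Eventually.of_forall fun r ↦ hmeas s r)
      ?_ (hmeas (s + 1) r₀).neg ?_ (hreal (by linarith) (half_pos hr₀')) ?_).2.differentiableAt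
    · refine (hreal hs hr₀').mono' (hmeas s r₀) ?_
      filter_upwards [ae_restrict_mem measurableSet_Ioi] with x hx
      exact (hnorm s r₀ hx).le
    · filter_upwards [ae_restrict_mem measurableSet_Ioi] with x hx r hrb
      rw [norm_neg, hnorm _ _ hx, add_re, one_re]
      have hx' : 0 < x := hx
      gcongr
      have := (abs_re_le_norm (r - r₀)).trans_lt (by simpa [dist_eq_norm] using hrb)
      rw [sub_re, abs_lt] at this
      linarith
    · filter_upwards [ae_restrict_mem measurableSet_Ioi] with x hx r _
      have hx0 : (x : ℂ) ≠ 0 := ofReal_ne_zero.mpr (ne_of_gt hx)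
      have h1 : HasDerivAt (fun r : ℂ ↦ (x : ℂ) ^ (s - 1) * exp (-(r * x)))
          ((x : ℂ) ^ (s - 1) * (exp (-(r * x)) * -(1 * (x : ℂ)))) r :=
        (((hasDerivAt_id r).mul_const (x : ℂ)).neg.cexp).const_mul _
      convert! h1 using 1
      rw [show s + 1 - 1 = (s - 1) + 1 by ring, cpow_add _ _ hx0, cpow_one]
      ring
  have hdiff₂ : DifferentiableOn ℂ (fun r : ℂ ↦ r ^ (-s) * Gamma s) U := fun r hr ↦
    ((differentiableAt_id.cpow_const (Or.inl hr)).mul_const _).differentiableWithinAt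
  have hpre : IsPreconnected U := (convex_halfSpace_re_gt 0).isPreconnected
  have h1 : (1 : ℂ) ∈ U := by simp [hU]
  refine (hdiff.analyticOnNhd hUo).eqOn_of_preconnected_of_frequently_eq
    (hdiff₂.analyticOnNhd hUo) hpre h1 ?_ hr
  have hseq : Tendsto (fun n : ℕ ↦ ((1 + 1 / ((n : ℝ) + 1) : ℝ) : ℂ)) atTop (𝓝[≠] 1) := by
    refine tendsto_nhdsWithin_iff.mpr ⟨?_, Eventually.of_forall fun n ↦ ?_⟩
    · have := (tendsto_one_div_add_atTop_nhds_zero_nat (𝕜 := ℝ)).const_add 1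
      rw [add_zero] at this
      exact_mod_cast (continuous_ofReal.tendsto 1).comp this
    · have : (0 : ℝ) < 1 / ((n : ℝ) + 1) := by positivity
      rw [mem_compl_iff, mem_singleton_iff, ofReal_eq_one]
      linarith
  refine hseq.frequently (Eventually.of_forall fun n ↦ ?_).frequently
  have hpos : (0 : ℝ) < 1 + 1 / ((n : ℝ) + 1) := by positivity
  rw [integral_cpow_mul_exp_neg_mul_Ioi hs hpos, one_div, inv_cpow _ _ (by
    rw [arg_ofReal_of_nonneg hpos.le]; exact Real.pi_pos.ne), cpow_neg]

lemma mellin_exp_ray {φ : ℝ} (hφ : 0 < Real.cos φ) (hφ₁ : -π < φ) (hφ₂ : φ < π)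
    {s : ℂ} (hs : 0 < s.re) {c : ℝ} (hc : 0 < c) :
    ∫ x in Ioi (0 : ℝ), (x : ℂ) ^ (s - 1) * exp (-(c * x * exp (φ * I)))
      = (c : ℂ) ^ (-s) * exp (-(φ * I * s)) * Gamma s := by
  have hre : 0 < ((c : ℂ) * exp (φ * I)).re := by
    rw [re_ofReal_mul, exp_ofReal_mul_I_re]; positivity
  have hc0 : (c : ℂ) ≠ 0 := ofReal_ne_zero.mpr hc.ne'
  have e1 : ((c : ℂ) * exp (φ * I)) ^ (-s) = (c : ℂ) ^ (-s) * exp (-(φ * I * s)) := by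
    rw [cpow_def_of_ne_zero (mul_ne_zero hc0 (exp_ne_zero _)),
      log_ofReal_mul hc (exp_ne_zero _),
      log_exp (by simp; linarith) (by simp; linarith), add_mul, exp_add,
      cpow_def_of_ne_zero hc0, ← ofReal_log hc.le]
    ring_nf
  rw [← e1, ← integral_cpow_mul_exp_neg_mul_Ioi_of_re_pos hs hre]
  refine setIntegral_congr_fun measurableSet_Ioi fun x _ ↦ ?_
  congr 2
  ring

lemma norm_exp_ray (φ c : ℝ) :
    ‖exp (-(c * exp (φ * I)))‖ = rexp (-(c * Real.cos φ)) := by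
  rw [norm_exp, neg_re, re_ofReal_mul, exp_ofReal_mul_I_re]

lemma thetaPair_Λ_eq {φ : ℝ} (hφ : 0 < Real.cos φ) (hφ₁ : -π < φ) (hφ₂ : φ < π)
    {s : ℂ} (hs : 1 < s.re) :
    (thetaPair φ hφ hφ₁ hφ₂).Λ (s / 2) = 2 * exp (-(φ * I * (s / 2))) * completedRiemannZeta s := by
  have hs2 : (1 / 2 : ℝ) < (s / 2).re := by
    have : (s / 2).re = s.re / 2 := by simp
    rw [this]; linarith
  have hs0 : 0 < (s / 2).re := by linarith
  have h := ((thetaPair φ hφ hφ₁ hφ₂).hasMellin hs2).2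
  rw [← h]
  have hterm (n : ℕ) : (0 : ℝ) < π * ((n : ℝ) + 1) ^ 2 := by positivity
  set F : ℕ → ℝ → ℂ := fun n x ↦ (x : ℂ) ^ (s / 2 - 1) *
    exp (-((π * ((n : ℝ) + 1) ^ 2 : ℝ) * x * exp (φ * I))) with hF
  have hinteg (n : ℕ) : IntegrableOn (F n) (Ioi 0) := by
    by_contra hcon
    have h0 := integral_undef hcon
    rw [hF, mellin_exp_ray hφ hφ₁ hφ₂ hs0 (hterm n)] at h0
    have := hterm n
    simp only [mul_eq_zero, exp_ne_zero, or_false, cpow_eq_zero_iff, ofReal_eq_zero, this.ne',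
      false_and, false_or] at h0
    exact Gamma_ne_zero_of_re_pos hs0 h0
  have hnorm (n : ℕ) : ∫ x in Ioi (0 : ℝ), ‖F n x‖ =
      ((1 / (π * Real.cos φ)) ^ (s / 2).re * Real.Gamma (s / 2).re) *
        (1 / ((n : ℝ) + 1) ^ s.re) := by
    have hr : 0 < π * ((n : ℝ) + 1) ^ 2 * Real.cos φ := mul_pos (hterm n) hφ
    have := Real.integral_rpow_mul_exp_neg_mul_Ioi hs0 hr
    have e : (1 / (π * ((n : ℝ) + 1) ^ 2 * Real.cos φ)) ^ (s / 2).re =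
        (1 / (π * Real.cos φ)) ^ (s / 2).re * (1 / ((n : ℝ) + 1) ^ s.re) := by
      rw [show 1 / (π * ((n : ℝ) + 1) ^ 2 * Real.cos φ) =
        1 / (π * Real.cos φ) * (1 / ((n : ℝ) + 1) ^ 2) by field_simp,
        Real.mul_rpow (by positivity) (by positivity)]
      congr 1
      rw [Real.div_rpow (by positivity) (by positivity), Real.one_rpow, ← Real.rpow_natCast,
        ← Real.rpow_mul (by positivity)]
      congr 2
      simp; ring
    rw [e] at this
    rw [mul_right_comm, ← this]
    refine setIntegral_congr_fun measurableSet_Ioi fun x hx ↦ ?_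
    simp only [hF, norm_mul]
    rw [norm_cpow_eq_rpow_re_of_pos hx, ← ofReal_mul, norm_exp_ray]
    simp only [sub_re, one_re]
    congr 2
    ring
  have hsum : Summable fun n ↦ ∫ x in Ioi (0 : ℝ), ‖F n x‖ := by
    simp_rw [hnorm]
    refine Summable.mul_left _ ?_
    have := (summable_nat_add_iff 1).mpr (Real.summable_one_div_nat_rpow.mpr hs)
    simpa using this
  have key := hasSum_integral_of_summable_integral_norm hinteg hsum
  have hmel : mellin (fun x ↦ (thetaPair φ hφ hφ₁ hφ₂).f x - (thetaPair φ hφ hφ₁ hφ₂).f₀) (s / 2)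
      = 2 * ∫ x in Ioi (0 : ℝ), ∑' n, F n x := by
    rw [mellin, ← integral_const_mul]
    refine setIntegral_congr_fun measurableSet_Ioi fun x hx ↦ ?_
    have h1 := (hasSum_thetaRay hφ hx).mul_left ((x : ℂ) ^ (s / 2 - 1))
    simp only [thetaPair, smul_eq_mul]
    rw [← h1.tsum_eq, ← tsum_mul_left]
    refine tsum_congr fun n ↦ ?_
    simp only [hF]
    push_cast
    ring
  rw [hmel, ← key.tsum_eq]
  have hval (n : ℕ) : ∫ x in Ioi (0 : ℝ), F n x =
      ((π * ((n : ℝ) + 1) ^ 2 : ℝ) : ℂ) ^ (-(s / 2)) * exp (-(φ * I * (s / 2))) * Gamma (s / 2) :=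
    mellin_exp_ray hφ hφ₁ hφ₂ hs0 (hterm n)
  simp_rw [hval]
  rw [completedZeta_eq_tsum_of_one_lt_re hs]
  have hterm2 (n : ℕ) : (((π * ((n : ℝ) + 1) ^ 2 : ℝ) : ℂ)) ^ (-(s / 2)) * exp (-(φ * I * (s / 2)))
      * Gamma (s / 2) = (exp (-(φ * I * (s / 2))) * ((π : ℂ) ^ (-s / 2) * Gamma (s / 2)))
        * (1 / ((n : ℂ) + 1) ^ s) := by
    rw [ofReal_mul, mul_cpow_ofReal_nonneg Real.pi_pos.le (by positivity)]
    have : (((((n : ℝ) + 1) ^ 2 : ℝ)) : ℂ) ^ (-(s / 2)) = 1 / ((n : ℂ) + 1) ^ s := by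
      have hn : ((n : ℂ) + 1) ≠ 0 := by exact_mod_cast Nat.succ_ne_zero n
      have hn' : (0 : ℝ) < (n : ℝ) + 1 := by positivity
      rw [cpow_neg, one_div]
      congr 1
      rw [cpow_def_of_ne_zero (by exact_mod_cast (by positivity : ((n : ℝ) + 1) ^ 2 ≠ 0)),
        cpow_def_of_ne_zero hn, ← ofReal_log (by positivity), Real.log_pow]
      have : (((n : ℂ)) + 1) = (((n : ℝ) + 1 : ℝ) : ℂ) := by push_cast; rfl
      rw [this, ← ofReal_log hn'.le]
      congr 1
      push_cast
      ring
    rw [this]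
    ring_nf
  simp_rw [hterm2]
  rw [tsum_mul_left]
  have hz : ∑' n : ℕ, 1 / (n : ℂ) ^ s = ∑' n : ℕ, 1 / ((n : ℂ) + 1) ^ s := by
    rw [← zeta_eq_tsum_one_div_nat_cpow hs, zeta_eq_tsum_one_div_nat_add_one_cpow hs]
  rw [hz]
  ring

end ThetaRay

section Representation

open Complex MeasureTheory Set
open scoped Real

lemma thetaPair_Λ_eq_of_ne {φ : ℝ} (hφ : 0 < Real.cos φ) (hφ₁ : -π < φ) (hφ₂ : φ < π)
    {s : ℂ} (hs₀ : s ≠ 0) (hs₁ : s ≠ 1) :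
    (thetaPair φ hφ hφ₁ hφ₂).Λ (s / 2) = 2 * exp (-(φ * I * (s / 2))) * completedRiemannZeta s := by
  set P := thetaPair φ hφ hφ₁ hφ₂ with hP
  set V : Set ℂ := {0, 1}ᶜ with hV
  have hVo : IsOpen V := (Set.toFinite _).isClosed.isOpen_compl
  have hVc : IsPreconnected V :=
    ((Set.toFinite _).countable.isConnected_compl_of_one_lt_rank
      (by rw [rank_real_complex]; norm_num)).isPreconnected
  have hmem {u : ℂ} (hu : u ∈ V) : u ≠ 0 ∧ u ≠ 1 := by
    simpa [hV] using hu
  have hd₁ : DifferentiableOn ℂ (fun u ↦ P.Λ (u / 2)) V := fun u hu ↦ by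
    obtain ⟨h0, h1⟩ := hmem hu
    refine (DifferentiableAt.comp u (P.differentiableAt_Λ (Or.inl ?_) (Or.inl ?_))
      (by fun_prop)).differentiableWithinAt
    · exact div_ne_zero h0 two_ne_zero
    · change u / 2 ≠ ((1 / 2 : ℝ) : ℂ)
      contrapose! h1
      push_cast at h1
      linear_combination 2 * h1
  have hd₂ : DifferentiableOn ℂ
      (fun u ↦ 2 * exp (-(φ * I * (u / 2))) * completedRiemannZeta u) V := fun u hu ↦ by
    obtain ⟨h0, h1⟩ := hmem hu
    exact (DifferentiableAt.mul (by fun_prop)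
      (differentiableAt_completedZeta h0 h1)).differentiableWithinAt
  have h2 : (2 : ℂ) ∈ V := by simp [hV]
  refine (hd₁.analyticOnNhd hVo).eqOn_of_preconnected_of_eventuallyEq
    (hd₂.analyticOnNhd hVo) hVc h2 ?_ (by simp [hV, hs₀, hs₁])
  have hopen : IsOpen {u : ℂ | 1 < u.re} := isOpen_lt continuous_const continuous_re
  filter_upwards [hopen.mem_nhds (show (1 : ℝ) < (2 : ℂ).re by simp)] with u hu
  exact thetaPair_Λ_eq hφ hφ₁ hφ₂ hu

lemma thetaRay_neg {φ x : ℝ} (hφ : 0 < Real.cos φ) (hx : 0 < x) :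
    thetaRay (-φ) x - 1 = (starRingEnd ℂ) (thetaRay φ x - 1) := by
  have h₁ := hasSum_thetaRay (φ := -φ) (by rwa [Real.cos_neg]) hx
  have h₂ := (hasSum_thetaRay hφ hx).map (starRingEnd ℂ) continuous_conj
  refine h₁.unique (h₂.congr_fun ?_)
  intro n
  simp [← exp_conj, map_ofNat]

/-- The half-line part of the Mellin transform of the theta function. -/
noncomputable def thetaTail (φ : ℝ) (w : ℂ) : ℂ :=
  ∫ x in Ioi (1 : ℝ), (x : ℂ) ^ (w - 1) * (thetaRay φ x - 1)

lemma mellin_indicator_eq (φ : ℝ) (w : ℂ) :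
    mellin ((Ioi 1).indicator fun x ↦ thetaRay φ x - 1) w = thetaTail φ w := by
  rw [mellin, thetaTail]
  have : ∀ x : ℝ, (x : ℂ) ^ (w - 1) • (Ioi 1).indicator (fun x ↦ thetaRay φ x - 1) x =
      (Ioi (1 : ℝ)).indicator (fun x : ℝ ↦ (x : ℂ) ^ (w - 1) * (thetaRay φ x - 1)) x := by
    intro x
    by_cases hx : x ∈ Ioi (1 : ℝ) <;> simp [hx]
  simp_rw [this]
  rw [setIntegral_indicator measurableSet_Ioi, Ioi_inter_Ioi]
  simp

lemma thetaTail_neg {φ : ℝ} (hφ : 0 < Real.cos φ) (w : ℂ) :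
    thetaTail (-φ) ((starRingEnd ℂ) w) = (starRingEnd ℂ) (thetaTail φ w) := by
  rw [thetaTail, thetaTail, ← integral_conj]
  refine setIntegral_congr_fun measurableSet_Ioi fun x hx ↦ ?_
  have hx0 : (0 : ℝ) < x := one_pos.trans hx
  simp only [map_mul]
  rw [thetaRay_neg hφ hx0]
  congr 1
  have hc := cpow_conj (x : ℂ) (w - 1) (by
    rw [arg_ofReal_of_nonneg hx0.le]; exact Real.pi_pos.ne)
  rwa [conj_ofReal, map_sub, map_one] at hc

lemma thetaPair_Λ₀_eq {φ : ℝ} (hφ : 0 < Real.cos φ) (hφ₁ : -π < φ) (hφ₂ : φ < π) (w : ℂ) :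
    (thetaPair φ hφ hφ₁ hφ₂).Λ₀ w =
      thetaTail φ w + exp (-(φ / 2 : ℝ) * I) * thetaTail (-φ) (1 / 2 - w) := by
  set P := thetaPair φ hφ hφ₁ hφ₂ with hP
  have hconv : MellinConvergent P.f_modif w :=
    (P.isStrongFEPair_toStrongFEPair.hasMellin w).1
  set f₁ : ℝ → ℂ := (Ioi 1).indicator fun x ↦ thetaRay φ x - 1 with hf₁
  set g₁ : ℝ → ℂ := (Ioi 1).indicator fun x ↦ thetaRay (-φ) x - 1 with hg₁
  have hc₁ : MellinConvergent f₁ w := by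
    have : IntegrableOn (fun x : ℝ ↦ (Ioi (1 : ℝ)).indicator
        (fun x : ℝ ↦ (x : ℂ) ^ (w - 1) • P.f_modif x) x) (Ioi 0) :=
      Integrable.indicator hconv measurableSet_Ioi
    refine this.congr_fun (fun x _ ↦ ?_) measurableSet_Ioi
    by_cases hx : x ∈ Ioi (1 : ℝ)
    · have hx' : ¬ x < 1 := not_lt.mpr (le_of_lt hx)
      simp [hx, hf₁, WeakFEPair.f_modif, hx', hP, thetaPair]
    · simp [hx, hf₁]
  have hsplit : ∀ x ∈ Ioi (0 : ℝ), P.f_modif x - f₁ x =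
      exp (-(φ / 2 : ℝ) * I) • ((x : ℂ) ^ (-(1 / 2) : ℂ) • g₁ x⁻¹) := by
    intro x hx
    have hx0 : (0 : ℝ) < x := hx
    have hfe := P.hf_modif_FE x⁻¹ (inv_pos.mpr hx)
    rw [one_div, inv_inv] at hfe
    have hcp : ((x⁻¹ ^ (1 / 2 : ℝ) : ℝ) : ℂ) = (x : ℂ) ^ (-(1 / 2) : ℂ) := by
      rw [Real.inv_rpow hx0.le, ← Real.rpow_neg hx0.le, ofReal_cpow hx0.le]
      norm_num
    rcases lt_trichotomy 1 x with h1 | h1 | h1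
    · have h2 : ¬ 1 < x⁻¹ := not_lt.mpr (inv_le_one_of_one_le₀ h1.le)
      have h3 : ¬ x < 1 := not_lt.mpr h1.le
      simp [WeakFEPair.f_modif, hf₁, hg₁, h1, h2, h3, hP, thetaPair]
    · subst h1
      simp [WeakFEPair.f_modif, hf₁, hg₁]
    · have h2 : 1 < x⁻¹ := (one_lt_inv₀ hx0).mpr h1
      have h3 : ¬ 1 < x := not_lt.mpr h1.le
      have h4 : ¬ x⁻¹ < 1 := not_lt.mpr h2.le
      have hf0 : f₁ x = 0 := by simp [hf₁, h3]
      have hg : P.g_modif x⁻¹ = g₁ x⁻¹ := by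
        simp [WeakFEPair.g_modif, hg₁, h2, h4, hP, thetaPair]
      rw [hfe, hg, hf0, sub_zero]
      have hk : P.k = 1 / 2 := rfl
      have he : P.ε = exp (-(φ / 2 : ℝ) * I) := rfl
      rw [hk, he, hcp, smul_eq_mul, smul_eq_mul, smul_eq_mul, mul_assoc]
  have hc₂ : MellinConvergent (fun x ↦ P.f_modif x - f₁ x) w := by
    simpa only [MellinConvergent, smul_sub] using! hconv.sub hc₁
  have hadd := (hasMellin_add hc₁ hc₂).2
  simp only [add_sub_cancel] at hadd
  have hm2 : mellin (fun x ↦ P.f_modif x - f₁ x) w =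
      exp (-(φ / 2 : ℝ) * I) * thetaTail (-φ) (1 / 2 - w) := by
    have : mellin (fun x ↦ P.f_modif x - f₁ x) w = mellin (fun x : ℝ ↦
        exp (-(φ / 2 : ℝ) * I) • ((x : ℂ) ^ (-(1 / 2) : ℂ) • g₁ x⁻¹)) w := by
      refine setIntegral_congr_fun measurableSet_Ioi fun x hx ↦ ?_
      simp only [hsplit x hx]
    rw [this, mellin_const_smul, mellin_cpow_smul, mellin_comp_inv, hg₁, mellin_indicator_eq,
      smul_eq_mul]
    ring_nf
  rw [WeakFEPair.Λ₀, show P.f_modif = fun x ↦ P.f_modif x from rfl, hadd, hm2, hf₁,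
    mellin_indicator_eq]

/-- The completed zeta function on the critical line as a real part. -/
lemma completedZeta_critical_line {φ : ℝ} (hφ : 0 < Real.cos φ) (hφ₁ : -π < φ) (hφ₂ : φ < π)
    (t : ℝ) :
    ((rexp (φ * t / 2) : ℝ) : ℂ) * completedRiemannZeta (1 / 2 + I * t) =
      ((exp ((φ / 4 : ℝ) * I) *
        (thetaTail φ (1 / 4 + I * (t / 2)) - 1 / (1 / 4 + I * (t / 2)))).re : ℝ) := by
  set P := thetaPair φ hφ hφ₁ hφ₂ with hP
  set w : ℂ := 1 / 4 + I * (t / 2) with hw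
  have hw2 : (1 / 2 + I * t) / 2 = w := by rw [hw]; ring
  have hs₀ : (1 / 2 + I * t : ℂ) ≠ 0 := by
    intro h; have := congrArg re h; norm_num at this
  have hs₁ : (1 / 2 + I * t : ℂ) ≠ 1 := by
    intro h; have := congrArg re h; norm_num at this
  have h := thetaPair_Λ_eq_of_ne hφ hφ₁ hφ₂ hs₀ hs₁
  have hconj : 1 / 2 - w = (starRingEnd ℂ) w := by
    rw [hw]; simp [map_ofNat]; ring
  rw [hw2, ← hP, WeakFEPair.Λ, hP, thetaPair_Λ₀_eq, hconj, thetaTail_neg hφ] at h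
  simp only [thetaPair, smul_eq_mul, mul_one] at h
  rw [show ((1 / 2 : ℝ) : ℂ) - w = (starRingEnd ℂ) w by rw [← hconj]; push_cast; ring] at h
  set D := thetaTail φ w
  set ω : ℂ := exp ((φ / 4 : ℝ) * I) with hω
  have hωc : (starRingEnd ℂ) ω = exp (-(φ / 4 : ℝ) * I) := by
    rw [hω, ← exp_conj]; simp [map_ofNat]
  have e1 : ω * exp (-(φ / 2 : ℝ) * I) = (starRingEnd ℂ) ω := by
    rw [hωc, hω, ← exp_add]; congr 1; push_cast; ring
  have e2 : ω * exp (-(φ * I * w)) = ((rexp (φ * t / 2) : ℝ) : ℂ) := by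
    rw [hω, ← exp_add, ofReal_exp, hw]
    congr 1
    push_cast
    linear_combination (-(φ * t / 2 : ℂ)) * I_sq
  rw [re_eq_add_conj, eq_div_iff two_ne_zero, ← e2]
  simp only [map_mul, map_sub, map_div₀, map_one]
  linear_combination (-ω) * h + ((starRingEnd ℂ) D - 1 / (starRingEnd ℂ) w) * e1

end Representation

section Waves

open Complex MeasureTheory Set
open scoped Real

/-- The `N`-th term of the theta series in logarithmic coordinates. -/
noncomputable def wave (z : ℂ) (N y : ℝ) : ℂ :=
  4 * rexp (y / 2) * exp (-((π * N ^ 2 * rexp (2 * y) : ℝ) * z))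

lemma continuous_wave (z : ℂ) (N : ℝ) : Continuous (wave z N) := by
  unfold wave; fun_prop

lemma norm_wave (z : ℂ) (N y : ℝ) :
    ‖wave z N y‖ = 4 * rexp (y / 2) * rexp (-(π * N ^ 2 * rexp (2 * y) * z.re)) := by
  rw [wave, norm_mul, norm_mul, norm_exp, neg_re, re_ofReal_mul, norm_real,
    Real.norm_of_nonneg (Real.exp_pos _).le]
  norm_num

lemma exp_neg_le_rpow {x r : ℝ} (hx : 0 < x) (hr₀ : 0 ≤ r) (hr₁ : r ≤ 1) :
    rexp (-x) ≤ x ^ (-r) := by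
  rw [Real.exp_neg, Real.rpow_neg hx.le]
  refine inv_anti₀ (Real.rpow_pos_of_pos hx r) ?_
  rcases le_total x 1 with h | h
  · exact (Real.rpow_le_one hx.le h hr₀).trans (Real.one_le_exp hx.le)
  · calc x ^ r ≤ x ^ (1 : ℝ) := Real.rpow_le_rpow_of_exponent_le h hr₁
      _ = x := Real.rpow_one x
      _ ≤ rexp x := by linarith [Real.add_one_le_exp x]

lemma norm_wave_le {z : ℂ} (hz : 0 < z.re) {N : ℝ} (hN : 0 < N) {y : ℝ} (hy : 0 ≤ y) :
    ‖wave z N y‖ ≤ 4 * rexp (-(π / 2 * N ^ 2 * z.re)) * N ^ (-(5 / 4) : ℝ) * z.re ^ (-(5 / 8) : ℝ)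
      * rexp (-(3 / 4) * y) := by
  have hx : 0 < N ^ 2 * z.re * rexp (2 * y) := by positivity
  have h1 := exp_neg_le_rpow hx (r := 5 / 8) (by norm_num) (by norm_num)
  have h2 : (N ^ 2 * z.re * rexp (2 * y)) ^ (-(5 / 8) : ℝ) =
      N ^ (-(5 / 4) : ℝ) * z.re ^ (-(5 / 8) : ℝ) * rexp (-(5 / 4) * y) := by
    rw [Real.mul_rpow (by positivity) (by positivity), Real.mul_rpow (by positivity) hz.le,
      ← Real.rpow_natCast, ← Real.rpow_mul hN.le, ← Real.exp_mul]
    congr 2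
    · congr 1; norm_num
    · ring
  have hpi := Real.pi_gt_three
  have h3 : rexp (-(π * N ^ 2 * rexp (2 * y) * z.re)) ≤
      rexp (-(π / 2 * N ^ 2 * z.re)) * rexp (-(N ^ 2 * z.re * rexp (2 * y))) := by
    rw [← Real.exp_add]
    apply Real.exp_le_exp.mpr
    have he : 1 ≤ rexp (2 * y) := Real.one_le_exp (by linarith)
    have hp : 0 < N ^ 2 * z.re := by positivity
    nlinarith [mul_nonneg hp.le (sub_nonneg.mpr he), mul_nonneg (mul_nonneg hp.le (by linarith : (0:ℝ) ≤ π / 2)) (sub_nonneg.mpr he), mul_pos hp (Real.exp_pos (2 * y))]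
  rw [norm_wave]
  calc 4 * rexp (y / 2) * rexp (-(π * N ^ 2 * rexp (2 * y) * z.re))
      ≤ 4 * rexp (y / 2) * (rexp (-(π / 2 * N ^ 2 * z.re)) *
        (N ^ (-(5 / 4) : ℝ) * z.re ^ (-(5 / 8) : ℝ) * rexp (-(5 / 4) * y))) := by
        rw [← h2]
        exact mul_le_mul_of_nonneg_left (h3.trans (mul_le_mul_of_nonneg_left h1
          (Real.exp_pos _).le)) (by positivity)
    _ = 4 * rexp (-(π / 2 * N ^ 2 * z.re)) * N ^ (-(5 / 4) : ℝ) * z.re ^ (-(5 / 8) : ℝ)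
        * (rexp (y / 2) * rexp (-(5 / 4) * y)) := by ring
    _ = _ := by
        rw [← Real.exp_add]
        congr 2
        ring

lemma integrableOn_wave {z : ℂ} (hz : 0 < z.re) {N : ℝ} (hN : 0 < N) :
    IntegrableOn (wave z N) (Ioi 0) := by
  have h : IntegrableOn (fun y ↦ 4 * rexp (-(π / 2 * N ^ 2 * z.re)) * N ^ (-(5 / 4) : ℝ) *
      z.re ^ (-(5 / 8) : ℝ) * rexp (-(3 / 4) * y)) (Ioi 0) :=
    (integrableOn_exp_mul_Ioi (by norm_num) 0).const_mul _
  refine h.mono' (continuous_wave z N).aestronglyMeasurable ?_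
  filter_upwards [ae_restrict_mem measurableSet_Ioi] with y hy
  exact norm_wave_le hz hN (le_of_lt hy)

lemma integral_norm_wave_le {z : ℂ} (hz : 0 < z.re) {N : ℝ} (hN : 0 < N) :
    ∫ y in Ioi (0 : ℝ), ‖wave z N y‖ ≤
      6 * rexp (-(π / 2 * N ^ 2 * z.re)) * N ^ (-(5 / 4) : ℝ) * z.re ^ (-(5 / 8) : ℝ) := by
  have hi := integral_exp_mul_Ioi (a := -(3 / 4)) (by norm_num) 0
  calc ∫ y in Ioi (0 : ℝ), ‖wave z N y‖
      ≤ ∫ y in Ioi (0 : ℝ), 4 * rexp (-(π / 2 * N ^ 2 * z.re)) * N ^ (-(5 / 4) : ℝ) *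
        z.re ^ (-(5 / 8) : ℝ) * rexp (-(3 / 4) * y) := by
        refine setIntegral_mono_on (integrableOn_wave hz hN).norm
          ((integrableOn_exp_mul_Ioi (by norm_num) 0).const_mul _) measurableSet_Ioi ?_
        exact fun y hy ↦ norm_wave_le hz hN (le_of_lt hy)
    _ = (16 / 3) * (rexp (-(π / 2 * N ^ 2 * z.re)) * N ^ (-(5 / 4) : ℝ) *
        z.re ^ (-(5 / 8) : ℝ)) := by
        rw [integral_const_mul, hi]
        simp
        ring
    _ ≤ 6 * (rexp (-(π / 2 * N ^ 2 * z.re)) * N ^ (-(5 / 4) : ℝ) * z.re ^ (-(5 / 8) : ℝ)) := by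
        gcongr
        norm_num
    _ = _ := by ring

/-- The constant `6 ∑ n^{-5/4}`. -/
noncomputable def waveConst : ℝ := ∑' n : ℕ, 6 * ((n : ℝ) + 1) ^ (-(5 / 4) : ℝ)

lemma summable_waveConst : Summable fun n : ℕ ↦ 6 * ((n : ℝ) + 1) ^ (-(5 / 4) : ℝ) := by
  refine Summable.mul_left _ ?_
  have := (summable_nat_add_iff 1).mpr
    (Real.summable_nat_rpow.mpr (by norm_num : (-(5 / 4) : ℝ) < -1))
  simpa using this

/-- The finite Fourier transform of a single wave. -/
noncomputable def waveInt (z : ℂ) (N t : ℝ) : ℂ :=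
  ∫ y in Ioi (0 : ℝ), wave z N y * exp (I * (t * y))

lemma norm_exp_I_mul (t y : ℝ) : ‖exp (I * ((t : ℂ) * y))‖ = 1 := by
  rw [mul_comm, ← ofReal_mul, norm_exp_ofReal_mul_I]

lemma norm_waveInt_le {z : ℂ} (hz : 0 < z.re) {N : ℝ} (hN : 0 < N) (t : ℝ) :
    ‖waveInt z N t‖ ≤
      6 * rexp (-(π / 2 * N ^ 2 * z.re)) * N ^ (-(5 / 4) : ℝ) * z.re ^ (-(5 / 8) : ℝ) := by
  refine (norm_integral_le_integral_norm _).trans ?_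
  simp_rw [norm_mul, norm_exp_I_mul, mul_one]
  exact integral_norm_wave_le hz hN

lemma hasSum_thetaTail {φ : ℝ} (hφ : 0 < Real.cos φ) (t : ℝ) :
    HasSum (fun n : ℕ ↦ waveInt (exp (φ * I)) (n + 1) t) (thetaTail φ (1 / 4 + I * (t / 2))) := by
  set z := exp (φ * I) with hz
  have hzre : z.re = Real.cos φ := exp_ofReal_mul_I_re φ
  have hz0 : 0 < z.re := by rwa [hzre]
  have himage : (fun y : ℝ ↦ rexp (2 * y)) '' Ioi 0 = Ioi 1 := by
    ext x
    simp only [mem_image, mem_Ioi]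
    constructor
    · rintro ⟨y, hy, rfl⟩
      exact Real.one_lt_exp_iff.mpr (by linarith)
    · intro hx
      refine ⟨Real.log x / 2, div_pos (Real.log_pos hx) two_pos, ?_⟩
      rw [mul_div_cancel₀ _ two_ne_zero, Real.exp_log (one_pos.trans hx)]
  have hsub : thetaTail φ (1 / 4 + I * (t / 2)) =
      ∫ y in Ioi (0 : ℝ), ∑' n : ℕ, wave z (n + 1) y * exp (I * (t * y)) := by
    rw [thetaTail, ← himage, integral_image_eq_integral_abs_deriv_smul (f := fun y ↦ rexp (2 * y))
      measurableSet_Ioi (f' := fun y ↦ rexp (2 * y) * (2 * 1)) (fun y _ ↦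
        (((hasDerivAt_id y).const_mul 2).exp).hasDerivWithinAt)
      (fun x _ y _ h ↦ by simpa using h)]
    refine setIntegral_congr_fun measurableSet_Ioi fun y hy ↦ ?_
    have h1 := (hasSum_thetaRay hφ (Real.exp_pos (2 * y)))
    have hpos : 0 < rexp (2 * y) * (2 * 1) := by positivity
    rw [← h1.tsum_eq, abs_of_pos hpos, ← tsum_mul_left, real_smul, ← tsum_mul_left]
    refine tsum_congr fun n ↦ ?_
    have hcp : ((rexp (2 * y) : ℝ) : ℂ) ^ (1 / 4 + I * (t / 2) - 1 : ℂ) =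
        exp (2 * y * (1 / 4 + I * (t / 2) - 1)) := by
      rw [cpow_def_of_ne_zero (ofReal_ne_zero.mpr (Real.exp_pos _).ne'), ← ofReal_log
        (Real.exp_pos _).le, Real.log_exp]
      push_cast; rfl
    rw [hcp, wave]
    have e1 : exp (2 * y * (1 / 4 + I * (t / 2) - 1) : ℂ) =
        exp (y / 2) * exp (I * (t * y)) * exp (-(2 * y)) := by
      rw [← exp_add, ← exp_add]; congr 1; ring
    have e2 : exp (2 * y) * exp (-(2 * y) : ℂ) = 1 := by
      rw [← exp_add]; simp
    have e3 : -(π * ((n : ℂ) + 1) ^ 2 * (rexp (2 * y) : ℝ) * exp (φ * I)) =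
        -(((π * ((n : ℝ) + 1) ^ 2 * rexp (2 * y) : ℝ) : ℂ) * z) := by
      rw [hz]; push_cast; ring
    rw [e1, e3]
    push_cast
    linear_combination (4 * exp (y / 2) * exp (I * (t * y)) *
      exp (-(π * (n + 1) ^ 2 * exp (2 * y) * z) : ℂ)) * e2
  rw [hsub]
  refine hasSum_integral_of_summable_integral_norm (fun n ↦ ?_) ?_
  · refine (integrableOn_wave hz0 (by positivity : (0:ℝ) < n + 1)).mul_bdd (c := 1) ?_ ?_
    · exact (by fun_prop : Continuous fun y : ℝ ↦ exp (I * ((t : ℂ) * y))).aestronglyMeasurable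
    · exact Eventually.of_forall fun y ↦ (norm_exp_I_mul t y).le
  · simp_rw [norm_mul, norm_exp_I_mul, mul_one]
    refine Summable.of_nonneg_of_le (fun n ↦ integral_nonneg fun _ ↦ norm_nonneg _)
      (fun n ↦ (integral_norm_wave_le hz0 (by positivity : (0:ℝ) < n + 1)).trans ?_)
      (summable_waveConst.mul_right (z.re ^ (-(5 / 8) : ℝ)))
    have : rexp (-(π / 2 * ((n : ℝ) + 1) ^ 2 * z.re)) ≤ 1 :=
      Real.exp_le_one_iff.mpr (by have : 0 ≤ π / 2 * ((n : ℝ) + 1) ^ 2 * z.re := by positivity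
                                  linarith)
    gcongr
    linarith

/-- Truncation of the theta series. -/
lemma norm_thetaTail_sub_sum_le {φ : ℝ} (hφ : 0 < Real.cos φ) (t : ℝ) (M : ℕ) :
    ‖thetaTail φ (1 / 4 + I * (t / 2)) - ∑ n ∈ Finset.range M, waveInt (exp (φ * I)) (n + 1) t‖ ≤
      waveConst * rexp (-(π / 2 * M ^ 2 * Real.cos φ)) * Real.cos φ ^ (-(5 / 8) : ℝ) := by
  have hzre : (exp (φ * I)).re = Real.cos φ := exp_ofReal_mul_I_re φ
  have hz0 : 0 < (exp (φ * I)).re := by rwa [hzre]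
  have h := (hasSum_nat_add_iff' M).mpr (hasSum_thetaTail hφ t)
  have hs := ((summable_nat_add_iff M).mpr summable_waveConst)
  have hs' := hs.mul_right (rexp (-(π / 2 * M ^ 2 * Real.cos φ)) * Real.cos φ ^ (-(5 / 8) : ℝ))
  rw [← h.tsum_eq]
  refine (tsum_of_norm_bounded hs'.hasSum fun n ↦ ?_).trans ?_
  · refine (norm_waveInt_le hz0 (by positivity) t).trans ?_
    rw [hzre]
    have : rexp (-(π / 2 * (((n + M : ℕ) : ℝ) + 1) ^ 2 * Real.cos φ)) ≤
        rexp (-(π / 2 * (M : ℝ) ^ 2 * Real.cos φ)) := by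
      apply Real.exp_le_exp.mpr
      have : (M : ℝ) ≤ ((n + M : ℕ) : ℝ) + 1 := by push_cast; linarith [(Nat.cast_nonneg n : (0:ℝ) ≤ n)]
      gcongr
    calc _ = 6 * (((n + M : ℕ) : ℝ) + 1) ^ (-(5 / 4) : ℝ) *
          (rexp (-(π / 2 * (((n + M : ℕ) : ℝ) + 1) ^ 2 * Real.cos φ)) *
            Real.cos φ ^ (-(5 / 8) : ℝ)) := by ring
      _ ≤ _ := by gcongr
  · rw [tsum_mul_right, mul_assoc waveConst]
    have hnn : 0 ≤ rexp (-(π / 2 * M ^ 2 * Real.cos φ)) * Real.cos φ ^ (-(5 / 8) : ℝ) := by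
      positivity
    refine mul_le_mul_of_nonneg_right ?_ hnn
    rw [waveConst, ← summable_waveConst.sum_add_tsum_nat_add M]
    have : 0 ≤ ∑ n ∈ Finset.range M, 6 * ((n : ℝ) + 1) ^ (-(5 / 4) : ℝ) :=
      Finset.sum_nonneg fun n _ ↦ by positivity
    linarith

lemma waveConst_nonneg : 0 ≤ waveConst := tsum_nonneg fun n ↦ by positivity

lemma XHL_eq_re {δ : ℝ} (hδ₀ : 0 < δ) (hδ₁ : δ < π / 2) {t : ℝ} :
    XHL t = 1 / 2 * t ^ (1 / 4 : ℝ) * rexp (δ * t / 2) *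
      (exp (((π / 2 - δ) / 4 : ℝ) * I) * (thetaTail (π / 2 - δ) (1 / 4 + I * (t / 2)) -
        1 / (1 / 4 + I * (t / 2)))).re := by
  have hcos : 0 < Real.cos (π / 2 - δ) := by
    rw [Real.cos_pi_div_two_sub]; exact Real.sin_pos_of_pos_of_lt_pi hδ₀ (by linarith)
  have h := completedZeta_critical_line hcos (by linarith) (by linarith) t
  set R := (exp (((π / 2 - δ) / 4 : ℝ) * I) * (thetaTail (π / 2 - δ) (1 / 4 + I * (t / 2)) -
        1 / (1 / 4 + I * (t / 2)))).re
  set s : ℂ := 1 / 2 + I * t with hs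
  have hs₀ : s ≠ 0 := by
    intro h; have := congrArg re h; norm_num [hs] at this
  have hG : Gammaℝ s ≠ 0 := Gammaℝ_ne_zero_of_re_pos (by norm_num [hs])
  have hL : completedRiemannZeta s = ((rexp (-((π / 2 - δ) * t / 2)) * R : ℝ) : ℂ) := by
    rw [ofReal_mul, ← h, ← mul_assoc, ← ofReal_mul, ← Real.exp_add]
    simp
  have hX : XiF t = -(1 / 4 + t ^ 2) / 2 * (rexp (-((π / 2 - δ) * t / 2)) * R) := by
    rw [XiF, riemannZeta_def_of_ne_zero hs₀, hL]
    have e : s * (s - 1) / 2 * (π : ℂ) ^ (-s / 2) * Gamma (s / 2) *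
        (((rexp (-((π / 2 - δ) * t / 2)) * R : ℝ) : ℂ) / Gammaℝ s) =
        ((-(1 / 4 + t ^ 2) / 2 * (rexp (-((π / 2 - δ) * t / 2)) * R) : ℝ) : ℂ) := by
      have h1 : (π : ℂ) ^ (-s / 2) * Gamma (s / 2) = Gammaℝ s := by rw [Gammaℝ_def]
      have h2 : s * (s - 1) = -(1 / 4 + (t : ℂ) ^ 2) := by
        rw [hs]; linear_combination (t : ℂ) ^ 2 * I_sq
      rw [mul_assoc (s * (s - 1) / 2), h1, h2]
      field_simp
      push_cast
      ring
    rw [e, ofReal_re]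
  have he : rexp (π * t / 4) * rexp (-((π / 2 - δ) * t / 2)) = rexp (δ * t / 2) := by
    rw [← Real.exp_add]; congr 1; ring
  have hpos : (0 : ℝ) < 1 / 4 + t ^ 2 := by positivity
  rw [XHL, hX, ← he]
  field_simp

end Waves

section Block

open Complex MeasureTheory Set
open scoped Real

/-- The Fourier kernel of the interval `[0, H]`. -/
noncomputable def kern (H y : ℝ) : ℂ := ∫ u in (0 : ℝ)..H, exp (I * (u * y))

/-- The amplitude of the averaged truncated theta series. -/
noncomputable def amp (z : ℂ) (H : ℝ) (M : ℕ) (y : ℝ) : ℂ :=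
  (∑ n ∈ Finset.range M, wave z (n + 1) y) * kern H y

/-- The average over `[t, t + H]` of the truncated theta series. -/
noncomputable def block (z : ℂ) (H : ℝ) (M : ℕ) (t : ℝ) : ℂ :=
  ∫ y in Ioi (0 : ℝ), amp z H M y * exp (I * (t * y))

lemma continuous_kern (H : ℝ) : Continuous (kern H) := by
  refine intervalIntegral.continuous_parametric_intervalIntegral_of_continuous' ?_ 0 H
  fun_prop

lemma norm_kern_le {H : ℝ} (hH : 0 ≤ H) (y : ℝ) : ‖kern H y‖ ≤ H := by
  have := intervalIntegral.norm_integral_le_of_norm_le_const (a := 0) (b := H) (C := 1)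
    (f := fun u : ℝ ↦ exp (I * (u * y))) fun u _ ↦ (norm_exp_I_mul u y).le
  simpa [abs_of_nonneg hH, kern] using this

lemma integrableOn_wave_mul_exp {z : ℂ} (hz : 0 < z.re) {N : ℝ} (hN : 0 < N) (t : ℝ) :
    IntegrableOn (fun y : ℝ ↦ wave z N y * exp (I * (t * y))) (Ioi 0) := by
  refine (integrableOn_wave hz hN).mul_bdd (c := 1) ?_ ?_
  · exact (by fun_prop : Continuous fun y : ℝ ↦ exp (I * ((t : ℂ) * y))).aestronglyMeasurable
  · exact Eventually.of_forall fun y ↦ (norm_exp_I_mul t y).le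

lemma continuous_waveInt {z : ℂ} (hz : 0 < z.re) {N : ℝ} (hN : 0 < N) :
    Continuous (waveInt z N) := by
  refine continuous_of_dominated (bound := fun y ↦ ‖wave z N y‖) (fun t ↦ ?_) (fun t ↦ ?_)
    (integrableOn_wave hz hN).norm (Eventually.of_forall fun y ↦ by fun_prop)
  · exact (integrableOn_wave_mul_exp hz hN t).aestronglyMeasurable
  · refine Eventually.of_forall fun y ↦ ?_
    rw [norm_mul, norm_exp_I_mul, mul_one]

lemma integral_exp_shift (H t y : ℝ) :
    ∫ u in t..(t + H), exp (I * ((u : ℂ) * y)) = kern H y * exp (I * (t * y)) := by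
  have h := intervalIntegral.integral_comp_add_left (a := 0) (b := H)
    (fun u : ℝ ↦ exp (I * ((u : ℂ) * y))) t
  rw [add_zero] at h
  rw [← h, kern, ← intervalIntegral.integral_mul_const]
  refine intervalIntegral.integral_congr fun u _ ↦ ?_
  rw [← exp_add]
  congr 1
  push_cast
  ring

lemma integral_waveInt {z : ℂ} (hz : 0 < z.re) {N : ℝ} (hN : 0 < N) {H : ℝ} (hH : 0 ≤ H) (t : ℝ) :
    ∫ u in t..(t + H), waveInt z N u =
      ∫ y in Ioi (0 : ℝ), wave z N y * kern H y * exp (I * (t * y)) := by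
  rw [intervalIntegral.integral_of_le (by linarith)]
  simp only [waveInt]
  rw [integral_integral_swap]
  · refine setIntegral_congr_fun measurableSet_Ioi fun y _ ↦ ?_
    rw [integral_const_mul, ← intervalIntegral.integral_of_le (by linarith), integral_exp_shift,
      mul_assoc]
  · have h1 : Integrable (fun q : ℝ × ℝ ↦ (1 : ℂ) * wave z N q.2)
        ((volume.restrict (Ioc t (t + H))).prod (volume.restrict (Ioi 0))) :=
      Integrable.mul_prod (integrable_const 1) (integrableOn_wave hz hN)
    simp only [one_mul] at h1
    refine h1.mul_bdd (c := 1) ?_ ?_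
    · exact (by fun_prop : Continuous fun q : ℝ × ℝ ↦ exp (I * ((q.1 : ℂ) * q.2))).aestronglyMeasurable
    · exact Eventually.of_forall fun q ↦ (norm_exp_I_mul q.1 q.2).le

lemma integrableOn_wave_mul_kern {z : ℂ} (hz : 0 < z.re) {N : ℝ} (hN : 0 < N) {H : ℝ}
    (hH : 0 ≤ H) : IntegrableOn (fun y ↦ wave z N y * kern H y) (Ioi 0) :=
  (integrableOn_wave hz hN).mul_bdd (c := H) (continuous_kern H).aestronglyMeasurable
    (Eventually.of_forall fun y ↦ norm_kern_le hH y)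

lemma integrableOn_amp {z : ℂ} (hz : 0 < z.re) {H : ℝ} (hH : 0 ≤ H) (M : ℕ) :
    IntegrableOn (amp z H M) (Ioi 0) := by
  unfold amp
  simp_rw [Finset.sum_mul]
  exact integrable_finsetSum _ fun n _ ↦ integrableOn_wave_mul_kern hz (by positivity) hH

lemma integral_sum_waveInt {z : ℂ} (hz : 0 < z.re) {H : ℝ} (hH : 0 ≤ H) (M : ℕ) (t : ℝ) :
    ∫ u in t..(t + H), ∑ n ∈ Finset.range M, waveInt z (n + 1) u = block z H M t := by
  rw [intervalIntegral.integral_finsetSum fun n _ ↦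
    (continuous_waveInt hz (by positivity)).intervalIntegrable _ _]
  simp_rw [block, amp, Finset.sum_mul]
  rw [integral_finsetSum]
  · exact Finset.sum_congr rfl fun n _ ↦ integral_waveInt hz (by positivity) hH t
  · intro n _
    refine (integrableOn_wave_mul_kern hz (by positivity) hH).mul_bdd (c := 1) ?_ ?_
    · exact (by fun_prop : Continuous fun y : ℝ ↦ exp (I * ((t : ℂ) * y))).aestronglyMeasurable
    · exact Eventually.of_forall fun y ↦ (norm_exp_I_mul t y).le

/-- The weight relating `X` to the smoothed completed zeta function. -/
noncomputable def weight (T u : ℝ) : ℝ := 1 / 2 * u ^ (1 / 4 : ℝ) * rexp (u / (2 * T))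

/-- The direction of the ray used at height `T`. -/
noncomputable def ray (T : ℝ) : ℂ := exp (((π / 2 - 1 / T : ℝ) : ℂ) * I)

/-- The fourth root of the ray direction. -/
noncomputable def rayRoot (T : ℝ) : ℂ := exp (((π / 2 - 1 / T) / 4 : ℝ) * I)

lemma ray_re (T : ℝ) : (ray T).re = Real.sin (1 / T) := by
  rw [ray, exp_ofReal_mul_I_re, Real.cos_pi_div_two_sub]

lemma ray_im (T : ℝ) : (ray T).im = Real.cos (1 / T) := by
  rw [ray, exp_ofReal_mul_I_im, Real.sin_pi_div_two_sub]

lemma norm_rayRoot (T : ℝ) : ‖rayRoot T‖ = 1 := norm_exp_ofReal_mul_I _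

lemma sin_one_div_ge {T : ℝ} (hT : 1 ≤ T) : 1 / (2 * T) ≤ Real.sin (1 / T) := by
  have h0 : 0 < 1 / T := by positivity
  have h1 : 1 / T ≤ 1 := by rw [div_le_one (by linarith)]; exact hT
  have h := Real.sin_gt_sub_cube h0
  have : 1 / (2 * T) = 1 / T / 2 := by field_simp
  rw [this]
  nlinarith [mul_pos h0 h0, mul_nonneg h0.le (sub_nonneg.mpr h1), mul_nonneg (mul_pos h0 h0).le (sub_nonneg.mpr h1)]

lemma ray_re_pos {T : ℝ} (hT : 1 ≤ T) : 0 < (ray T).re := by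
  rw [ray_re]
  exact lt_of_lt_of_le (by positivity) (sin_one_div_ge hT)

lemma ray_re_rpow_le {T : ℝ} (hT : 1 ≤ T) : (ray T).re ^ (-(5 / 8) : ℝ) ≤ 2 * T ^ (5 / 8 : ℝ) := by
  have h0 : (0 : ℝ) < 1 / (2 * T) := by positivity
  rw [ray_re]
  calc Real.sin (1 / T) ^ (-(5 / 8) : ℝ) ≤ (1 / (2 * T)) ^ (-(5 / 8) : ℝ) :=
        Real.rpow_le_rpow_of_nonpos h0 (sin_one_div_ge hT) (by norm_num)
    _ = (2 * T) ^ (5 / 8 : ℝ) := by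
        rw [one_div, Real.inv_rpow (by positivity), Real.rpow_neg (by positivity), inv_inv]
    _ = 2 ^ (5 / 8 : ℝ) * T ^ (5 / 8 : ℝ) := Real.mul_rpow (by norm_num) (by linarith)
    _ ≤ 2 ^ (1 : ℝ) * T ^ (5 / 8 : ℝ) := by
        gcongr
        · norm_num
        · norm_num
    _ = _ := by rw [Real.rpow_one]

/-- The smoothed completed zeta function on the critical line. -/
noncomputable def zetaRay (T u : ℝ) : ℝ :=
  (rayRoot T * (thetaTail (π / 2 - 1 / T) (1 / 4 + I * (u / 2)) - 1 / (1 / 4 + I * (u / 2)))).re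

lemma cos_ray_pos {T : ℝ} (hT : 1 ≤ T) : 0 < Real.cos (π / 2 - 1 / T) := by
  rw [Real.cos_pi_div_two_sub]
  exact lt_of_lt_of_le (by positivity) (sin_one_div_ge hT)

lemma XHL_eq_weight_mul {T : ℝ} (hT : 1 ≤ T) (u : ℝ) : XHL u = weight T u * zetaRay T u := by
  have h1 : 1 / T ≤ 1 := by rw [div_le_one (by linarith)]; exact hT
  rw [XHL_eq_re (δ := 1 / T) (by positivity) (by linarith [Real.pi_gt_three]), weight, zetaRay,
    rayRoot]
  congr 3
  field_simp

lemma continuous_zetaRay {T : ℝ} (hT : 1 ≤ T) : Continuous (zetaRay T) := by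
  have h1 : 1 / T ≤ 1 := by rw [div_le_one (by linarith)]; exact hT
  have h0 : 0 < 1 / T := by positivity
  have hpi := Real.pi_gt_three
  have h (u : ℝ) : zetaRay T u =
      (((rexp ((π / 2 - 1 / T) * u / 2) : ℝ) : ℂ) * completedRiemannZeta (1 / 2 + I * u)).re := by
    rw [completedZeta_critical_line (cos_ray_pos hT) (by linarith) (by linarith), ofReal_re]
    rfl
  rw [show zetaRay T = _ from funext h]
  refine continuous_re.comp (Continuous.mul (by fun_prop) ?_)
  refine continuous_iff_continuousAt.mpr fun u ↦ ?_
  refine ContinuousAt.comp (f := fun u : ℝ ↦ (1 / 2 + I * u : ℂ))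
    (differentiableAt_completedZeta ?_ ?_).continuousAt (by fun_prop)
  · intro h; have := congrArg re h; norm_num at this
  · intro h; have := congrArg re h; norm_num at this

lemma continuousOn_XHL : ContinuousOn XHL (Ioi 0) := by
  rw [show XHL = _ from funext (XHL_eq_weight_mul le_rfl)]
  refine ContinuousOn.mul (ContinuousOn.mul (ContinuousOn.mul continuousOn_const ?_) (by fun_prop))
    (continuous_zetaRay le_rfl).continuousOn
  exact fun u hu ↦ (Real.continuousAt_rpow_const u _ (Or.inl (ne_of_gt hu))).continuousWithinAt

end Block

section BlockApprox

open Complex MeasureTheory Set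
open scoped Real

lemma exp_three_halves_le : rexp (3 / 2) ≤ 5 := by
  have h : rexp (3 / 2) ^ 2 = rexp 1 ^ 3 := by
    rw [← Real.exp_nat_mul, ← Real.exp_nat_mul]; norm_num
  have h1 : rexp 1 ^ 3 ≤ 25 := by
    have := Real.exp_one_lt_d9
    calc rexp 1 ^ 3 ≤ 2.7182818286 ^ 3 := by gcongr
      _ ≤ 25 := by norm_num
  nlinarith [Real.exp_pos (3 / 2)]

lemma weight_nonneg (T : ℝ) {u : ℝ} (hu : 0 ≤ u) : 0 ≤ weight T u := by
  unfold weight; positivity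

lemma weight_le {T u : ℝ} (hT : 0 < T) (hu₀ : 0 ≤ u) (hu : u ≤ 3 * T) :
    weight T u ≤ 5 * T ^ (1 / 4 : ℝ) := by
  have h1 : u ^ (1 / 4 : ℝ) ≤ 2 * T ^ (1 / 4 : ℝ) := by
    calc u ^ (1 / 4 : ℝ) ≤ (16 * T) ^ (1 / 4 : ℝ) :=
          Real.rpow_le_rpow hu₀ (by linarith) (by norm_num)
      _ = 16 ^ (1 / 4 : ℝ) * T ^ (1 / 4 : ℝ) := Real.mul_rpow (by norm_num) hT.le
      _ = 2 * T ^ (1 / 4 : ℝ) := by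
          rw [show (16 : ℝ) = 2 ^ (4 : ℝ) by norm_num, ← Real.rpow_mul (by norm_num)]
          norm_num
  have h2 : rexp (u / (2 * T)) ≤ 5 := by
    refine (Real.exp_le_exp.mpr ?_).trans exp_three_halves_le
    rw [div_le_div_iff₀ (by positivity) (by norm_num)]
    linarith
  calc weight T u ≤ 1 / 2 * (2 * T ^ (1 / 4 : ℝ)) * 5 := by
        unfold weight; gcongr
    _ = _ := by ring

lemma hasDerivAt_weight {T u : ℝ} (hT : 0 < T) (hu : 0 < u) :
    HasDerivAt (weight T) (weight T u * (1 / (4 * u) + 1 / (2 * T))) u := by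
  have h1 : HasDerivAt (fun u : ℝ ↦ u ^ (1 / 4 : ℝ)) (1 / 4 * u ^ (1 / 4 - 1 : ℝ)) u :=
    Real.hasDerivAt_rpow_const (Or.inl hu.ne')
  have h2 : HasDerivAt (fun u : ℝ ↦ rexp (u / (2 * T))) (rexp (u / (2 * T)) * (1 / (2 * T))) u :=
    ((hasDerivAt_id u).div_const (2 * T)).exp
  have h := ((h1.const_mul (1 / 2)).mul h2)
  refine h.congr_deriv ?_
  rw [weight, Real.rpow_sub_one hu.ne']
  field_simp

lemma abs_weight_sub_le {T t u : ℝ} (hT : 1 ≤ T) (ht : T ≤ t) (htu : t ≤ u) (hu : u ≤ 3 * T) :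
    |weight T u - weight T t| ≤ 4 * T ^ (-(3 / 4) : ℝ) * (u - t) := by
  have hT0 : 0 < T := by linarith
  have hderiv : ∀ x ∈ Icc t u, HasDerivWithinAt (weight T)
      (weight T x * (1 / (4 * x) + 1 / (2 * T))) (Icc t u) x := fun x hx ↦
    (hasDerivAt_weight hT0 (by linarith [hx.1])).hasDerivWithinAt
  have hbound : ∀ x ∈ Icc t u, ‖weight T x * (1 / (4 * x) + 1 / (2 * T))‖ ≤
      4 * T ^ (-(3 / 4) : ℝ) := by
    intro x hx
    have hxT : T ≤ x := ht.trans hx.1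
    have hx0 : 0 < x := by linarith
    have hw := weight_le hT0 hx0.le (hx.2.trans hu)
    rw [Real.norm_of_nonneg (mul_nonneg (weight_nonneg T hx0.le) (by positivity))]
    have h1 : 1 / (4 * x) + 1 / (2 * T) ≤ 3 / 4 * T⁻¹ := by
      have : 1 / (4 * x) ≤ 1 / (4 * T) := by gcongr
      calc _ ≤ 1 / (4 * T) + 1 / (2 * T) := by linarith
        _ = _ := by field_simp; norm_num
    calc _ ≤ 5 * T ^ (1 / 4 : ℝ) * (3 / 4 * T⁻¹) := by
          gcongr
      _ = 15 / 4 * (T ^ (1 / 4 : ℝ) * T ^ (-1 : ℝ)) := by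
          rw [Real.rpow_neg_one]; ring
      _ = 15 / 4 * T ^ (-(3 / 4) : ℝ) := by
          rw [← Real.rpow_add hT0]; norm_num
      _ ≤ _ := by gcongr; norm_num
  have := (convex_Icc t u).norm_image_sub_le_of_norm_hasDerivWithin_le hderiv hbound
    (left_mem_Icc.mpr htu) (right_mem_Icc.mpr htu)
  rwa [Real.norm_eq_abs, Real.norm_eq_abs, abs_of_nonneg (sub_nonneg.mpr htu)] at this

lemma norm_one_div_le {u : ℝ} (hu : 0 < u) : ‖(1 / (1 / 4 + I * ((u : ℂ) / 2)) : ℂ)‖ ≤ 2 / u := by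
  rw [norm_div, norm_one]
  have h : u / 2 ≤ ‖(1 / 4 + I * ((u : ℂ) / 2) : ℂ)‖ := by
    refine le_trans ?_ (abs_im_le_norm _)
    have : (1 / 4 + I * ((u : ℂ) / 2) : ℂ).im = u / 2 := by simp
    rw [this]
    exact le_abs_self _
  calc 1 / ‖(1 / 4 + I * ((u : ℂ) / 2) : ℂ)‖ ≤ 1 / (u / 2) := by gcongr
    _ = 2 / u := by field_simp

lemma norm_thetaTail_le {T : ℝ} (hT : 1 ≤ T) (u : ℝ) :
    ‖thetaTail (π / 2 - 1 / T) (1 / 4 + I * (u / 2))‖ ≤ 2 * waveConst * T ^ (5 / 8 : ℝ) := by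
  have h := norm_thetaTail_sub_sum_le (cos_ray_pos hT) u 0
  rw [Finset.range_zero, Finset.sum_empty, sub_zero] at h
  have h2 := ray_re_rpow_le hT
  rw [ray_re] at h2
  rw [Real.cos_pi_div_two_sub] at h
  have := waveConst_nonneg
  calc _ ≤ _ := h
    _ = waveConst * Real.sin (1 / T) ^ (-(5 / 8) : ℝ) := by simp
    _ ≤ waveConst * (2 * T ^ (5 / 8 : ℝ)) := by gcongr
    _ = _ := by ring

lemma abs_zetaRay_le {T u : ℝ} (hT : 1 ≤ T) (hu : T ≤ u) :
    |zetaRay T u| ≤ (2 * waveConst + 2) * T ^ (5 / 8 : ℝ) := by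
  refine (abs_re_le_norm _).trans ?_
  rw [norm_mul, norm_rayRoot, one_mul]
  refine (norm_sub_le _ _).trans ?_
  have h1 := norm_thetaTail_le hT u
  have h2 := norm_one_div_le (show 0 < u by linarith)
  have h3 : 2 / u ≤ 2 * T ^ (5 / 8 : ℝ) := by
    have : 2 / u ≤ 2 := by rw [div_le_iff₀ (by linarith)]; linarith
    have := Real.one_le_rpow hT (by norm_num : (0 : ℝ) ≤ 5 / 8)
    linarith
  linarith

lemma norm_block_le {T : ℝ} (hT : 1 ≤ T) {H : ℝ} (hH : 0 ≤ H) (M : ℕ) (t : ℝ) :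
    ‖block (ray T) H M t‖ ≤ 2 * waveConst * T ^ (5 / 8 : ℝ) * H := by
  have hz := ray_re_pos hT
  have hr := ray_re_rpow_le hT
  refine (norm_integral_le_integral_norm _).trans ?_
  simp_rw [norm_mul, norm_exp_I_mul, mul_one, amp, norm_mul]
  calc ∫ y in Ioi (0 : ℝ), ‖∑ n ∈ Finset.range M, wave (ray T) (n + 1) y‖ * ‖kern H y‖
      ≤ ∫ y in Ioi (0 : ℝ), (∑ n ∈ Finset.range M, ‖wave (ray T) (n + 1) y‖) * H := by
        refine integral_mono_of_nonneg (Eventually.of_forall fun y ↦ by positivity)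
          (Integrable.mul_const (integrable_finsetSum _ fun n _ ↦
            (integrableOn_wave hz (by positivity)).norm) H) (Eventually.of_forall fun y ↦ ?_)
        exact mul_le_mul (norm_sum_le _ _) (norm_kern_le hH y) (norm_nonneg _)
          (Finset.sum_nonneg fun _ _ ↦ norm_nonneg _)
    _ = (∑ n ∈ Finset.range M, ∫ y in Ioi (0 : ℝ), ‖wave (ray T) (n + 1) y‖) * H := by
        rw [integral_mul_const, integral_finsetSum _ fun n _ ↦
            (integrableOn_wave hz (by positivity)).norm]
    _ ≤ (∑ n ∈ Finset.range M, 6 * ((n : ℝ) + 1) ^ (-(5 / 4) : ℝ) * (2 * T ^ (5 / 8 : ℝ))) * H := by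
        gcongr with n _
        refine (integral_norm_wave_le hz (by positivity)).trans ?_
        have : rexp (-(π / 2 * ((n : ℝ) + 1) ^ 2 * (ray T).re)) ≤ 1 :=
          Real.exp_le_one_iff.mpr (neg_nonpos.mpr (by positivity))
        calc _ ≤ 6 * 1 * ((n : ℝ) + 1) ^ (-(5 / 4) : ℝ) * (2 * T ^ (5 / 8 : ℝ)) := by gcongr
          _ = _ := by ring
    _ ≤ waveConst * (2 * T ^ (5 / 8 : ℝ)) * H := by
        rw [← Finset.sum_mul]
        gcongr
        exact summable_waveConst.sum_le_tsum _ fun n _ ↦ by positivity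
    _ = _ := by ring

/-- The short integral of `X` is the weighted average of the truncated theta series, up to a
power-saving error. -/
lemma abs_integral_XHL_sub_le {T : ℝ} (hT : 1 ≤ T) {H : ℝ} (hH : 1 ≤ H) {M : ℕ}
    (hM : rexp (-(π / 2 * M ^ 2 * (ray T).re)) ≤ 1 / T ^ 2) {t : ℝ} (ht : T ≤ t)
    (htH : t + H ≤ 3 * T) :
    |(∫ u in t..(t + H), XHL u) - weight T t * (rayRoot T * block (ray T) H M t).re| ≤
      (18 * waveConst + 18) * H ^ 2 * T ^ (-(1 / 8) : ℝ) := by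
  have hz := ray_re_pos hT
  have hT0 : 0 < T := by linarith
  have ht0 : 0 < t := by linarith
  have hwc := waveConst_nonneg
  set D : ℝ → ℂ := fun u ↦ ∑ n ∈ Finset.range M, waveInt (ray T) (n + 1) u with hD
  have hDc : Continuous D := continuous_finsetSum _ fun n _ ↦ continuous_waveInt hz (by positivity)
  have hzc := continuous_zetaRay hT
  have hRe : ∫ u in t..(t + H), (rayRoot T * D u).re = (rayRoot T * block (ray T) H M t).re := by
    rw [← integral_sum_waveInt hz (by linarith), ← intervalIntegral.integral_const_mul]
    exact reCLM.intervalIntegral_comp_comm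
      ((continuous_const.mul hDc).intervalIntegrable t (t + H))
  have hle : t ≤ t + H := by linarith
  have hXc : ContinuousOn XHL (uIcc t (t + H)) := continuousOn_XHL.mono fun u hu ↦ by
    rw [uIcc_of_le hle] at hu
    exact lt_of_lt_of_le ht0 hu.1
  rw [← hRe, ← intervalIntegral.integral_const_mul, ← intervalIntegral.integral_sub
    hXc.intervalIntegrable (Continuous.intervalIntegrable (by fun_prop) _ _)]
  have hbound : ∀ u ∈ uIoc t (t + H), ‖XHL u - weight T t * (rayRoot T * D u).re‖ ≤
      (18 * waveConst + 18) * H * T ^ (-(1 / 8) : ℝ) := by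
    intro u hu
    rw [uIoc_of_le hle] at hu
    have hu3 : u ≤ 3 * T := hu.2.trans htH
    have huT : T ≤ u := ht.trans hu.1.le
    have hsplit : XHL u - weight T t * (rayRoot T * D u).re =
        (weight T u - weight T t) * zetaRay T u +
          weight T t * (zetaRay T u - (rayRoot T * D u).re) := by
      rw [XHL_eq_weight_mul hT]; ring
    have h1 : |(weight T u - weight T t) * zetaRay T u| ≤
        (8 * waveConst + 8) * H * T ^ (-(1 / 8) : ℝ) := by
      rw [abs_mul]
      calc _ ≤ (4 * T ^ (-(3 / 4) : ℝ) * H) * ((2 * waveConst + 2) * T ^ (5 / 8 : ℝ)) := by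
            refine mul_le_mul ((abs_weight_sub_le hT ht hu.1.le hu3).trans ?_)
              (abs_zetaRay_le hT huT) (abs_nonneg _) (by positivity)
            gcongr
            linarith [hu.2]
        _ = (8 * waveConst + 8) * H * (T ^ (-(3 / 4) : ℝ) * T ^ (5 / 8 : ℝ)) := by ring
        _ = _ := by rw [← Real.rpow_add hT0]; norm_num
    have h2 : |zetaRay T u - (rayRoot T * D u).re| ≤ (2 * waveConst + 2) * T ^ (-1 : ℝ) := by
      have e : zetaRay T u - (rayRoot T * D u).re =
          (rayRoot T * ((thetaTail (π / 2 - 1 / T) (1 / 4 + I * (u / 2)) - D u) -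
            1 / (1 / 4 + I * (u / 2)))).re := by
        rw [zetaRay, ← sub_re]; congr 1; ring
      rw [e]
      refine (abs_re_le_norm _).trans ?_
      rw [norm_mul, norm_rayRoot, one_mul]
      refine (norm_sub_le _ _).trans ?_
      have h3 := norm_thetaTail_sub_sum_le (cos_ray_pos hT) u M
      have h4 := norm_one_div_le (show 0 < u by linarith)
      have h5 := ray_re_rpow_le hT
      rw [ray_re] at hM h5
      rw [Real.cos_pi_div_two_sub] at h3
      have h6 : 2 / u ≤ 2 * T ^ (-1 : ℝ) := by
        rw [Real.rpow_neg_one, ← div_eq_mul_inv]; gcongr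
      have h7 : waveConst * rexp (-(π / 2 * M ^ 2 * Real.sin (1 / T))) *
          Real.sin (1 / T) ^ (-(5 / 8) : ℝ) ≤ 2 * waveConst * T ^ (-1 : ℝ) := by
        calc _ ≤ waveConst * (1 / T ^ 2) * (2 * T ^ (5 / 8 : ℝ)) := by
              have : 0 ≤ Real.sin (1 / T) ^ (-(5 / 8) : ℝ) := Real.rpow_nonneg (by
                rw [← ray_re]; exact hz.le) _
              gcongr
          _ = 2 * waveConst * (T ^ (-2 : ℝ) * T ^ (5 / 8 : ℝ)) := by
              rw [Real.rpow_neg hT0.le, Real.rpow_two]; ring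
          _ ≤ 2 * waveConst * T ^ (-1 : ℝ) := by
              rw [← Real.rpow_add hT0]
              gcongr
              norm_num
      have h8 : ‖thetaTail (π / 2 - 1 / T) (1 / 4 + I * (u / 2)) - D u‖ ≤ _ := h3
      linarith
    have h9 : |weight T t * (zetaRay T u - (rayRoot T * D u).re)| ≤
        (10 * waveConst + 10) * H * T ^ (-(1 / 8) : ℝ) := by
      rw [abs_mul, abs_of_nonneg (weight_nonneg T ht0.le)]
      calc _ ≤ (5 * T ^ (1 / 4 : ℝ)) * ((2 * waveConst + 2) * T ^ (-1 : ℝ)) :=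
            mul_le_mul (weight_le hT0 ht0.le (by linarith)) h2 (abs_nonneg _) (by positivity)
        _ = (10 * waveConst + 10) * 1 * (T ^ (1 / 4 : ℝ) * T ^ (-1 : ℝ)) := by ring
        _ ≤ _ := by
            rw [← Real.rpow_add hT0]
            gcongr
            norm_num
    rw [hsplit, Real.norm_eq_abs]
    refine (abs_add_le _ _).trans ?_
    linarith
  have := intervalIntegral.norm_integral_le_of_norm_le_const hbound
  rw [Real.norm_eq_abs, add_sub_cancel_left, abs_of_nonneg (by linarith : 0 ≤ H)] at this
  calc _ ≤ _ := this
    _ = _ := by ring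

end BlockApprox

section GaussianForms

open Complex MeasureTheory Set
open scoped Real

/-- The Gaussian window of width `Δ` centred at `m`. -/
noncomputable def gauss (Δ m t : ℝ) : ℝ := rexp (-((t - m) ^ 2 / Δ ^ 2))

lemma continuous_gauss (Δ m : ℝ) : Continuous (gauss Δ m) := by
  unfold gauss; fun_prop

lemma gauss_pos (Δ m t : ℝ) : 0 < gauss Δ m t := Real.exp_pos _

lemma gauss_le_one (Δ m t : ℝ) : gauss Δ m t ≤ 1 := by
  unfold gauss
  exact Real.exp_le_one_iff.mpr (neg_nonpos.mpr (by positivity))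

lemma integrable_gauss {Δ : ℝ} (hΔ : 0 < Δ) (m : ℝ) : Integrable (gauss Δ m) := by
  have h := (integrable_exp_neg_mul_sq (b := 1 / Δ ^ 2) (by positivity)).comp_sub_right m
  refine h.congr (Eventually.of_forall fun t ↦ ?_)
  simp only [gauss]
  congr 1; ring

lemma integral_gauss {Δ : ℝ} (hΔ : 0 < Δ) (m : ℝ) : ∫ t, gauss Δ m t = √π * Δ := by
  have h := integral_sub_right_eq_self (μ := volume) (fun t ↦ rexp (-(1 / Δ ^ 2) * t ^ 2)) m
  rw [integral_gaussian] at h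
  rw [show (fun t ↦ gauss Δ m t) = fun t ↦ rexp (-(1 / Δ ^ 2) * (t - m) ^ 2) by
    funext t; simp only [gauss]; congr 1; ring, h, div_div_eq_mul_div, div_one,
    Real.sqrt_mul Real.pi_pos.le, Real.sqrt_sq hΔ.le]

lemma integral_gauss_mul_exp {Δ : ℝ} (hΔ : 0 < Δ) (m x : ℝ) :
    ∫ t, (gauss Δ m t : ℂ) * exp (I * ((t : ℂ) * x)) =
      √π * Δ * (exp (I * ((m : ℂ) * x)) * rexp (-(Δ ^ 2 * x ^ 2 / 4))) := by
  have hb : 0 < ((1 / Δ ^ 2 : ℝ) : ℂ).re := by rw [ofReal_re]; positivity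
  have h := fourierIntegral_gaussian hb (x : ℂ)
  have h2 := integral_sub_right_eq_self (μ := volume)
    (fun t : ℝ ↦ exp (I * x * t) * exp (-((1 / Δ ^ 2 : ℝ) : ℂ) * (t : ℂ) ^ 2)) m
  rw [h] at h2
  have h3 : ∀ t : ℝ, (gauss Δ m t : ℂ) * exp (I * ((t : ℂ) * x)) =
      exp (I * ((m : ℂ) * x)) * (exp (I * x * ((t - m : ℝ) : ℂ)) *
        exp (-((1 / Δ ^ 2 : ℝ) : ℂ) * ((t - m : ℝ) : ℂ) ^ 2)) := by
    intro t
    rw [gauss, ofReal_exp, ← Complex.exp_add, ← Complex.exp_add, ← Complex.exp_add]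
    congr 1
    push_cast
    ring
  simp_rw [h3]
  rw [integral_const_mul, h2]
  have h4 : ((π : ℂ) / ((1 / Δ ^ 2 : ℝ) : ℂ)) ^ (1 / 2 : ℂ) = ((√π * Δ : ℝ) : ℂ) := by
    rw [← ofReal_div, show (1 / 2 : ℂ) = ((1 / 2 : ℝ) : ℂ) by norm_num,
      ← ofReal_cpow (by positivity), ← Real.sqrt_eq_rpow, div_div_eq_mul_div, div_one,
    Real.sqrt_mul Real.pi_pos.le, Real.sqrt_sq hΔ.le]
  rw [h4, ofReal_exp, show -(x : ℂ) ^ 2 / (4 * ((1 / Δ ^ 2 : ℝ) : ℂ)) =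
    ((-(Δ ^ 2 * x ^ 2 / 4) : ℝ) : ℂ) by
      push_cast; have : (Δ : ℂ) ≠ 0 := by exact_mod_cast hΔ.ne'
      field_simp]
  push_cast
  ring

lemma integrable_prod_gauss_mul {E : Type*} [MeasurableSpace E] {μ : Measure E} [SFinite μ]
    {F : E → ℂ} (hF : Integrable F μ) {φ : E → ℝ} (hφ : Measurable φ) {Δ : ℝ} (hΔ : 0 < Δ)
    (m : ℝ) :
    Integrable (fun q : ℝ × E ↦ (gauss Δ m q.1 : ℂ) *
      (F q.2 * exp (I * ((q.1 : ℂ) * φ q.2)))) (volume.prod μ) := by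
  have h1 : Integrable (fun q : ℝ × E ↦ (gauss Δ m q.1 : ℂ) * F q.2) (volume.prod μ) :=
    (integrable_gauss hΔ m).ofReal.mul_prod hF
  have h2 := h1.mul_bdd (c := 1) (g := fun q : ℝ × E ↦ exp (I * ((q.1 : ℂ) * φ q.2)))
    (Measurable.aestronglyMeasurable (by fun_prop))
    (Eventually.of_forall fun q ↦ (norm_exp_I_mul _ _).le)
  refine h2.congr (Eventually.of_forall fun q ↦ ?_)
  simp only [mul_assoc]

lemma integrable_gauss_mul_integral {E : Type*} [MeasurableSpace E] {μ : Measure E} [SFinite μ]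
    {F : E → ℂ} (hF : Integrable F μ) {φ : E → ℝ} (hφ : Measurable φ) {Δ : ℝ} (hΔ : 0 < Δ)
    (m : ℝ) :
    Integrable (fun t : ℝ ↦ (gauss Δ m t : ℂ) * ∫ p, F p * exp (I * ((t : ℂ) * φ p)) ∂μ) := by
  simp_rw [← integral_const_mul]
  exact (integrable_prod_gauss_mul hF hφ hΔ m).integral_prod_left

lemma integral_gauss_mul_integral {E : Type*} [MeasurableSpace E] {μ : Measure E} [SFinite μ]
    {F : E → ℂ} (hF : Integrable F μ) {φ : E → ℝ} (hφ : Measurable φ) {Δ : ℝ} (hΔ : 0 < Δ)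
    (m : ℝ) :
    ∫ t, (gauss Δ m t : ℂ) * ∫ p, F p * exp (I * ((t : ℂ) * φ p)) ∂μ =
      √π * Δ * ∫ p, F p * (exp (I * ((m : ℂ) * φ p)) * rexp (-(Δ ^ 2 * φ p ^ 2 / 4))) ∂μ := by
  have hinteg := integrable_prod_gauss_mul hF hφ hΔ m
  simp_rw [← integral_const_mul]
  rw [integral_integral_swap hinteg]
  refine integral_congr_ae (Eventually.of_forall fun p ↦ ?_)
  have h := integral_gauss_mul_exp hΔ m (φ p)
  calc ∫ t, (gauss Δ m t : ℂ) * (F p * exp (I * ((t : ℂ) * φ p)))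
      = ∫ t, F p * ((gauss Δ m t : ℂ) * exp (I * ((t : ℂ) * φ p))) := by
        congr 1; funext t; ring
    _ = _ := by rw [integral_const_mul, h]; ring

lemma integrable_comp_shear {f : ℝ × ℝ → ℂ} (hf : Integrable f (volume.prod volume)) :
    Integrable (fun z : ℝ × ℝ ↦ f (z.1, z.1 + z.2)) (volume.prod volume) :=
  ((measurePreserving_prod_add (volume : Measure ℝ) (volume : Measure ℝ)).integrable_comp_emb
    (MeasurableEquiv.shearAddRight ℝ).measurableEmbedding).mpr hf

lemma integral_comp_shift_pair (f : ℝ × ℝ → ℂ) (v : ℝ) :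
    ∫ y : ℝ, f (y, y + v) = ∫ y : ℝ, f (y - v / 2, y + v / 2) := by
  have h2 := integral_sub_right_eq_self (μ := volume) (fun y : ℝ ↦ f (y, y + v)) (v / 2)
  refine h2.symm.trans (integral_congr_ae (Eventually.of_forall fun y ↦ ?_))
  simp only
  congr 2; ring

lemma integrable_integral_shear {f : ℝ × ℝ → ℂ} (hf : Integrable f (volume.prod volume)) :
    Integrable (fun v : ℝ ↦ ∫ y : ℝ, f (y - v / 2, y + v / 2)) :=
  (integrable_comp_shear hf).integral_prod_right.congr
    (Eventually.of_forall fun v ↦ integral_comp_shift_pair f v)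

lemma integral_prod_eq_shear {f : ℝ × ℝ → ℂ} (hf : Integrable f (volume.prod volume)) :
    ∫ p, f p ∂(volume.prod volume) = ∫ v : ℝ, ∫ y : ℝ, f (y - v / 2, y + v / 2) := by
  have hmp := measurePreserving_prod_add (volume : Measure ℝ) (volume : Measure ℝ)
  rw [← hmp.integral_comp (MeasurableEquiv.shearAddRight ℝ).measurableEmbedding,
    integral_prod_symm _ (integrable_comp_shear hf)]
  exact integral_congr_ae (Eventually.of_forall fun v ↦ integral_comp_shift_pair f v)

lemma integrable_conj {a : ℝ → ℂ} (ha : Integrable a) :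
    Integrable (fun y ↦ (starRingEnd ℂ) (a y)) :=
  ⟨continuous_conj.comp_aestronglyMeasurable ha.1,
    ha.2.congr' (Eventually.of_forall fun y ↦ by simp)⟩

lemma integrable_autocorrelation {a : ℝ → ℂ} (ha : Integrable a) :
    Integrable (fun v : ℝ ↦ ∫ y, a (y - v / 2) * (starRingEnd ℂ) (a (y + v / 2))) :=
  integrable_integral_shear (ha.mul_prod (integrable_conj ha))

lemma integral_gauss_norm_sq {a : ℝ → ℂ} (ha : Integrable a) {Δ : ℝ} (hΔ : 0 < Δ) (m : ℝ) :
    ∫ t, (gauss Δ m t : ℂ) * ((‖∫ y, a y * exp (I * ((t : ℂ) * y))‖ ^ 2 : ℝ) : ℂ) =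
      √π * Δ * ∫ v : ℝ, exp (-(I * ((m : ℂ) * v))) * rexp (-(Δ ^ 2 * v ^ 2 / 4)) *
        ∫ y, a (y - v / 2) * (starRingEnd ℂ) (a (y + v / 2)) := by
  have hac := integrable_conj ha
  have hF : Integrable (fun p : ℝ × ℝ ↦ a p.1 * (starRingEnd ℂ) (a p.2))
    (volume.prod volume) := ha.mul_prod hac
  have h := integral_gauss_mul_integral hF (φ := fun p : ℝ × ℝ ↦ p.1 - p.2) (by fun_prop) hΔ m
  have hL : ∀ t : ℝ, ((‖∫ y, a y * exp (I * ((t : ℂ) * y))‖ ^ 2 : ℝ) : ℂ) =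
      ∫ p : ℝ × ℝ, a p.1 * (starRingEnd ℂ) (a p.2) *
        exp (I * ((t : ℂ) * ((p.1 - p.2 : ℝ) : ℂ))) ∂(volume.prod volume) := by
    intro t
    have h1 := mul_conj (∫ y, a y * exp (I * ((t : ℂ) * y)))
    rw [normSq_eq_norm_sq, ← integral_conj, ← integral_prod_mul] at h1
    rw [← h1]
    refine integral_congr_ae (Eventually.of_forall fun p ↦ ?_)
    simp only [map_mul, ← exp_conj, conj_I, conj_ofReal]
    rw [mul_mul_mul_comm, ← Complex.exp_add]
    congr 2
    push_cast; ring
  simp_rw [hL]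
  rw [h, integral_prod_eq_shear]
  · congr 1
    refine integral_congr_ae (Eventually.of_forall fun v ↦ ?_)
    simp only
    rw [← integral_const_mul]
    refine integral_congr_ae (Eventually.of_forall fun y ↦ ?_)
    simp only
    rw [show y - v / 2 - (y + v / 2) = -v by ring, neg_sq]
    push_cast
    rw [show I * ((m : ℂ) * -(v : ℂ)) = -(I * ((m : ℂ) * v)) by ring]
    ring
  · refine hF.mul_bdd (c := 1) (Measurable.aestronglyMeasurable (by fun_prop))
      (Eventually.of_forall fun p ↦ ?_)
    rw [norm_mul, norm_exp_I_mul, one_mul, norm_real, Real.norm_of_nonneg (Real.exp_pos _).le]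
    exact Real.exp_le_one_iff.mpr (neg_nonpos.mpr (by positivity))

lemma norm_integral_gauss_sq_le {a : ℝ → ℂ} (ha : IntegrableOn a (Ioi 0)) {Δ : ℝ} (hΔ : 0 < Δ)
    (m : ℝ) :
    ‖∫ t, (gauss Δ m t : ℂ) * (∫ y in Ioi 0, a y * exp (I * ((t : ℂ) * y))) ^ 2‖ ≤
      √π * Δ * (∫ y in Ioi 0, ‖a y‖ * rexp (-(Δ ^ 2 * y ^ 2 / 4))) ^ 2 := by
  set μ : Measure ℝ := volume.restrict (Ioi 0)
  have hF : Integrable (fun p : ℝ × ℝ ↦ a p.1 * a p.2) (μ.prod μ) := Integrable.mul_prod ha ha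
  have h := integral_gauss_mul_integral hF (φ := fun p : ℝ × ℝ ↦ p.1 + p.2) (by fun_prop) hΔ m
  have hL : ∀ t : ℝ, (∫ y, a y * exp (I * ((t : ℂ) * y)) ∂μ) ^ 2 =
      ∫ p : ℝ × ℝ, a p.1 * a p.2 * exp (I * ((t : ℂ) * ((p.1 + p.2 : ℝ) : ℂ))) ∂(μ.prod μ) := by
    intro t
    rw [sq, ← integral_prod_mul]
    refine integral_congr_ae (Eventually.of_forall fun p ↦ ?_)
    simp only
    rw [mul_mul_mul_comm, ← Complex.exp_add]
    congr 2
    push_cast; ring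
  simp_rw [hL]
  rw [h, norm_mul, norm_mul, norm_real, norm_real, Real.norm_of_nonneg (Real.sqrt_nonneg _),
    Real.norm_of_nonneg hΔ.le, sq (∫ y, _ ∂μ), ← integral_prod_mul]
  refine mul_le_mul_of_nonneg_left ?_ (by positivity)
  refine (norm_integral_le_integral_norm _).trans ?_
  have hg : Integrable (fun y ↦ ‖a y‖ * rexp (-(Δ ^ 2 * y ^ 2 / 4))) μ := by
    refine Integrable.mul_bdd (c := 1) ha.norm (Continuous.aestronglyMeasurable (by fun_prop))
      (Eventually.of_forall fun p ↦ ?_)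
    rw [Real.norm_of_nonneg (Real.exp_pos _).le]
    exact Real.exp_le_one_iff.mpr (neg_nonpos.mpr (by positivity))
  refine integral_mono_of_nonneg (Eventually.of_forall fun p ↦ norm_nonneg _)
    (hg.mul_prod hg) ?_
  have hpos : ∀ᵐ p ∂(μ.prod μ), p ∈ (Ioi (0 : ℝ)) ×ˢ (Ioi (0 : ℝ)) := by
    rw [Measure.prod_restrict]
    exact ae_restrict_mem (measurableSet_Ioi.prod measurableSet_Ioi)
  filter_upwards [hpos] with p hp
  have hp1 : 0 < p.1 := hp.1
  have hp2 : 0 < p.2 := hp.2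
  simp only [norm_mul]
  rw [norm_exp_I_mul, one_mul, norm_real, Real.norm_of_nonneg (Real.exp_pos _).le,
    mul_mul_mul_comm, ← Real.exp_add]
  gcongr
  nlinarith [mul_pos (sq_pos_of_pos hΔ) (mul_pos hp1 hp2)]

end GaussianForms

section KernelBounds

open Complex MeasureTheory Set
open scoped Real

lemma norm_kern_le_div (H : ℝ) {y : ℝ} (hy : y ≠ 0) : ‖kern H y‖ ≤ 2 / |y| := by
  have hc : I * (y : ℂ) ≠ 0 := mul_ne_zero I_ne_zero (by exact_mod_cast hy)
  have h : kern H y = (exp (I * y * H) - exp (I * y * (0 : ℝ))) / (I * y) := by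
    rw [← integral_exp_mul_complex hc, kern]
    refine intervalIntegral.integral_congr fun u _ ↦ ?_
    congr 1; ring
  rw [h, norm_div, norm_mul, norm_I, one_mul, norm_real, Real.norm_eq_abs]
  gcongr
  refine (norm_sub_le _ _).trans ?_
  rw [mul_assoc, mul_assoc, norm_exp_I_mul, norm_exp_I_mul]
  norm_num

/-- The derivative of `kern H`. -/
noncomputable def kernDeriv (H y : ℝ) : ℂ := ∫ u in (0 : ℝ)..H, I * u * exp (I * (u * y))

lemma hasDerivAt_kern (H y : ℝ) : HasDerivAt (kern H) (kernDeriv H y) y := by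
  have h := intervalIntegral.hasDerivAt_integral_of_dominated_loc_of_deriv_le
    (F := fun (y : ℝ) (u : ℝ) ↦ exp (I * ((u : ℂ) * y)))
    (F' := fun (y : ℝ) (u : ℝ) ↦ I * u * exp (I * ((u : ℂ) * y)))
    (μ := volume) (a := 0) (b := H) (x₀ := y) (s := univ) (bound := fun u ↦ |u|) univ_mem
    (Eventually.of_forall fun x ↦ Continuous.aestronglyMeasurable (by fun_prop))
    (Continuous.intervalIntegrable (by fun_prop) _ _)
    (Continuous.aestronglyMeasurable (by fun_prop))
    (Eventually.of_forall fun t _ x _ ↦ by simp [norm_exp_I_mul])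
    (continuous_abs.intervalIntegrable _ _)
    (Eventually.of_forall fun t _ x _ ↦ by
      have h1 : HasDerivAt (fun x : ℝ ↦ I * ((t : ℂ) * x)) (I * t) x := by
        simpa using ((ofRealCLM.hasDerivAt (x := x)).const_mul (t : ℂ)).const_mul I
      simpa [mul_comm] using h1.cexp)
  exact h.2

lemma continuous_kernDeriv (H : ℝ) : Continuous (kernDeriv H) := by
  unfold kernDeriv
  exact intervalIntegral.continuous_parametric_intervalIntegral_of_continuous' (by fun_prop) _ _

lemma norm_kernDeriv_le {H : ℝ} (hH : 0 ≤ H) (y : ℝ) : ‖kernDeriv H y‖ ≤ H ^ 2 := by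
  have h := intervalIntegral.norm_integral_le_of_norm_le_const
    (a := 0) (b := H) (C := H) (f := fun u : ℝ ↦ I * u * exp (I * (u * y))) (fun u hu ↦ by
      rw [uIoc_of_le hH] at hu
      rw [norm_mul, norm_exp_I_mul, norm_mul, norm_I, one_mul, mul_one, norm_real,
        Real.norm_of_nonneg hu.1.le]
      exact hu.2)
  rw [sub_zero, abs_of_nonneg hH] at h
  rw [sq]
  exact h

lemma norm_kern_sub_le {H : ℝ} (hH : 0 ≤ H) (x y : ℝ) :
    ‖kern H x - kern H y‖ ≤ H ^ 2 * |x - y| := by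
  have := Convex.norm_image_sub_le_of_norm_hasDerivWithin_le (f := kern H) (f' := kernDeriv H)
    (s := univ) (C := H ^ 2) (fun t _ ↦ (hasDerivAt_kern H t).hasDerivWithinAt)
    (fun t _ ↦ norm_kernDeriv_le hH t) convex_univ (mem_univ y) (mem_univ x)
  simpa [Real.norm_eq_abs] using this

lemma kern_neg (H y : ℝ) : kern H (-y) = (starRingEnd ℂ) (kern H y) := by
  rw [kern, kern, intervalIntegral, intervalIntegral, map_sub, ← integral_conj, ← integral_conj]
  congr 1 <;>
  · congr 1; funext u
    rw [← exp_conj, map_mul, map_mul, conj_I, conj_ofReal, conj_ofReal]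
    congr 1; push_cast; ring

lemma norm_kern_abs (H y : ℝ) : ‖kern H |y|‖ = ‖kern H y‖ := by
  rcases abs_choice y with h | h <;> rw [h]
  rw [kern_neg, norm_conj]

lemma norm_kern_sq_le {H : ℝ} (hH : 0 ≤ H) (y : ℝ) :
    ‖kern H y‖ ^ 2 ≤ (2 * H ^ 2 + 8) * (1 + y ^ 2)⁻¹ := by
  rw [← div_eq_mul_inv, le_div_iff₀ (by positivity)]
  have h1 := norm_kern_le hH y
  have h3 : ‖kern H y‖ * |y| ≤ 2 := by
    rcases eq_or_ne y 0 with rfl | hy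
    · simp
    · have := norm_kern_le_div H hy
      rwa [le_div_iff₀ (abs_pos.mpr hy)] at this
  have h4 : ‖kern H y‖ ^ 2 ≤ H ^ 2 := by gcongr
  have h5 : (‖kern H y‖ * |y|) ^ 2 ≤ 2 ^ 2 := by gcongr
  rw [mul_pow, sq_abs] at h5
  nlinarith [sq_nonneg H]

lemma integrable_norm_kern_sq {H : ℝ} (hH : 0 ≤ H) : Integrable (fun y ↦ ‖kern H y‖ ^ 2) := by
  refine (integrable_inv_one_add_sq.const_mul (2 * H ^ 2 + 8)).mono'
    ((continuous_kern H).norm.pow 2).aestronglyMeasurable (Eventually.of_forall fun y ↦ ?_)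
  rw [Real.norm_of_nonneg (by positivity)]
  exact norm_kern_sq_le hH y

lemma integral_indicator_mul_shift (H v : ℝ) :
    ∫ y, (Ioc 0 H).indicator (fun _ ↦ (1 : ℂ)) (y - v / 2) *
      (starRingEnd ℂ) ((Ioc 0 H).indicator (fun _ ↦ (1 : ℂ)) (y + v / 2)) =
      ((max (H - |v|) 0 : ℝ) : ℂ) := by
  have h : ∀ y : ℝ, (Ioc 0 H).indicator (fun _ ↦ (1 : ℂ)) (y - v / 2) *
      (starRingEnd ℂ) ((Ioc 0 H).indicator (fun _ ↦ (1 : ℂ)) (y + v / 2)) =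
      (Ioc (|v| / 2) (H - |v| / 2)).indicator (fun _ ↦ (1 : ℂ)) y := by
    intro y
    simp only [indicator_apply, mem_Ioc]
    have : (|v| / 2 < y ∧ y ≤ H - |v| / 2) ↔
        ((0 < y - v / 2 ∧ y - v / 2 ≤ H) ∧ (0 < y + v / 2 ∧ y + v / 2 ≤ H)) := by
      rcases abs_cases v with ⟨h, h'⟩ | ⟨h, h'⟩ <;> rw [h] <;> constructor <;> intro h'' <;>
        refine ⟨?_, ?_⟩ <;> (try constructor) <;> linarith [h''.1, h''.2]
    by_cases h1 : 0 < y - v / 2 ∧ y - v / 2 ≤ H <;> by_cases h2 : 0 < y + v / 2 ∧ y + v / 2 ≤ H <;>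
      simp [this, h1, h2]
  simp_rw [h]
  rw [integral_indicator_const _ measurableSet_Ioc, measureReal_def, Real.volume_Ioc,
    ENNReal.toReal_ofReal']
  simp [sub_sub]

lemma integral_gauss_mul_norm_kern_sq {H : ℝ} (hH : 0 ≤ H) {k : ℝ} (hk : 0 < k) :
    ∫ y, gauss k 0 y * ‖kern H y‖ ^ 2 =
      2 * √π * ∫ s : ℝ, rexp (-s ^ 2) * max (H - |2 / k * s|) 0 := by
  have ha : Integrable ((Ioc 0 H).indicator (fun _ ↦ (1 : ℂ))) :=
    (integrable_indicator_iff measurableSet_Ioc).mpr (by simp)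
  have h := integral_gauss_norm_sq ha hk 0
  have hK : ∀ t : ℝ, ∫ y, (Ioc 0 H).indicator (fun _ ↦ (1 : ℂ)) y * exp (I * ((t : ℂ) * y)) =
      kern H t := by
    intro t
    rw [kern, intervalIntegral.integral_of_le hH, ← integral_indicator measurableSet_Ioc]
    congr 1; funext y
    by_cases hy : y ∈ Ioc 0 H <;> simp [hy, mul_comm]
  simp_rw [hK, integral_indicator_mul_shift H] at h
  have hs := Measure.integral_comp_mul_left
    (fun v : ℝ ↦ rexp (-(k ^ 2 * v ^ 2 / 4)) * max (H - |v|) 0) (2 / k)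
  have hs2 : ∀ s : ℝ, -(k ^ 2 * (2 / k * s) ^ 2 / 4) = -s ^ 2 := by
    intro s; field_simp; ring
  simp_rw [hs2] at hs
  rw [hs, abs_of_pos (by positivity), smul_eq_mul]
  apply ofReal_injective
  calc ((∫ y, gauss k 0 y * ‖kern H y‖ ^ 2 : ℝ) : ℂ)
      = ∫ t, (gauss k 0 t : ℂ) * ((‖kern H t‖ ^ 2 : ℝ) : ℂ) := by
        rw [← integral_complex_ofReal]; simp
    _ = √π * k * ∫ v : ℝ, ((rexp (-(k ^ 2 * v ^ 2 / 4)) * max (H - |v|) 0 : ℝ) : ℂ) := by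
        rw [h]; simp
    _ = _ := by
        rw [integral_complex_ofReal]
        push_cast
        have : (k : ℂ) ≠ 0 := by exact_mod_cast hk.ne'
        field_simp

lemma integral_norm_kern_sq {H : ℝ} (hH : 0 ≤ H) :
    ∫ y in Ioi (0 : ℝ), ‖kern H y‖ ^ 2 = π * H := by
  have hL : Tendsto (fun n : ℕ ↦ ∫ y, gauss ((n : ℝ) + 1) 0 y * ‖kern H y‖ ^ 2) atTop
      (𝓝 (∫ y, ‖kern H y‖ ^ 2)) := by
    refine tendsto_integral_of_dominated_convergence (fun y ↦ ‖kern H y‖ ^ 2) (fun n ↦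
      ((continuous_gauss _ _).mul ((continuous_kern H).norm.pow 2)).aestronglyMeasurable)
      (integrable_norm_kern_sq hH) (fun n ↦ Eventually.of_forall fun y ↦ ?_)
      (Eventually.of_forall fun y ↦ ?_)
    · rw [Real.norm_of_nonneg (mul_nonneg (gauss_pos _ _ _).le (by positivity))]
      exact mul_le_of_le_one_left (by positivity) (gauss_le_one _ _ _)
    · have h1 : Tendsto (fun n : ℕ ↦ ((n : ℝ) + 1) ^ 2) atTop atTop :=
        (tendsto_pow_atTop (by norm_num)).comp
          (tendsto_atTop_add_const_right _ _ tendsto_natCast_atTop_atTop)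
      have h2 : Tendsto (fun n : ℕ ↦ gauss ((n : ℝ) + 1) 0 y) atTop (𝓝 1) := by
        have := (h1.const_div_atTop ((y - 0) ^ 2)).neg
        rw [neg_zero] at this
        simpa [gauss, Function.comp_def] using (Real.continuous_exp.tendsto 0).comp this
      simpa using h2.mul_const (‖kern H y‖ ^ 2)
  have hR : Tendsto (fun n : ℕ ↦ 2 * √π * ∫ s : ℝ, rexp (-s ^ 2) *
      max (H - |2 / ((n : ℝ) + 1) * s|) 0) atTop (𝓝 (2 * √π * ∫ s : ℝ, rexp (-s ^ 2) * H)) := by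
    refine Tendsto.const_mul _ ?_
    have hg : Integrable (fun s : ℝ ↦ rexp (-s ^ 2)) := by
      simpa using integrable_exp_neg_mul_sq (b := 1) one_pos
    refine tendsto_integral_of_dominated_convergence (fun s ↦ rexp (-s ^ 2) * H) (fun n ↦
      Continuous.aestronglyMeasurable (by fun_prop)) (hg.mul_const H)
      (fun n ↦ Eventually.of_forall fun s ↦ ?_) (Eventually.of_forall fun s ↦ ?_)
    · rw [Real.norm_of_nonneg (by positivity)]
      gcongr
      exact max_le (by linarith [abs_nonneg (2 / ((n : ℝ) + 1) * s)]) hH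
    · have h1 : Tendsto (fun n : ℕ ↦ (n : ℝ) + 1) atTop atTop :=
        tendsto_atTop_add_const_right _ _ tendsto_natCast_atTop_atTop
      have h2 : Tendsto (fun n : ℕ ↦ max (H - |2 / ((n : ℝ) + 1) * s|) 0) atTop
          (𝓝 (max (H - |0 * s|) 0)) :=
        (tendsto_const_nhds.sub (((h1.const_div_atTop 2).mul_const s).abs)).max tendsto_const_nhds
      simp only [zero_mul, abs_zero, sub_zero, max_eq_left hH] at h2
      exact h2.const_mul _
  have h := tendsto_nhds_unique hL (hR.congr fun n ↦
    (integral_gauss_mul_norm_kern_sq hH (by positivity)).symm)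
  have hg := integral_gaussian 1
  simp only [neg_mul, one_mul, div_one] at hg
  rw [integral_mul_const, hg] at h
  have hab := integral_comp_abs (f := fun y ↦ ‖kern H y‖ ^ 2)
  simp_rw [norm_kern_abs] at hab
  have hpi := Real.mul_self_sqrt Real.pi_pos.le
  rw [h] at hab
  nlinarith

end KernelBounds

section ByParts

open Complex MeasureTheory Set
open scoped Real

lemma hasDerivAt_exp_neg_exp (ζ : ℂ) (hζ : ζ ≠ 0) (y : ℝ) :
    HasDerivAt (fun y : ℝ ↦ -exp (-(π * ζ * rexp (2 * y))) / (2 * π * ζ))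
      (rexp (2 * y) * exp (-(π * ζ * rexp (2 * y)))) y := by
  have h1 : HasDerivAt (fun y : ℝ ↦ ((rexp (2 * y) : ℝ) : ℂ)) ((rexp (2 * y) * 2 : ℝ) : ℂ) y := by
    have : HasDerivAt (fun y : ℝ ↦ rexp (2 * y)) (rexp (2 * y) * 2) y := by
      simpa using ((hasDerivAt_id y).const_mul 2).exp
    exact this.ofReal_comp
  have h2 := (((h1.const_mul (π * ζ)).neg.cexp).neg).div_const (2 * π * ζ)
  refine h2.congr_deriv ?_
  have hpi : (π : ℂ) ≠ 0 := by exact_mod_cast Real.pi_ne_zero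
  simp only [Pi.neg_apply]
  push_cast
  field_simp

lemma integrableOn_exp_mul_exp_neg_exp {c : ℝ} (hc : 0 < c) (y₀ : ℝ) :
    IntegrableOn (fun y ↦ rexp (2 * y) * rexp (-(c * rexp (2 * y)))) (Ioi y₀) := by
  have hd : ∀ y : ℝ, HasDerivAt (fun y ↦ -rexp (-(c * rexp (2 * y))) / (2 * c))
      (rexp (2 * y) * rexp (-(c * rexp (2 * y)))) y := by
    intro y
    have h1 : HasDerivAt (fun y : ℝ ↦ rexp (2 * y)) (rexp (2 * y) * 2) y := by
      simpa using ((hasDerivAt_id y).const_mul 2).exp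
    refine (((h1.const_mul c).neg.exp).neg.div_const (2 * c)).congr_deriv ?_
    simp only [Pi.neg_apply]
    field_simp
  refine integrableOn_Ioi_deriv_of_nonneg' (l := 0) (fun y _ ↦ hd y) (fun y _ ↦ by positivity) ?_
  have h1 : Tendsto (fun y : ℝ ↦ c * rexp (2 * y)) atTop atTop :=
    (Real.tendsto_exp_atTop.comp (tendsto_id.const_mul_atTop two_pos)).const_mul_atTop hc
  have h2 := ((Real.tendsto_exp_neg_atTop_nhds_zero.comp h1).neg).div_const (2 * c)
  simpa using h2

lemma norm_exp_mul_cexp_neg_exp (ζ : ℂ) (y : ℝ) :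
    ‖(rexp (2 * y) : ℂ) * exp (-(π * ζ * rexp (2 * y)))‖ =
      rexp (2 * y) * rexp (-(π * ζ.re * rexp (2 * y))) := by
  rw [norm_mul, norm_real, Real.norm_of_nonneg (Real.exp_pos _).le, norm_exp, neg_re,
    re_mul_ofReal, re_ofReal_mul]

lemma integrableOn_oscillatory {ζ : ℂ} (hζ : 0 < ζ.re) {g : ℝ → ℂ} (hg : Continuous g) {P : ℝ}
    (hP : ∀ y, ‖g y‖ ≤ P) {l : ℝ} (hl : 0 ≤ l) {y₀ : ℝ} (hy₀ : 0 ≤ y₀) :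
    IntegrableOn (fun y : ℝ ↦ rexp (-(l * y)) * g y *
      (rexp (2 * y) * exp (-(π * ζ * rexp (2 * y))))) (Ioi y₀) := by
  have hP0 : 0 ≤ P := (norm_nonneg _).trans (hP 0)
  refine ((integrableOn_exp_mul_exp_neg_exp (mul_pos Real.pi_pos hζ) y₀).const_mul P).mono'
    (Continuous.aestronglyMeasurable (by fun_prop)) ?_
  filter_upwards [ae_restrict_mem measurableSet_Ioi] with y hy
  have hy' : 0 ≤ y := hy₀.trans (le_of_lt hy)
  rw [norm_mul, norm_exp_mul_cexp_neg_exp, norm_mul, norm_real,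
    Real.norm_of_nonneg (Real.exp_pos _).le]
  have h1 : rexp (-(l * y)) * ‖g y‖ ≤ 1 * P :=
    mul_le_mul (Real.exp_le_one_iff.mpr (by nlinarith)) (hP y) (norm_nonneg _) zero_le_one
  rw [one_mul] at h1
  exact mul_le_mul_of_nonneg_right h1 (by positivity)

lemma norm_integral_oscillatory_le {ζ : ℂ} (hζ : 0 < ζ.re) {g g' : ℝ → ℂ}
    (hg : ∀ y, HasDerivAt g (g' y) y) (hg' : Continuous g') {P Q : ℝ}
    (hP : ∀ y, ‖g y‖ ≤ P) (hQ : ∀ y, ‖g' y‖ ≤ Q) {l : ℝ} (hl : 1 ≤ l) {y₀ : ℝ} (hy₀ : 0 ≤ y₀) :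
    ‖∫ y in Ioi y₀, rexp (-(l * y)) * g y * (rexp (2 * y) * exp (-(π * ζ * rexp (2 * y))))‖ ≤
      (2 * P + Q) / (2 * π * ‖ζ‖) := by
  have hP0 : 0 ≤ P := (norm_nonneg _).trans (hP 0)
  have hQ0 : 0 ≤ Q := (norm_nonneg _).trans (hQ 0)
  have hζ0 : ζ ≠ 0 := by rintro rfl; simp at hζ
  have hζn : 0 < ‖ζ‖ := norm_pos_iff.mpr hζ0
  have hgc : Continuous g := continuous_iff_continuousAt.mpr fun y ↦ (hg y).continuousAt
  set u : ℝ → ℂ := fun y ↦ rexp (-(l * y)) * g y with hu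
  set u' : ℝ → ℂ := fun y ↦ ((rexp (-(l * y)) * -l : ℝ) : ℂ) * g y + rexp (-(l * y)) * g' y with hu'
  set v : ℝ → ℂ := fun y ↦ -exp (-(π * ζ * rexp (2 * y))) / (2 * π * ζ) with hv
  have hud : ∀ y, HasDerivAt u (u' y) y := by
    intro y
    have h1 : HasDerivAt (fun y : ℝ ↦ rexp (-(l * y))) (rexp (-(l * y)) * -l) y := by
      simpa using ((hasDerivAt_id y).const_mul l).neg.exp
    exact h1.ofReal_comp.mul (hg y)
  have hvd := hasDerivAt_exp_neg_exp ζ hζ0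
  have hvn : ∀ y, ‖v y‖ ≤ 1 / (2 * π * ‖ζ‖) := by
    intro y
    simp only [hv, norm_div, norm_neg, norm_mul, norm_real, Real.norm_of_nonneg Real.pi_pos.le,
      RCLike.norm_ofNat]
    gcongr
    rw [norm_exp, Real.exp_le_one_iff]
    simp only [neg_re, mul_re, ofReal_re, ofReal_im, mul_im]
    have := mul_pos (mul_pos Real.pi_pos hζ) (Real.exp_pos (2 * y))
    ring_nf at this ⊢
    linarith
  have hun : ∀ y, ‖u y‖ ≤ rexp (-(l * y)) * P := by
    intro y
    simp only [hu, norm_mul, norm_real, Real.norm_of_nonneg (Real.exp_pos _).le]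
    gcongr
    exact hP y
  have hu'n : ∀ y, ‖u' y‖ ≤ (l * P + Q) * rexp (-(l * y)) := by
    intro y
    refine (norm_add_le _ _).trans ?_
    simp only [norm_mul, norm_real, Real.norm_of_nonneg (Real.exp_pos _).le, norm_neg,
      Real.norm_of_nonneg (zero_le_one.trans hl)]
    nlinarith [mul_le_mul_of_nonneg_left (hP y) (mul_nonneg (Real.exp_pos (-(l * y))).le
      (zero_le_one.trans hl)), mul_le_mul_of_nonneg_left (hQ y) (Real.exp_pos (-(l * y))).le]
  have huc : Continuous u := by fun_prop
  have hu'c : Continuous u' := by fun_prop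
  have hvc : Continuous v := by fun_prop
  have hexp : IntegrableOn (fun y ↦ rexp (-(l * y))) (Ioi y₀) := by
    simpa using integrableOn_exp_mul_Ioi (a := -l) (by linarith) y₀
  have hu'v : IntegrableOn (u' * v) (Ioi y₀) := by
    refine ((hexp.const_mul (l * P + Q)).mul_const (1 / (2 * π * ‖ζ‖))).mono'
      (hu'c.mul hvc).aestronglyMeasurable (Eventually.of_forall fun y ↦ ?_)
    rw [Pi.mul_apply, norm_mul]
    exact mul_le_mul (hu'n y) (hvn y) (norm_nonneg _) (by positivity)
  have huv' : IntegrableOn (u * fun y ↦ rexp (2 * y) * exp (-(π * ζ * rexp (2 * y))))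
      (Ioi y₀) := integrableOn_oscillatory hζ hgc hP (by linarith) hy₀
  have hz : Tendsto (u * v) (𝓝[>] y₀) (𝓝 (u y₀ * v y₀)) :=
    ((huc.mul hvc).tendsto y₀).mono_left nhdsWithin_le_nhds
  have hi : Tendsto (u * v) atTop (𝓝 0) := by
    rw [tendsto_zero_iff_norm_tendsto_zero]
    have h0 : Tendsto (fun y : ℝ ↦ rexp (-(l * y)) * P * (1 / (2 * π * ‖ζ‖))) atTop (𝓝 0) := by
      have := (((Real.tendsto_exp_neg_atTop_nhds_zero.comp
        (tendsto_id.const_mul_atTop (zero_lt_one.trans_le hl))).mul_const P).mul_const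
        (1 / (2 * π * ‖ζ‖)))
      simpa using this
    refine squeeze_zero (fun _ ↦ norm_nonneg _) (fun y ↦ ?_) h0
    rw [Pi.mul_apply, norm_mul]
    exact mul_le_mul (hun y) (hvn y) (norm_nonneg _) (by positivity)
  have h := integral_Ioi_mul_deriv_eq_deriv_mul (fun y _ ↦ hud y) (fun y _ ↦ hvd y) huv' hu'v hz hi
  rw [h, zero_sub]
  have hb1 : ‖u y₀ * v y₀‖ ≤ P * (1 / (2 * π * ‖ζ‖)) := by
    rw [norm_mul]
    refine mul_le_mul ((hun y₀).trans (mul_le_of_le_one_left hP0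
      (Real.exp_le_one_iff.mpr (by nlinarith)))) (hvn _) (norm_nonneg _) hP0
  have hb2 : ‖∫ y in Ioi y₀, u' y * v y‖ ≤ (P + Q) * (1 / (2 * π * ‖ζ‖)) := by
    refine (norm_integral_le_integral_norm _).trans ?_
    calc ∫ y in Ioi y₀, ‖u' y * v y‖
        ≤ ∫ y in Ioi y₀, ((l * P + Q) * (1 / (2 * π * ‖ζ‖))) * rexp (-l * y) := by
          refine integral_mono_of_nonneg (Eventually.of_forall fun _ ↦ norm_nonneg _)
            ((integrableOn_exp_mul_Ioi (by linarith) y₀).const_mul _)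
            (Eventually.of_forall fun y ↦ ?_)
          simp only [norm_mul]
          calc ‖u' y‖ * ‖v y‖ ≤ ((l * P + Q) * rexp (-(l * y))) * (1 / (2 * π * ‖ζ‖)) :=
                mul_le_mul (hu'n y) (hvn y) (norm_nonneg _) (by positivity)
            _ = _ := by rw [neg_mul]; ring
      _ = ((l * P + Q) / l * rexp (-(l * y₀))) * (1 / (2 * π * ‖ζ‖)) := by
          rw [integral_const_mul, integral_exp_mul_Ioi (by linarith)]
          have : l ≠ 0 := by linarith
          field_simp
      _ ≤ _ := by
          refine mul_le_mul_of_nonneg_right ?_ (by positivity)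
          have h1 : rexp (-(l * y₀)) ≤ 1 := Real.exp_le_one_iff.mpr (by nlinarith)
          have h2 : (l * P + Q) / l ≤ P + Q := by
            rw [div_le_iff₀ (by linarith)]; nlinarith
          have h3 : 0 ≤ (l * P + Q) / l := by positivity
          nlinarith
  refine (norm_sub_le _ _).trans ?_
  rw [norm_neg]
  calc _ ≤ P * (1 / (2 * π * ‖ζ‖)) + (P + Q) * (1 / (2 * π * ‖ζ‖)) := add_le_add hb1 hb2
    _ = _ := by ring

end ByParts

section Correlations

open Complex MeasureTheory Set
open scoped Real

lemma integrableOn_exp_comp_exp {f : ℝ → ℝ} (hf : IntegrableOn f (Ioi 0)) {N : ℝ} (hN : 0 < N)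
    (y₀ : ℝ) : IntegrableOn (fun y ↦ rexp y * f (N * rexp y)) (Ioi y₀) ∧
      ∫ y in Ioi y₀, rexp y * f (N * rexp y) = 1 / N * ∫ x in Ioi (N * rexp y₀), f x := by
  have himg : (fun y ↦ N * rexp y) '' Ioi y₀ = Ioi (N * rexp y₀) := by
    ext x
    simp only [mem_image, mem_Ioi]
    constructor
    · rintro ⟨y, hy, rfl⟩
      gcongr
    · intro hx
      have hx0 : 0 < x := lt_trans (by positivity) hx
      refine ⟨Real.log (x / N), ?_, ?_⟩
      · rw [Real.lt_log_iff_exp_lt (by positivity), lt_div_iff₀ hN, mul_comm]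
        exact hx
      · rw [Real.exp_log (by positivity)]; field_simp
  have hd : ∀ y ∈ Ioi y₀, HasDerivWithinAt (fun y ↦ N * rexp y) (N * rexp y) (Ioi y₀) y :=
    fun y _ ↦ ((Real.hasDerivAt_exp y).const_mul N).hasDerivWithinAt
  have hinj : InjOn (fun y ↦ N * rexp y) (Ioi y₀) := fun a _ b _ hab ↦
    Real.exp_injective (mul_left_cancel₀ hN.ne' hab)
  have hsub : IntegrableOn f (Ioi (N * rexp y₀)) :=
    hf.mono_set (Ioi_subset_Ioi (by positivity))
  have h1 := integrableOn_image_iff_integrableOn_abs_deriv_smul measurableSet_Ioi hd hinj f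
  have h2 := integral_image_eq_integral_abs_deriv_smul measurableSet_Ioi hd hinj f
  rw [himg] at h1 h2
  have habs : ∀ y, |N * rexp y| • f (N * rexp y) = N * (rexp y * f (N * rexp y)) := fun y ↦ by
    rw [abs_of_pos (by positivity), smul_eq_mul, mul_assoc]
  simp_rw [habs] at h1 h2
  have h3 := (h1.mp hsub).const_mul (1 / N)
  refine ⟨?_, ?_⟩
  · refine h3.congr (Eventually.of_forall fun y ↦ ?_)
    simp only
    field_simp
  · rw [h2, integral_const_mul, ← mul_assoc, one_div_mul_cancel hN.ne', one_mul]

lemma integral_exp_mul_exp_neg_sq_le {N s : ℝ} (hN : 0 < N) (hs : 0 < s) :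
    IntegrableOn (fun y ↦ rexp y * rexp (-(π * N ^ 2 * s * rexp (2 * y)))) (Ioi 0) ∧
      ∫ y in Ioi (0 : ℝ), rexp y * rexp (-(π * N ^ 2 * s * rexp (2 * y))) ≤ 1 / (2 * N * √s) := by
  have hg : IntegrableOn (fun x : ℝ ↦ rexp (-(π * s) * x ^ 2)) (Ioi 0) :=
    (integrable_exp_neg_mul_sq (by positivity)).integrableOn
  obtain ⟨h1, h2⟩ := integrableOn_exp_comp_exp hg hN 0
  have he : ∀ y : ℝ, rexp (-(π * s) * (N * rexp y) ^ 2) = rexp (-(π * N ^ 2 * s * rexp (2 * y))) := by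
    intro y
    congr 1
    rw [mul_pow, ← Real.exp_nat_mul]
    push_cast
    ring
  simp_rw [he] at h1 h2
  refine ⟨h1, ?_⟩
  rw [h2]
  have h3 : ∫ x in Ioi (N * rexp 0), rexp (-(π * s) * x ^ 2) ≤
      ∫ x in Ioi (0 : ℝ), rexp (-(π * s) * x ^ 2) :=
    setIntegral_mono_set hg (Eventually.of_forall fun x ↦ (Real.exp_pos _).le)
      (Ioi_subset_Ioi (by positivity)).eventuallyLE
  rw [integral_gaussian_Ioi, show π / (π * s) = 1 / s by field_simp, Real.sqrt_div zero_le_one,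
    Real.sqrt_one] at h3
  calc 1 / N * ∫ x in Ioi (N * rexp 0), rexp (-(π * s) * x ^ 2)
      ≤ 1 / N * (1 / √s / 2) := by gcongr
    _ = _ := by field_simp

/-- The complex frequency of a product of two shifted waves. -/
noncomputable def pairFreq (z : ℂ) (N N' v : ℝ) : ℂ :=
  (N ^ 2 * rexp (-v) : ℝ) * z + (N' ^ 2 * rexp v : ℝ) * (starRingEnd ℂ) z

/-- The correlation at lag `v` of two waves weighted by `kern H`. -/
noncomputable def pairCorr (z : ℂ) (H N N' v : ℝ) : ℂ :=
  16 * ∫ y in Ioi (|v| / 2), rexp (-(1 * y)) *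
    (kern H (y - v / 2) * (starRingEnd ℂ) (kern H (y + v / 2))) *
      (rexp (2 * y) * exp (-(π * pairFreq z N N' v * rexp (2 * y))))

lemma pairFreq_re (z : ℂ) (N N' v : ℝ) :
    (pairFreq z N N' v).re = (N ^ 2 * rexp (-v) + N' ^ 2 * rexp v) * z.re := by
  rw [pairFreq, add_re, re_ofReal_mul, re_ofReal_mul, conj_re]; ring

lemma pairFreq_im (z : ℂ) (N N' v : ℝ) :
    (pairFreq z N N' v).im = (N ^ 2 * rexp (-v) - N' ^ 2 * rexp v) * z.im := by
  rw [pairFreq, add_im, im_ofReal_mul, im_ofReal_mul, conj_im]; ring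

lemma pairFreq_re_pos {z : ℂ} (hz : 0 < z.re) {N N' : ℝ} (hN : 0 < N) (v : ℝ) :
    0 < (pairFreq z N N' v).re := by
  rw [pairFreq_re]
  have : 0 ≤ N' ^ 2 * rexp v := by positivity
  have : 0 < N ^ 2 * rexp (-v) := by positivity
  exact mul_pos (by linarith) hz

lemma norm_kern_mul_kern_le {H : ℝ} (hH : 0 ≤ H) (x y : ℝ) :
    ‖kern H x * (starRingEnd ℂ) (kern H y)‖ ≤ H ^ 2 := by
  rw [norm_mul, norm_conj, sq]
  exact mul_le_mul (norm_kern_le hH _) (norm_kern_le hH _) (norm_nonneg _) hH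

lemma continuous_kern_mul_kern (H v : ℝ) :
    Continuous (fun y ↦ kern H (y - v / 2) * (starRingEnd ℂ) (kern H (y + v / 2))) :=
  ((continuous_kern H).comp (by fun_prop)).mul
    (continuous_conj.comp ((continuous_kern H).comp (by fun_prop)))

lemma norm_pairCorr_le {z : ℂ} (hz : 0 < z.re) {H : ℝ} (hH : 1 ≤ H) {N N' : ℝ} (hN : 0 < N)
    (v : ℝ) : ‖pairCorr z H N N' v‖ ≤ 64 * H ^ 3 / (2 * π * ‖pairFreq z N N' v‖) := by
  have hH0 : 0 ≤ H := by linarith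
  have hc : ∀ y, HasDerivAt (fun y ↦ (starRingEnd ℂ) (kern H (y + v / 2)))
      ((starRingEnd ℂ) (kernDeriv H (y + v / 2))) y := fun y ↦ by
    have h1 : HasDerivAt (fun y ↦ kern H (y + v / 2)) (kernDeriv H (y + v / 2)) y :=
      (hasDerivAt_kern H (y + v / 2)).comp_add_const y (v / 2)
    exact h1.star
  have hd : ∀ y, HasDerivAt (fun y ↦ kern H (y - v / 2) * (starRingEnd ℂ) (kern H (y + v / 2)))
      (kernDeriv H (y - v / 2) * (starRingEnd ℂ) (kern H (y + v / 2)) +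
        kern H (y - v / 2) * (starRingEnd ℂ) (kernDeriv H (y + v / 2))) y := fun y ↦
    ((hasDerivAt_kern H (y - v / 2)).comp_sub_const y (v / 2)).mul (hc y)
  have hcont : Continuous fun y ↦ kernDeriv H (y - v / 2) * (starRingEnd ℂ) (kern H (y + v / 2)) +
        kern H (y - v / 2) * (starRingEnd ℂ) (kernDeriv H (y + v / 2)) := by
    have h1 := continuous_kern H
    have h2 := continuous_kernDeriv H
    have h3 := continuous_conj
    fun_prop
  have hb : ∀ y, ‖kernDeriv H (y - v / 2) * (starRingEnd ℂ) (kern H (y + v / 2)) +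
        kern H (y - v / 2) * (starRingEnd ℂ) (kernDeriv H (y + v / 2))‖ ≤ 2 * H ^ 3 := fun y ↦ by
    refine (norm_add_le _ _).trans ?_
    rw [norm_mul, norm_mul, norm_conj, norm_conj]
    have h1 := mul_le_mul (norm_kernDeriv_le hH0 (y - v / 2)) (norm_kern_le hH0 (y + v / 2))
      (norm_nonneg _) (by positivity)
    have h2 := mul_le_mul (norm_kern_le hH0 (y - v / 2)) (norm_kernDeriv_le hH0 (y + v / 2))
      (norm_nonneg _) hH0
    linarith [show H ^ 2 * H + H * H ^ 2 = 2 * H ^ 3 by ring]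
  have h := norm_integral_oscillatory_le (pairFreq_re_pos hz hN (N' := N') v) hd hcont
    (fun y ↦ norm_kern_mul_kern_le hH0 _ _) hb le_rfl (y₀ := |v| / 2) (by positivity)
  rw [pairCorr, norm_mul, RCLike.norm_ofNat]
  have hpos : 0 < ‖pairFreq z N N' v‖ :=
    norm_pos_iff.mpr fun h0 ↦ by simpa [h0] using pairFreq_re_pos hz hN (N' := N') v
  calc _ ≤ 16 * ((2 * H ^ 2 + 2 * H ^ 3) / (2 * π * ‖pairFreq z N N' v‖)) := by gcongr
    _ ≤ 16 * ((2 * H ^ 3 + 2 * H ^ 3) / (2 * π * ‖pairFreq z N N' v‖)) := by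
        gcongr
        norm_num
    _ = _ := by ring

lemma abs_exp_sub_one_le_two_mul {v : ℝ} (hv : |v| ≤ 1) : |rexp v - 1| ≤ 2 * |v| := by
  have h := Complex.norm_exp_sub_one_le (x := (v : ℂ)) (by simpa using hv)
  rw [← ofReal_exp, ← ofReal_one, ← ofReal_sub, norm_real, norm_real] at h
  exact h

lemma norm_pairCorr_offDiag_le {z : ℂ} (hz : 0 < z.re) (hi : 1 / 2 ≤ z.im) {H : ℝ} (hH : 1 ≤ H)
    {M : ℕ} {v : ℝ} (hv : 8 * M * |v| ≤ 1) {n n' : ℕ} (hn : n < M) (hn' : n' < M) (hne : n ≠ n') :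
    ‖pairCorr z H (n + 1) (n' + 1) v‖ ≤
      48 * H ^ 3 * (1 / (((n : ℝ) + 1) * |(n : ℝ) - n'|)) := by
  have hnM : (n : ℝ) + 1 ≤ M := by exact_mod_cast hn
  have hnM' : (n' : ℝ) + 1 ≤ M := by exact_mod_cast hn'
  have hM : (1 : ℝ) ≤ M := by linarith [show (0 : ℝ) ≤ n from Nat.cast_nonneg n]
  have hn0 : (0 : ℝ) ≤ n := Nat.cast_nonneg n
  have hn0' : (0 : ℝ) ≤ n' := Nat.cast_nonneg n'
  have hv1 : |v| ≤ 1 := by nlinarith [abs_nonneg v]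
  have hgap : 1 ≤ |(n : ℝ) - n'| := by
    have : (1 : ℤ) ≤ |(n : ℤ) - n'| := Int.one_le_abs (by omega)
    exact_mod_cast this
  set N : ℝ := (n : ℝ) + 1
  set N' : ℝ := (n' : ℝ) + 1
  have hN1 : 1 ≤ N := by linarith
  have hN1' : 1 ≤ N' := by linarith
  have hsub : |N - N'| = |(n : ℝ) - n'| := by congr 1; simp only [N, N']; ring
  have hsq : |N ^ 2 - N' ^ 2| = (N + N') * |(n : ℝ) - n'| := by
    rw [← hsub, show N ^ 2 - N' ^ 2 = (N + N') * (N - N') by ring, abs_mul,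
      abs_of_pos (by linarith)]
  have h1 := abs_exp_sub_one_le_two_mul hv1
  have h2 := abs_exp_sub_one_le_two_mul (v := -v) (by rwa [abs_neg])
  rw [abs_neg] at h2
  have hdiff : |N ^ 2 * rexp (-v) - N' ^ 2 * rexp v - (N ^ 2 - N' ^ 2)| ≤ 1 / 2 * (N + N') := by
    calc |N ^ 2 * rexp (-v) - N' ^ 2 * rexp v - (N ^ 2 - N' ^ 2)|
        = |N ^ 2 * (rexp (-v) - 1) - N' ^ 2 * (rexp v - 1)| := by congr 1; ring
      _ ≤ N ^ 2 * |rexp (-v) - 1| + N' ^ 2 * |rexp v - 1| := by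
          refine (abs_sub _ _).trans (le_of_eq ?_)
          rw [abs_mul, abs_mul, abs_of_nonneg (sq_nonneg N), abs_of_nonneg (sq_nonneg N')]
      _ ≤ N ^ 2 * (2 * |v|) + N' ^ 2 * (2 * |v|) := by gcongr
      _ ≤ (M * N) * (2 * |v|) + (M * N') * (2 * |v|) := by
          gcongr <;> nlinarith
      _ = 1 / 4 * (8 * M * |v|) * (N + N') := by ring
      _ ≤ _ := by nlinarith [abs_nonneg v]
  have hlow : 1 / 2 * ((N + N') * |(n : ℝ) - n'|) ≤ |N ^ 2 * rexp (-v) - N' ^ 2 * rexp v| := by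
    have h3 := abs_sub_abs_le_abs_sub (N ^ 2 - N' ^ 2) (N ^ 2 * rexp (-v) - N' ^ 2 * rexp v)
    rw [abs_sub_comm (N ^ 2 - N' ^ 2)] at h3
    nlinarith
  have hζ : 1 / 4 * (N * |(n : ℝ) - n'|) ≤ ‖pairFreq z N N' v‖ := by
    refine le_trans ?_ (abs_im_le_norm _)
    rw [pairFreq_im, abs_mul, abs_of_pos (by linarith : 0 < z.im)]
    have h4 : 0 ≤ N * |(n : ℝ) - n'| := by positivity
    have h5 : 0 ≤ N' * |(n : ℝ) - n'| := by positivity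
    have h6 : 1 / 2 * (N * |(n : ℝ) - n'|) ≤ |N ^ 2 * rexp (-v) - N' ^ 2 * rexp v| := by nlinarith
    nlinarith
  refine (norm_pairCorr_le hz hH (by linarith) v).trans ?_
  have hpi := Real.pi_gt_three
  have hX : 0 < N * |(n : ℝ) - n'| := by positivity
  rw [mul_one_div]
  calc 64 * H ^ 3 / (2 * π * ‖pairFreq z N N' v‖)
      ≤ 64 * H ^ 3 / (2 * 3 * (1 / 4 * (N * |(n : ℝ) - n'|))) := by gcongr
    _ = (128 / 3) * (H ^ 3 / (N * |(n : ℝ) - n'|)) := by field_simp; norm_num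
    _ ≤ 48 * (H ^ 3 / (N * |(n : ℝ) - n'|)) := by gcongr; norm_num
    _ = _ := by ring

end Correlations

section CorrelationSums

open Complex MeasureTheory Set
open scoped Real

/-- The harmonic numbers, as real numbers. -/
noncomputable def harm (M : ℕ) : ℝ := ∑ n ∈ Finset.range M, 1 / ((n : ℝ) + 1)

lemma harm_le (M : ℕ) : harm M ≤ 1 + Real.log M := by
  have h := harmonic_le_one_add_log M
  simpa [harm, harmonic] using h

lemma harm_mono {K M : ℕ} (h : K ≤ M) : harm K ≤ harm M :=
  Finset.sum_le_sum_of_subset_of_nonneg (Finset.range_mono h) fun _ _ _ ↦ by positivity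

lemma harm_nonneg (M : ℕ) : 0 ≤ harm M := Finset.sum_nonneg fun _ _ ↦ by positivity

lemma one_le_harm {M : ℕ} (hM : 1 ≤ M) : 1 ≤ harm M := by
  simpa [harm] using harm_mono hM

lemma sum_inv_abs_sub_le {M n : ℕ} (hn : n < M) :
    ∑ n' ∈ Finset.range M, 1 / |(n : ℝ) - n'| ≤ 2 * harm M := by
  obtain ⟨k, rfl⟩ : ∃ k, M = n + (1 + k) := ⟨M - n - 1, by omega⟩
  rw [Finset.sum_range_add, Finset.sum_range_add]
  have h1 : ∑ x ∈ Finset.range n, 1 / |(n : ℝ) - x| = harm n := by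
    rw [harm, ← Finset.sum_range_reflect]
    refine Finset.sum_congr rfl fun j hj ↦ ?_
    have hj' := Finset.mem_range.mp hj
    have : ((n - 1 - j : ℕ) : ℝ) = n - 1 - j := by
      rw [Nat.cast_sub (by omega), Nat.cast_sub (by omega)]; simp
    have h0 : (j : ℝ) + 1 ≤ n := by exact_mod_cast hj'
    rw [this, abs_of_nonneg (by linarith)]
    congr 1; ring
  have h2 : ∑ x ∈ Finset.range k, 1 / |(n : ℝ) - ((n + (1 + x) : ℕ) : ℝ)| = harm k := by
    refine Finset.sum_congr rfl fun j _ ↦ ?_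
    rw [show (n : ℝ) - ((n + (1 + j) : ℕ) : ℝ) = -((j : ℝ) + 1) by push_cast; ring, abs_neg,
      abs_of_nonneg (by positivity)]
  rw [h1, h2]
  simp only [Finset.sum_range_one, add_zero, sub_self, abs_zero, div_zero, zero_add]
  linarith [harm_mono (show n ≤ n + (1 + k) by omega), harm_mono (show k ≤ n + (1 + k) by omega)]

lemma sum_offDiag_inv_le (M : ℕ) :
    ∑ n ∈ Finset.range M, ∑ n' ∈ Finset.range M, 1 / (((n : ℝ) + 1) * |(n : ℝ) - n'|) ≤
      2 * harm M ^ 2 := by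
  calc ∑ n ∈ Finset.range M, ∑ n' ∈ Finset.range M, 1 / (((n : ℝ) + 1) * |(n : ℝ) - n'|)
      = ∑ n ∈ Finset.range M, 1 / ((n : ℝ) + 1) * ∑ n' ∈ Finset.range M, 1 / |(n : ℝ) - n'| := by
        refine Finset.sum_congr rfl fun n _ ↦ ?_
        rw [Finset.mul_sum]
        exact Finset.sum_congr rfl fun n' _ ↦ by rw [one_div_mul_one_div]
    _ ≤ ∑ n ∈ Finset.range M, 1 / ((n : ℝ) + 1) * (2 * harm M) :=
        Finset.sum_le_sum fun n hn ↦ by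
          gcongr
          exact sum_inv_abs_sub_le (Finset.mem_range.mp hn)
    _ = _ := by rw [← Finset.sum_mul, ← harm]; ring

/-- The amplitude `amp z H M`, extended by zero to the negative half-line. -/
noncomputable def ampExt (z : ℂ) (H : ℝ) (M : ℕ) : ℝ → ℂ := (Ioi 0).indicator (amp z H M)

lemma integrable_ampExt {z : ℂ} (hz : 0 < z.re) {H : ℝ} (hH : 0 ≤ H) (M : ℕ) :
    Integrable (ampExt z H M) :=
  (integrable_indicator_iff measurableSet_Ioi).mpr (integrableOn_amp hz hH M)

lemma block_eq_integral_ampExt (z : ℂ) (H : ℝ) (M : ℕ) (t : ℝ) :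
    block z H M t = ∫ y, ampExt z H M y * exp (I * ((t : ℂ) * y)) := by
  rw [block, ← integral_indicator measurableSet_Ioi]
  congr 1; funext y
  by_cases hy : y ∈ Ioi (0 : ℝ) <;> simp [ampExt, hy]

/-- The autocorrelation of the amplitude. -/
noncomputable def corr (z : ℂ) (H : ℝ) (M : ℕ) (v : ℝ) : ℂ :=
  ∫ y, ampExt z H M (y - v / 2) * (starRingEnd ℂ) (ampExt z H M (y + v / 2))

lemma wave_mul_conj_wave (z : ℂ) (N N' v y : ℝ) :
    wave z N (y - v / 2) * (starRingEnd ℂ) (wave z N' (y + v / 2)) =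
      16 * (rexp (-(1 * y)) * (rexp (2 * y) * exp (-(π * pairFreq z N N' v * rexp (2 * y))))) := by
  have e1 : ∀ a b : ℝ, ((rexp a : ℝ) : ℂ) * ((rexp b : ℝ) : ℂ) = ((rexp (a + b) : ℝ) : ℂ) :=
    fun a b ↦ by rw [← ofReal_mul, Real.exp_add]
  simp only [wave, pairFreq, map_mul, conj_ofReal, map_ofNat, ← exp_conj, map_neg]
  rw [show (4 : ℂ) * (rexp ((y - v / 2) / 2) : ℂ) * exp (-((π * N ^ 2 * rexp (2 * (y - v / 2)) : ℝ) * z)) *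
    (4 * (rexp ((y + v / 2) / 2) : ℂ) * exp (-((π * N' ^ 2 * rexp (2 * (y + v / 2)) : ℝ) *
      (starRingEnd ℂ) z))) = 16 * ((rexp ((y - v / 2) / 2) : ℂ) * (rexp ((y + v / 2) / 2) : ℂ)) *
    (exp (-((π * N ^ 2 * rexp (2 * (y - v / 2)) : ℝ) * z)) *
    exp (-((π * N' ^ 2 * rexp (2 * (y + v / 2)) : ℝ) * (starRingEnd ℂ) z))) by ring, e1,
    ← Complex.exp_add]
  rw [← mul_assoc (rexp (-(1 * y)) : ℂ), e1, mul_assoc]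
  congr 4
  · ring
  · rw [show 2 * (y - v / 2) = 2 * y + -v by ring, show 2 * (y + v / 2) = 2 * y + v by ring,
      Real.exp_add, Real.exp_add]
    push_cast
    ring

lemma integrableOn_pairCorr {z : ℂ} (hz : 0 < z.re) {H : ℝ} (hH : 0 ≤ H) {N N' : ℝ} (hN : 0 < N)
    (v : ℝ) : IntegrableOn (fun y : ℝ ↦ (rexp (-(1 * y)) : ℂ) *
    (kern H (y - v / 2) * (starRingEnd ℂ) (kern H (y + v / 2))) *
      (rexp (2 * y) * exp (-(π * pairFreq z N N' v * rexp (2 * y))))) (Ioi (|v| / 2)) :=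
  integrableOn_oscillatory (pairFreq_re_pos hz hN (N' := N') v) (continuous_kern_mul_kern H v)
    (fun y ↦ norm_kern_mul_kern_le hH _ _) zero_le_one (by positivity)

lemma half_abs_lt_iff (v y : ℝ) : |v| / 2 < y ↔ 0 < y - v / 2 ∧ 0 < y + v / 2 := by
  rw [div_lt_iff₀ two_pos, abs_lt]
  constructor <;> rintro ⟨h₁, h₂⟩ <;> constructor <;> linarith

lemma corr_eq_sum {z : ℂ} (hz : 0 < z.re) {H : ℝ} (hH : 0 ≤ H) (M : ℕ) (v : ℝ) :
    corr z H M v = ∑ n ∈ Finset.range M, ∑ n' ∈ Finset.range M,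
      pairCorr z H ((n : ℝ) + 1) ((n' : ℝ) + 1) v := by
  have h : ∀ y, ampExt z H M (y - v / 2) * (starRingEnd ℂ) (ampExt z H M (y + v / 2)) =
      (Ioi (|v| / 2)).indicator (fun y ↦ ∑ n ∈ Finset.range M, ∑ n' ∈ Finset.range M,
        16 * ((rexp (-(1 * y)) : ℂ) *
        (kern H (y - v / 2) * (starRingEnd ℂ) (kern H (y + v / 2))) *
        (rexp (2 * y) * exp (-(π * pairFreq z ((n : ℝ) + 1) ((n' : ℝ) + 1) v
          * rexp (2 * y)))))) y := by
    intro y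
    by_cases hy : |v| / 2 < y
    · rw [indicator_of_mem (mem_Ioi.mpr hy)]
      obtain ⟨h1, h2⟩ := (half_abs_lt_iff v y).mp hy
      rw [ampExt, indicator_of_mem (mem_Ioi.mpr h1), indicator_of_mem (mem_Ioi.mpr h2), amp, amp,
        map_mul, map_sum, mul_mul_mul_comm, Finset.sum_mul_sum, Finset.sum_mul]
      refine Finset.sum_congr rfl fun n _ ↦ ?_
      rw [Finset.sum_mul]
      refine Finset.sum_congr rfl fun n' _ ↦ ?_
      rw [wave_mul_conj_wave]
      ring
    · rw [indicator_of_notMem (by simpa using hy)]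
      have h3 : ¬ (0 < y - v / 2 ∧ 0 < y + v / 2) := fun h ↦ hy ((half_abs_lt_iff v y).mpr h)
      by_cases h1 : 0 < y - v / 2
      · have h2 : ¬ 0 < y + v / 2 := fun h2 ↦ h3 ⟨h1, h2⟩
        rw [ampExt, indicator_of_notMem (a := y + v / 2) (by simpa using h2), map_zero, mul_zero]
      · rw [ampExt, indicator_of_notMem (a := y - v / 2) (by simpa using h1), zero_mul]
  rw [corr]
  simp_rw [h]
  have hinteg : ∀ n n' : ℕ, IntegrableOn (fun y : ℝ ↦ 16 * ((rexp (-(1 * y)) : ℂ) *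
        (kern H (y - v / 2) * (starRingEnd ℂ) (kern H (y + v / 2))) *
        (rexp (2 * y) * exp (-(π * pairFreq z ((n : ℝ) + 1) ((n' : ℝ) + 1) v
          * rexp (2 * y)))))) (Ioi (|v| / 2)) := fun n n' ↦
    (integrableOn_pairCorr hz hH (by positivity) v).const_mul 16
  rw [integral_indicator measurableSet_Ioi, integral_finsetSum _ fun n _ ↦
    integrable_finsetSum _ fun n' _ ↦ hinteg n n']
  refine Finset.sum_congr rfl fun n _ ↦ ?_
  rw [integral_finsetSum _ fun n' _ ↦ hinteg n n']
  refine Finset.sum_congr rfl fun n' _ ↦ ?_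
  rw [integral_const_mul, pairCorr]

lemma norm_corr_sub_diag_le {z : ℂ} (hz : 0 < z.re) (hi : 1 / 2 ≤ z.im) {H : ℝ} (hH : 1 ≤ H)
    {M : ℕ} {v : ℝ} (hv : 8 * M * |v| ≤ 1) :
    ‖corr z H M v - ∑ n ∈ Finset.range M, pairCorr z H ((n : ℝ) + 1) ((n : ℝ) + 1) v‖ ≤
      96 * H ^ 3 * harm M ^ 2 := by
  rw [corr_eq_sum hz (by linarith), ← Finset.sum_sub_distrib]
  have h : ∀ n ∈ Finset.range M, ‖(∑ n' ∈ Finset.range M,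
      pairCorr z H ((n : ℝ) + 1) ((n' : ℝ) + 1) v) - pairCorr z H ((n : ℝ) + 1) ((n : ℝ) + 1) v‖ ≤
      ∑ n' ∈ Finset.range M, 48 * H ^ 3 * (1 / (((n : ℝ) + 1) * |(n : ℝ) - n'|)) := by
    intro n hn
    rw [← Finset.sum_erase_eq_sub hn]
    refine (norm_sum_le _ _).trans ?_
    refine (Finset.sum_le_sum fun n' hn' ↦ norm_pairCorr_offDiag_le hz hi hH hv
      (Finset.mem_range.mp hn) (Finset.mem_range.mp (Finset.mem_of_mem_erase hn'))
      (Finset.ne_of_mem_erase hn').symm).trans ?_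
    exact Finset.sum_le_sum_of_subset_of_nonneg (Finset.erase_subset _ _)
      fun _ _ _ ↦ by positivity
  refine (norm_sum_le _ _).trans ((Finset.sum_le_sum h).trans ?_)
  simp_rw [← Finset.mul_sum]
  have := sum_offDiag_inv_le M
  have h0 : 0 ≤ H ^ 3 := by positivity
  nlinarith

lemma norm_amp_le {z : ℂ} (hz : 0 < z.re) {H : ℝ} (hH : 0 ≤ H) (M : ℕ) {y : ℝ} (hy : 0 ≤ y) :
    ‖amp z H M y‖ ≤ waveConst * z.re ^ (-(5 / 8) : ℝ) * H := by
  rw [amp, norm_mul]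
  refine mul_le_mul ?_ (norm_kern_le hH y) (norm_nonneg _)
    (mul_nonneg waveConst_nonneg (by positivity))
  calc ‖∑ n ∈ Finset.range M, wave z ((n : ℝ) + 1) y‖
      ≤ ∑ n ∈ Finset.range M, 6 * ((n : ℝ) + 1) ^ (-(5 / 4) : ℝ) * z.re ^ (-(5 / 8) : ℝ) := by
        refine (norm_sum_le _ _).trans (Finset.sum_le_sum fun n _ ↦ ?_)
        refine (norm_wave_le hz (by positivity) hy).trans ?_
        have h1 : rexp (-(π / 2 * ((n : ℝ) + 1) ^ 2 * z.re)) ≤ 1 :=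
          Real.exp_le_one_iff.mpr (neg_nonpos.mpr (by positivity))
        have h2 : rexp (-(3 / 4) * y) ≤ 1 := Real.exp_le_one_iff.mpr (by linarith)
        calc _ ≤ 4 * 1 * ((n : ℝ) + 1) ^ (-(5 / 4) : ℝ) * z.re ^ (-(5 / 8) : ℝ) * 1 := by gcongr
          _ ≤ _ := by
            have : 0 ≤ ((n : ℝ) + 1) ^ (-(5 / 4) : ℝ) * z.re ^ (-(5 / 8) : ℝ) := by positivity
            nlinarith
    _ ≤ waveConst * z.re ^ (-(5 / 8) : ℝ) := by
        rw [← Finset.sum_mul]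
        gcongr
        exact summable_waveConst.sum_le_tsum _ fun _ _ ↦ by positivity

lemma integral_norm_amp_le {z : ℂ} (hz : 0 < z.re) {H : ℝ} (hH : 0 ≤ H) (M : ℕ) :
    ∫ y in Ioi (0 : ℝ), ‖amp z H M y‖ ≤ waveConst * z.re ^ (-(5 / 8) : ℝ) * H := by
  have hw : ∀ n : ℕ, IntegrableOn (fun y ↦ ‖wave z ((n : ℝ) + 1) y‖) (Ioi 0) := fun n ↦
    (integrableOn_wave hz (by positivity)).norm
  calc ∫ y in Ioi (0 : ℝ), ‖amp z H M y‖
      ≤ ∫ y in Ioi (0 : ℝ), (∑ n ∈ Finset.range M, ‖wave z ((n : ℝ) + 1) y‖) * H := by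
        refine integral_mono_of_nonneg (Eventually.of_forall fun _ ↦ norm_nonneg _)
          ((integrable_finsetSum _ fun n _ ↦ hw n).mul_const H) (Eventually.of_forall fun y ↦ ?_)
        simp only [amp, norm_mul]
        exact mul_le_mul (norm_sum_le _ _) (norm_kern_le hH y) (norm_nonneg _) (by positivity)
    _ = (∑ n ∈ Finset.range M, ∫ y in Ioi (0 : ℝ), ‖wave z ((n : ℝ) + 1) y‖) * H := by
        rw [integral_mul_const, integral_finsetSum _ fun n _ ↦ hw n]
    _ ≤ (∑ n ∈ Finset.range M, 6 * ((n : ℝ) + 1) ^ (-(5 / 4) : ℝ) * z.re ^ (-(5 / 8) : ℝ)) * H := by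
        gcongr with n _
        refine (integral_norm_wave_le hz (by positivity)).trans ?_
        have h1 : rexp (-(π / 2 * ((n : ℝ) + 1) ^ 2 * z.re)) ≤ 1 :=
          Real.exp_le_one_iff.mpr (neg_nonpos.mpr (by positivity))
        calc _ ≤ 6 * 1 * ((n : ℝ) + 1) ^ (-(5 / 4) : ℝ) * z.re ^ (-(5 / 8) : ℝ) := by gcongr
          _ = _ := by ring
    _ ≤ _ := by
        rw [← Finset.sum_mul]
        gcongr
        exact summable_waveConst.sum_le_tsum _ fun _ _ ↦ by positivity

lemma norm_corr_le {z : ℂ} (hz : 0 < z.re) {H : ℝ} (hH : 0 ≤ H) (M : ℕ) (v : ℝ) :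
    ‖corr z H M v‖ ≤ (waveConst * z.re ^ (-(5 / 8) : ℝ) * H) ^ 2 := by
  have hS : 0 ≤ waveConst * z.re ^ (-(5 / 8) : ℝ) * H :=
    mul_nonneg (mul_nonneg waveConst_nonneg (by positivity)) hH
  have hb : ∀ y, ‖ampExt z H M y‖ ≤ waveConst * z.re ^ (-(5 / 8) : ℝ) * H := fun y ↦ by
    by_cases hy : 0 < y
    · rw [ampExt, indicator_of_mem (mem_Ioi.mpr hy)]
      exact norm_amp_le hz hH M hy.le
    · rw [ampExt, indicator_of_notMem (by simpa using hy), norm_zero]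
      exact hS
  have hI : ∫ y, ‖ampExt z H M y‖ ≤ waveConst * z.re ^ (-(5 / 8) : ℝ) * H := by
    refine le_of_eq_of_le ?_ (integral_norm_amp_le hz hH M)
    rw [← integral_indicator measurableSet_Ioi]
    congr 1; funext y
    rw [ampExt, norm_indicator_eq_indicator_norm]
  refine (norm_integral_le_integral_norm _).trans ?_
  calc ∫ y, ‖ampExt z H M (y - v / 2) * (starRingEnd ℂ) (ampExt z H M (y + v / 2))‖
      ≤ ∫ y, ‖ampExt z H M (y - v / 2)‖ * (waveConst * z.re ^ (-(5 / 8) : ℝ) * H) := by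
        refine integral_mono_of_nonneg (Eventually.of_forall fun _ ↦ norm_nonneg _)
          (((integrable_ampExt hz hH M).norm.comp_sub_right (v / 2)).mul_const _)
          (Eventually.of_forall fun y ↦ ?_)
        simp only [norm_mul, norm_conj]
        exact mul_le_mul_of_nonneg_left (hb _) (norm_nonneg _)
    _ = (∫ y, ‖ampExt z H M y‖) * (waveConst * z.re ^ (-(5 / 8) : ℝ) * H) := by
        rw [integral_mul_const, integral_sub_right_eq_self (fun y ↦ ‖ampExt z H M y‖)]
    _ ≤ _ := by rw [sq]; gcongr

end CorrelationSums

section Diagonal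

open Complex MeasureTheory Set
open scoped Real

lemma norm_exp_neg_sub_exp_neg_le {x : ℝ} {w₀ w₁ : ℂ} (h₀ : x ≤ w₀.re) (h₁ : x ≤ w₁.re) :
    ‖exp (-w₁) - exp (-w₀)‖ ≤ rexp (-x) * ‖w₁ - w₀‖ := by
  refine Convex.norm_image_sub_le_of_norm_hasDerivWithin_le (s := {w : ℂ | x ≤ w.re})
    (f := fun w ↦ exp (-w)) (f' := fun w ↦ exp (-w) * -1) (fun w _ ↦ ?_) (fun w hw ↦ ?_)
    (convex_halfSpace_re_ge x) h₀ h₁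
  · exact ((hasDerivAt_neg w).cexp).hasDerivWithinAt
  · rw [norm_mul, norm_neg, norm_one, mul_one, norm_exp, neg_re]
    exact Real.exp_le_exp.mpr (neg_le_neg hw)

lemma abs_exp_sub_quadratic_le {v : ℝ} (hv : |v| ≤ 1) :
    |rexp v - (1 + v + v ^ 2 / 2)| ≤ |v| ^ 3 * (2 / 9) := by
  have h := Real.exp_bound hv (n := 3) (by norm_num)
  simp [Finset.sum_range_succ, Nat.factorial] at h
  norm_num at h
  exact h

lemma abs_exp_sub_exp_neg_sub_le {v : ℝ} (hv : |v| ≤ 1) :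
    |(rexp v - rexp (-v)) / 2 - v| ≤ |v| ^ 3 := by
  have h1 := abs_le.mp (abs_exp_sub_quadratic_le hv)
  have h2 := abs_le.mp (abs_exp_sub_quadratic_le (v := -v) (by rwa [abs_neg]))
  rw [abs_neg] at h2
  have h3 : 0 ≤ |v| ^ 3 := by positivity
  rw [abs_le]
  constructor <;> nlinarith

lemma abs_exp_add_exp_neg_sub_le {v : ℝ} (hv : |v| ≤ 1) :
    0 ≤ (rexp v + rexp (-v)) / 2 - 1 ∧ (rexp v + rexp (-v)) / 2 - 1 ≤ v ^ 2 := by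
  have h1 := abs_le.mp (abs_exp_sub_quadratic_le hv)
  have h2 := abs_le.mp (abs_exp_sub_quadratic_le (v := -v) (by rwa [abs_neg]))
  rw [abs_neg] at h2
  have h3 : |v| ^ 3 ≤ v ^ 2 := by
    rw [← sq_abs v, pow_succ]
    exact mul_le_of_le_one_right (by positivity) hv
  refine ⟨?_, by nlinarith⟩
  nlinarith [Real.add_one_le_exp v, Real.add_one_le_exp (-v)]

/-- The linearisation at `v = 0` of the diagonal frequency `pairFreq z N N v`. -/
noncomputable def modelFreq (z : ℂ) (N v : ℝ) : ℂ := (2 * N ^ 2 : ℝ) * (z.re - I * (z.im * v))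

/-- The diagonal correlation with linearised frequency and unshifted kernels. -/
noncomputable def modelCorr (z : ℂ) (H N v : ℝ) : ℂ :=
  16 * ∫ y in Ioi (0 : ℝ), rexp (-(1 * y)) * ((‖kern H y‖ ^ 2 : ℝ) : ℂ) *
      (rexp (2 * y) * exp (-(π * modelFreq z N v * rexp (2 * y))))

lemma modelFreq_re (z : ℂ) (N v : ℝ) : (modelFreq z N v).re = 2 * N ^ 2 * z.re := by
  rw [modelFreq, re_ofReal_mul]; simp

lemma modelFreq_im (z : ℂ) (N v : ℝ) : (modelFreq z N v).im = -(2 * N ^ 2 * (z.im * v)) := by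
  rw [modelFreq, im_ofReal_mul]; simp

lemma norm_pairFreq_sub_modelFreq_le {z : ℂ} (hz : 0 < z.re) (hi : |z.im| ≤ 1) (N : ℝ) {v : ℝ}
    (hv : |v| ≤ 1) : ‖pairFreq z N N v - modelFreq z N v‖ ≤
      2 * N ^ 2 * (z.re * v ^ 2 + |v| ^ 3) := by
  have hre : (pairFreq z N N v - modelFreq z N v).re =
      2 * N ^ 2 * (z.re * ((rexp v + rexp (-v)) / 2 - 1)) := by
    rw [sub_re, pairFreq_re, modelFreq_re]; ring
  have him : (pairFreq z N N v - modelFreq z N v).im =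
      -(2 * N ^ 2 * (z.im * ((rexp v - rexp (-v)) / 2 - v))) := by
    rw [sub_im, pairFreq_im, modelFreq_im]; ring
  refine (norm_le_abs_re_add_abs_im _).trans ?_
  obtain ⟨h1, h2⟩ := abs_exp_add_exp_neg_sub_le hv
  have h3 := abs_exp_sub_exp_neg_sub_le hv
  rw [hre, him, abs_neg, abs_of_nonneg (by positivity), abs_mul, abs_mul z.im,
    abs_of_nonneg (by positivity : 0 ≤ 2 * N ^ 2), ← mul_add]
  have h4 : |z.im| * |(rexp v - rexp (-v)) / 2 - v| ≤ 1 * |v| ^ 3 := by gcongr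
  gcongr
  linarith

lemma norm_kern_mul_conj_kern_sub_le {H : ℝ} (hH : 0 ≤ H) (y v : ℝ) :
    ‖kern H (y - v / 2) * (starRingEnd ℂ) (kern H (y + v / 2)) - ((‖kern H y‖ ^ 2 : ℝ) : ℂ)‖ ≤
      H ^ 3 * |v| := by
  have h0 : ((‖kern H y‖ ^ 2 : ℝ) : ℂ) = kern H y * (starRingEnd ℂ) (kern H y) := by
    rw [mul_conj, normSq_eq_norm_sq]
  rw [h0, show kern H (y - v / 2) * (starRingEnd ℂ) (kern H (y + v / 2)) -
      kern H y * (starRingEnd ℂ) (kern H y) =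
      (kern H (y - v / 2) - kern H y) * (starRingEnd ℂ) (kern H (y + v / 2)) +
      kern H y * (starRingEnd ℂ) (kern H (y + v / 2) - kern H y) by rw [map_sub]; ring]
  refine (norm_add_le _ _).trans ?_
  rw [norm_mul, norm_mul, norm_conj, norm_conj]
  have h1 := norm_kern_sub_le hH (y - v / 2) y
  have h2 := norm_kern_sub_le hH (y + v / 2) y
  rw [show y - v / 2 - y = -(v / 2) by ring, abs_neg, abs_div, abs_two] at h1
  rw [show y + v / 2 - y = v / 2 by ring, abs_div, abs_two] at h2
  calc _ ≤ H ^ 2 * (|v| / 2) * H + H * (H ^ 2 * (|v| / 2)) := by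
        gcongr <;> exact norm_kern_le hH _
    _ = _ := by ring

lemma norm_sq_kern_le {H : ℝ} (hH : 0 ≤ H) (y : ℝ) : ‖((‖kern H y‖ ^ 2 : ℝ) : ℂ)‖ ≤ H ^ 2 := by
  rw [norm_real, Real.norm_of_nonneg (by positivity)]
  gcongr
  exact norm_kern_le hH y

lemma mul_exp_neg_le_exp_neg_half (x : ℝ) : x * rexp (-x) ≤ rexp (-(x / 2)) := by
  rw [show -x = -(x / 2) + -(x / 2) by ring, Real.exp_add, ← mul_assoc]
  refine mul_le_of_le_one_left (Real.exp_pos _).le ?_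
  rw [Real.exp_neg, ← div_eq_mul_inv, div_le_one (Real.exp_pos _)]
  have := Real.quadratic_le_exp_of_nonneg (x := |x / 2|) (abs_nonneg _)
  rcases le_or_gt 0 x with h | h
  · rw [abs_of_nonneg (by positivity)] at this
    nlinarith [sq_nonneg (x / 2 - 1)]
  · exact h.le.trans (Real.exp_pos _).le

lemma norm_diag_integrand_sub_le {z : ℂ} (hz : 0 < z.re) (hi : |z.im| ≤ 1) {H : ℝ} (hH : 0 ≤ H)
    (N : ℝ) {v : ℝ} (hv : |v| ≤ 1) (y : ℝ) :
    ‖(rexp (-(1 * y)) * (kern H (y - v / 2) * (starRingEnd ℂ) (kern H (y + v / 2))) *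
      (rexp (2 * y) * exp (-(π * pairFreq z N N v * rexp (2 * y)))) : ℂ) -
      rexp (-(1 * y)) * ((‖kern H y‖ ^ 2 : ℝ) : ℂ) *
      (rexp (2 * y) * exp (-(π * modelFreq z N v * rexp (2 * y))))‖ ≤
    (H ^ 3 * |v| + H ^ 2 * (v ^ 2 + |v| ^ 3 / z.re)) *
      (rexp y * rexp (-(π * N ^ 2 * z.re * rexp (2 * y)))) := by
  set x : ℝ := 2 * (π * N ^ 2 * z.re * rexp (2 * y)) with hx
  have hx0 : 0 ≤ x := by positivity
  set w₁ : ℂ := π * pairFreq z N N v * rexp (2 * y) with hw₁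
  set w₀ : ℂ := π * modelFreq z N v * rexp (2 * y) with hw₀
  set k₁ : ℂ := kern H (y - v / 2) * (starRingEnd ℂ) (kern H (y + v / 2))
  set k₀ : ℂ := ((‖kern H y‖ ^ 2 : ℝ) : ℂ)
  have hre : ∀ ζ : ℂ, (π * ζ * rexp (2 * y) : ℂ).re = π * ζ.re * rexp (2 * y) := fun ζ ↦ by
    rw [re_mul_ofReal, re_ofReal_mul]
  have hr₀ : x ≤ w₀.re := by rw [hw₀, hre, modelFreq_re, hx]; apply le_of_eq; ring
  have hr₁ : x ≤ w₁.re := by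
    rw [hw₁, hre, pairFreq_re, hx]
    have h1 := (abs_exp_add_exp_neg_sub_le hv).1
    calc 2 * (π * N ^ 2 * z.re * rexp (2 * y)) = π * (N ^ 2 * 2 * z.re) * rexp (2 * y) := by ring
      _ ≤ π * (N ^ 2 * (rexp v + rexp (-v)) * z.re) * rexp (2 * y) := by gcongr; linarith
      _ = _ := by ring
  have hdist : ‖w₁ - w₀‖ ≤ x * (v ^ 2 + |v| ^ 3 / z.re) := by
    rw [show w₁ - w₀ = π * (pairFreq z N N v - modelFreq z N v) * rexp (2 * y) by
      rw [hw₁, hw₀]; ring, norm_mul, norm_mul, norm_real, norm_real,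
      Real.norm_of_nonneg Real.pi_pos.le, Real.norm_of_nonneg (Real.exp_pos _).le]
    calc _ ≤ π * (2 * N ^ 2 * (z.re * v ^ 2 + |v| ^ 3)) * rexp (2 * y) := by
          gcongr
          exact norm_pairFreq_sub_modelFreq_le hz hi N hv
      _ = _ := by rw [hx]; field_simp
  have hexp := norm_exp_neg_sub_exp_neg_le hr₀ hr₁
  have he₁ : ‖exp (-w₁)‖ ≤ rexp (-x) := by
    rw [norm_exp, neg_re]; exact Real.exp_le_exp.mpr (neg_le_neg hr₁)
  have hhalf : rexp (-x) ≤ rexp (-(x / 2)) := Real.exp_le_exp.mpr (by linarith)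
  have hsplit : (rexp (-(1 * y)) * k₁ * (rexp (2 * y) * exp (-w₁)) : ℂ) -
      rexp (-(1 * y)) * k₀ * (rexp (2 * y) * exp (-w₀)) =
      (rexp y : ℂ) * ((k₁ - k₀) * exp (-w₁) + k₀ * (exp (-w₁) - exp (-w₀))) := by
    have : (rexp y : ℂ) = rexp (-(1 * y)) * rexp (2 * y) := by
      rw [← ofReal_mul, ← Real.exp_add]; ring_nf
    rw [this]; ring
  rw [hsplit, norm_mul, norm_real, Real.norm_of_nonneg (Real.exp_pos _).le,
    show π * N ^ 2 * z.re * rexp (2 * y) = x / 2 by rw [hx]; ring]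
  have hδ : 0 ≤ v ^ 2 + |v| ^ 3 / z.re := by positivity
  have hmain : ‖(k₁ - k₀) * exp (-w₁) + k₀ * (exp (-w₁) - exp (-w₀))‖ ≤
      (H ^ 3 * |v| + H ^ 2 * (v ^ 2 + |v| ^ 3 / z.re)) * rexp (-(x / 2)) := by
    refine (norm_add_le _ _).trans ?_
    rw [norm_mul, norm_mul, add_mul]
    refine add_le_add ?_ ?_
    · exact mul_le_mul (norm_kern_mul_conj_kern_sub_le hH y v) (he₁.trans hhalf)
        (norm_nonneg _) (by positivity)
    · calc ‖k₀‖ * ‖exp (-w₁) - exp (-w₀)‖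
          ≤ H ^ 2 * (rexp (-x) * (x * (v ^ 2 + |v| ^ 3 / z.re))) := by
            gcongr
            · exact norm_sq_kern_le hH y
            · exact hexp.trans (by gcongr)
        _ = H ^ 2 * (v ^ 2 + |v| ^ 3 / z.re) * (x * rexp (-x)) := by ring
        _ ≤ _ := by
            gcongr
            exact mul_exp_neg_le_exp_neg_half x
  calc _ ≤ rexp y * ((H ^ 3 * |v| + H ^ 2 * (v ^ 2 + |v| ^ 3 / z.re)) * rexp (-(x / 2))) := by
        gcongr
    _ = _ := by ring

lemma continuous_norm_kern_sq (H : ℝ) : Continuous fun y ↦ ((‖kern H y‖ ^ 2 : ℝ) : ℂ) :=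
  continuous_ofReal.comp ((continuous_kern H).norm.pow 2)

lemma integrableOn_modelCorr {z : ℂ} (hz : 0 < z.re) {H : ℝ} (hH : 0 ≤ H) {N : ℝ} (hN : 0 < N)
    (v : ℝ) {y₀ : ℝ} (hy₀ : 0 ≤ y₀) :
    IntegrableOn (fun y : ℝ ↦ (rexp (-(1 * y)) * ((‖kern H y‖ ^ 2 : ℝ) : ℂ) *
      (rexp (2 * y) * exp (-(π * modelFreq z N v * rexp (2 * y)))) : ℂ)) (Ioi y₀) := by
  refine integrableOn_oscillatory ?_ (continuous_norm_kern_sq H) (norm_sq_kern_le hH) zero_le_one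
    hy₀
  rw [modelFreq_re]; positivity

lemma norm_pairCorr_sub_modelCorr_le {z : ℂ} (hz : 0 < z.re) (hi : |z.im| ≤ 1) {H : ℝ}
    (hH : 0 ≤ H) {N : ℝ} (hN : 0 < N) {v : ℝ} (hv : |v| ≤ 1) :
    ‖pairCorr z H N N v - modelCorr z H N v‖ ≤ 16 * H ^ 2 * |v| +
      8 * (H ^ 3 * |v| + H ^ 2 * (v ^ 2 + |v| ^ 3 / z.re)) * (1 / (N * √z.re)) := by
  set G₁ : ℝ → ℂ := fun y ↦ rexp (-(1 * y)) *
    (kern H (y - v / 2) * (starRingEnd ℂ) (kern H (y + v / 2))) *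
      (rexp (2 * y) * exp (-(π * pairFreq z N N v * rexp (2 * y)))) with hG₁
  set G₀ : ℝ → ℂ := fun y ↦ rexp (-(1 * y)) * ((‖kern H y‖ ^ 2 : ℝ) : ℂ) *
      (rexp (2 * y) * exp (-(π * modelFreq z N v * rexp (2 * y)))) with hG₀
  have hv2 : 0 ≤ |v| / 2 := by positivity
  have hi₁ : IntegrableOn G₁ (Ioi (|v| / 2)) := integrableOn_pairCorr hz hH hN v
  have hi₀ : IntegrableOn G₀ (Ioi 0) := integrableOn_modelCorr hz hH hN v le_rfl
  have hsplit : ∫ y in Ioi 0, G₀ y = (∫ y in Ioc 0 (|v| / 2), G₀ y) + ∫ y in Ioi (|v| / 2), G₀ y := by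
    rw [← setIntegral_union (Ioc_disjoint_Ioi le_rfl) measurableSet_Ioi
      (hi₀.mono_set Ioc_subset_Ioi_self) (hi₀.mono_set (Ioi_subset_Ioi hv2)),
      Ioc_union_Ioi_eq_Ioi hv2]
  set C : ℝ := H ^ 3 * |v| + H ^ 2 * (v ^ 2 + |v| ^ 3 / z.re) with hC
  have hC0 : 0 ≤ C := by positivity
  obtain ⟨hgi, hgb⟩ := integral_exp_mul_exp_neg_sq_le hN hz
  have h1 : ‖∫ y in Ioi (|v| / 2), (G₁ y - G₀ y)‖ ≤ C * (1 / (2 * N * √z.re)) := by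
    calc _ ≤ ∫ y in Ioi (|v| / 2), C * (rexp y * rexp (-(π * N ^ 2 * z.re * rexp (2 * y)))) :=
          norm_integral_le_of_norm_le ((hgi.mono_set (Ioi_subset_Ioi hv2)).const_mul C)
            (Eventually.of_forall fun y ↦ norm_diag_integrand_sub_le hz hi hH N hv y)
      _ ≤ ∫ y in Ioi 0, C * (rexp y * rexp (-(π * N ^ 2 * z.re * rexp (2 * y)))) :=
          setIntegral_mono_set (hgi.const_mul C) (Eventually.of_forall fun y ↦ by
            simp only [Pi.zero_apply]; positivity) (Ioi_subset_Ioi hv2).eventuallyLE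
      _ ≤ _ := by rw [integral_const_mul]; gcongr
  have h2 : ‖∫ y in Ioc 0 (|v| / 2), G₀ y‖ ≤ H ^ 2 * |v| := by
    have hb : ∀ y ∈ Ioc 0 (|v| / 2), ‖G₀ y‖ ≤ 2 * H ^ 2 := fun y hy ↦ by
      have hy1 : y ≤ 1 / 2 := by linarith [hy.2]
      rw [hG₀]
      simp only
      rw [norm_mul, norm_mul, norm_exp_mul_cexp_neg_exp, norm_real,
        Real.norm_of_nonneg (Real.exp_pos _).le]
      have h3 : rexp (-(π * (modelFreq z N v).re * rexp (2 * y))) ≤ 1 := by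
        rw [Real.exp_le_one_iff, modelFreq_re, neg_nonpos]; positivity
      have h4 : rexp y ≤ 2 := by
        have := Real.exp_bound_div_one_sub_of_interval (x := 1 / 2) (by norm_num) (by norm_num)
        refine (Real.exp_le_exp.mpr hy1).trans (this.trans (by norm_num))
      calc _ ≤ rexp (-(1 * y)) * H ^ 2 * (rexp (2 * y) * 1) := by
            gcongr
            exact norm_sq_kern_le hH y
        _ = rexp y * H ^ 2 := by
            rw [show rexp y = rexp (-(1 * y)) * rexp (2 * y) by rw [← Real.exp_add]; ring_nf]
            ring
        _ ≤ _ := by gcongr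
    have h5 := norm_setIntegral_le_of_norm_le_const (μ := volume) (by simp) hb
    rw [Real.volume_real_Ioc_of_le hv2] at h5
    exact h5.trans (le_of_eq (by ring))
  have hEq : pairCorr z H N N v - modelCorr z H N v =
      16 * ((∫ y in Ioi (|v| / 2), (G₁ y - G₀ y)) - ∫ y in Ioc 0 (|v| / 2), G₀ y) := by
    rw [integral_sub hi₁ (hi₀.mono_set (Ioi_subset_Ioi hv2)), pairCorr, modelCorr, hsplit]
    ring
  rw [hEq, norm_mul, RCLike.norm_ofNat]
  calc _ ≤ 16 * (C * (1 / (2 * N * √z.re)) + H ^ 2 * |v|) := by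
        gcongr
        exact (norm_sub_le _ _).trans (add_le_add h1 h2)
    _ = _ := by field_simp; ring

lemma norm_modelCorr_le {z : ℂ} (hz : 0 < z.re) {H : ℝ} (hH : 0 ≤ H) {N : ℝ} (hN : 0 < N)
    (v : ℝ) : ‖modelCorr z H N v‖ ≤ 8 * H ^ 2 * (1 / (N * √z.re)) := by
  obtain ⟨hgi, hgb⟩ := integral_exp_mul_exp_neg_sq_le hN hz
  rw [modelCorr, norm_mul, RCLike.norm_ofNat]
  calc _ ≤ 16 * ∫ y in Ioi 0, H ^ 2 * (rexp y * rexp (-(π * N ^ 2 * z.re * rexp (2 * y)))) := by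
        gcongr
        refine norm_integral_le_of_norm_le (hgi.const_mul _) (Eventually.of_forall fun y ↦ ?_)
        rw [norm_mul, norm_mul, norm_exp_mul_cexp_neg_exp, norm_real,
          Real.norm_of_nonneg (Real.exp_pos _).le, modelFreq_re]
        have he : rexp (-(π * (2 * N ^ 2 * z.re) * rexp (2 * y))) ≤
            rexp (-(π * N ^ 2 * z.re * rexp (2 * y))) := by
          rw [Real.exp_le_exp]
          linarith [show 0 ≤ π * N ^ 2 * z.re * rexp (2 * y) by positivity]
        calc _ ≤ rexp (-(1 * y)) * H ^ 2 *
              (rexp (2 * y) * rexp (-(π * N ^ 2 * z.re * rexp (2 * y)))) :=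
              mul_le_mul (mul_le_mul_of_nonneg_left (norm_sq_kern_le hH y) (Real.exp_pos _).le)
                (mul_le_mul_of_nonneg_left he (Real.exp_pos _).le) (by positivity) (by positivity)
          _ = _ := by
              rw [show rexp y = rexp (-(1 * y)) * rexp (2 * y) by rw [← Real.exp_add]; ring_nf]
              ring
    _ ≤ 16 * (H ^ 2 * (1 / (2 * N * √z.re))) := by rw [integral_const_mul]; gcongr
    _ = _ := by field_simp; ring

end Diagonal

section MeanSquareModel

open Complex MeasureTheory Set
open scoped Real

lemma norm_integral_gauss_window_le {D : ℝ → ℂ} {V E₁ E₂ Δ : ℝ} (hΔ : 0 < Δ) (hV : 0 ≤ V)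
    (hE₁ : 0 ≤ E₁) (hE₂ : 0 ≤ E₂) (h₁ : ∀ v, |v| ≤ V → ‖D v‖ ≤ E₁) (h₂ : ∀ v, ‖D v‖ ≤ E₂) (m : ℝ) :
    ‖√π * Δ * ∫ v : ℝ, exp (-(I * ((m : ℂ) * v))) * rexp (-(Δ ^ 2 * v ^ 2 / 4)) * D v‖ ≤
      2 * π * E₁ + 3 * π * (E₂ * rexp (-(Δ ^ 2 * V ^ 2 / 8))) := by
  have hg : ∀ c : ℝ, 0 < c → Integrable (fun v : ℝ ↦ rexp (-c * v ^ 2)) :=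
    fun c hc ↦ integrable_exp_neg_mul_sq hc
  have hi₁ := (hg (Δ ^ 2 / 4) (by positivity)).const_mul E₁
  have hi₂ := (hg (Δ ^ 2 / 8) (by positivity)).const_mul (E₂ * rexp (-(Δ ^ 2 * V ^ 2 / 8)))
  have hb : ‖∫ v : ℝ, exp (-(I * ((m : ℂ) * v))) * rexp (-(Δ ^ 2 * v ^ 2 / 4)) * D v‖ ≤
      ∫ v : ℝ, (E₁ * rexp (-(Δ ^ 2 / 4) * v ^ 2) +
        E₂ * rexp (-(Δ ^ 2 * V ^ 2 / 8)) * rexp (-(Δ ^ 2 / 8) * v ^ 2)) := by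
    refine norm_integral_le_of_norm_le (hi₁.add hi₂) (Eventually.of_forall fun v ↦ ?_)
    have hn : ‖exp (-(I * ((m : ℂ) * v)))‖ = 1 := by rw [norm_exp]; simp
    rw [norm_mul, norm_mul, hn, one_mul, norm_real, Real.norm_of_nonneg (Real.exp_pos _).le,
      show -(Δ ^ 2 * v ^ 2 / 4) = -(Δ ^ 2 / 4) * v ^ 2 by ring]
    rcases le_or_gt |v| V with hv | hv
    · have := mul_le_mul_of_nonneg_left (h₁ v hv) (Real.exp_pos (-(Δ ^ 2 / 4) * v ^ 2)).le
      have : 0 ≤ E₂ * rexp (-(Δ ^ 2 * V ^ 2 / 8)) * rexp (-(Δ ^ 2 / 8) * v ^ 2) := by positivity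
      linarith
    · have hexp : rexp (-(Δ ^ 2 / 4) * v ^ 2) ≤
          rexp (-(Δ ^ 2 * V ^ 2 / 8)) * rexp (-(Δ ^ 2 / 8) * v ^ 2) := by
        rw [← Real.exp_add, Real.exp_le_exp]
        have h3 : V ^ 2 ≤ v ^ 2 := by rw [← sq_abs v]; gcongr
        nlinarith [sq_nonneg Δ]
      have := mul_le_mul hexp (h₂ v) (norm_nonneg _) (by positivity)
      have : 0 ≤ E₁ * rexp (-(Δ ^ 2 / 4) * v ^ 2) := by positivity
      linarith
  rw [integral_add hi₁ hi₂, integral_const_mul, integral_const_mul, integral_gaussian,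
    integral_gaussian] at hb
  have hs₁ : √π * Δ * √(π / (Δ ^ 2 / 4)) = 2 * π := by
    rw [show π / (Δ ^ 2 / 4) = π * (2 / Δ) ^ 2 by field_simp; norm_num, Real.sqrt_mul Real.pi_pos.le,
      Real.sqrt_sq (by positivity)]
    rw [show √π * Δ * (√π * (2 / Δ)) = √π * √π * 2 by field_simp, Real.mul_self_sqrt Real.pi_pos.le]
    ring
  have hs₂ : √π * Δ * √(π / (Δ ^ 2 / 8)) ≤ 3 * π := by
    calc √π * Δ * √(π / (Δ ^ 2 / 8)) ≤ √π * Δ * √(π * (3 / Δ) ^ 2) := by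
          gcongr
          rw [div_pow, div_div_eq_mul_div, mul_div_assoc]
          gcongr
          norm_num
      _ = 3 * π := by
          rw [Real.sqrt_mul Real.pi_pos.le, Real.sqrt_sq (by positivity),
            show √π * Δ * (√π * (3 / Δ)) = √π * √π * 3 by field_simp,
            Real.mul_self_sqrt Real.pi_pos.le]
          ring
  rw [norm_mul, norm_mul, norm_real, norm_real, Real.norm_of_nonneg (Real.sqrt_nonneg _),
    Real.norm_of_nonneg hΔ.le]
  have hE : 0 ≤ E₂ * rexp (-(Δ ^ 2 * V ^ 2 / 8)) := by positivity
  calc _ ≤ √π * Δ * (E₁ * √(π / (Δ ^ 2 / 4)) +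
        E₂ * rexp (-(Δ ^ 2 * V ^ 2 / 8)) * √(π / (Δ ^ 2 / 8))) := by gcongr
    _ = E₁ * (√π * Δ * √(π / (Δ ^ 2 / 4))) +
        E₂ * rexp (-(Δ ^ 2 * V ^ 2 / 8)) * (√π * Δ * √(π / (Δ ^ 2 / 8))) := by ring
    _ ≤ E₁ * (2 * π) + E₂ * rexp (-(Δ ^ 2 * V ^ 2 / 8)) * (3 * π) := by
        rw [hs₁]; gcongr
    _ = _ := by ring

/-- The density of the lattice sum which models the mean square of a block. -/
noncomputable def profile (z : ℂ) (Δ m x : ℝ) : ℝ :=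
  rexp (-(2 * π * z.re * x ^ 2)) * rexp (-((2 * π * z.im * x ^ 2 - m) ^ 2 / Δ ^ 2))

lemma exp_mul_modelCorr (z : ℂ) (H N m v : ℝ) :
    exp (-(I * ((m : ℂ) * v))) * modelCorr z H N v =
      16 * ∫ y in Ioi (0 : ℝ), ((rexp (-(1 * y)) * ‖kern H y‖ ^ 2 *
        (rexp (2 * y) * rexp (-(2 * π * z.re * N ^ 2 * rexp (2 * y)))) : ℝ) : ℂ) *
        exp (I * ((v : ℂ) * ((2 * π * z.im * N ^ 2 * rexp (2 * y) - m : ℝ) : ℂ))) := by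
  rw [modelCorr, mul_left_comm, ← integral_const_mul]
  congr 1
  refine integral_congr_ae (Eventually.of_forall fun y ↦ ?_)
  simp only
  have h : exp (-(I * ((m : ℂ) * v))) * exp (-(π * modelFreq z N v * rexp (2 * y))) =
      (rexp (-(2 * π * z.re * N ^ 2 * rexp (2 * y))) : ℂ) *
      exp (I * ((v : ℂ) * ((2 * π * z.im * N ^ 2 * rexp (2 * y) - m : ℝ) : ℂ))) := by
    rw [ofReal_exp (-(2 * π * z.re * N ^ 2 * rexp (2 * y))), ← exp_add, ← exp_add, modelFreq]
    congr 1
    push_cast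
    ring
  push_cast at h ⊢
  linear_combination (exp (-(1 * y)) * (‖kern H y‖ : ℂ) ^ 2 * exp (2 * y)) * h

lemma integrableOn_model_amplitude {z : ℂ} (hz : 0 < z.re) {H : ℝ} (hH : 0 ≤ H) {N : ℝ}
    (hN : 0 < N) : IntegrableOn (fun y : ℝ ↦ ((rexp (-(1 * y)) * ‖kern H y‖ ^ 2 *
        (rexp (2 * y) * rexp (-(2 * π * z.re * N ^ 2 * rexp (2 * y)))) : ℝ) : ℂ)) (Ioi 0) := by
  refine (integrableOn_modelCorr hz hH hN 0 le_rfl).congr (Eventually.of_forall fun y ↦ ?_)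
  simp only
  rw [modelFreq]
  push_cast
  congr 3
  simp only [mul_zero, sub_zero]
  ring

lemma gauss_two_div {Δ : ℝ} (hΔ : 0 < Δ) (v : ℝ) :
    gauss (2 / Δ) 0 v = rexp (-(Δ ^ 2 * v ^ 2 / 4)) := by
  rw [gauss]
  congr 1
  field_simp
  ring

lemma integrable_exp_mul_modelCorr {z : ℂ} (hz : 0 < z.re) {H : ℝ} (hH : 0 ≤ H) {N : ℝ}
    (hN : 0 < N) {Δ : ℝ} (hΔ : 0 < Δ) (m : ℝ) :
    Integrable (fun v : ℝ ↦ exp (-(I * ((m : ℂ) * v))) * rexp (-(Δ ^ 2 * v ^ 2 / 4)) *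
      modelCorr z H N v) := by
  have h := (integrable_gauss_mul_integral (integrableOn_model_amplitude hz hH hN)
    (φ := fun y ↦ 2 * π * z.im * N ^ 2 * rexp (2 * y) - m) (by fun_prop)
    (Δ := 2 / Δ) (by positivity) 0).const_mul 16
  refine h.congr (Eventually.of_forall fun v ↦ ?_)
  simp only
  rw [mul_right_comm (exp _), exp_mul_modelCorr, gauss_two_div hΔ]
  ring

lemma integral_exp_mul_modelCorr {z : ℂ} (hz : 0 < z.re) {H : ℝ} (hH : 0 ≤ H) {N : ℝ}
    (hN : 0 < N) {Δ : ℝ} (hΔ : 0 < Δ) (m : ℝ) :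
    √π * Δ * ∫ v : ℝ, exp (-(I * ((m : ℂ) * v))) * rexp (-(Δ ^ 2 * v ^ 2 / 4)) *
      modelCorr z H N v =
    ((32 * π * ∫ y in Ioi (0 : ℝ), ‖kern H y‖ ^ 2 * (rexp y * profile z Δ m (N * rexp y)) : ℝ) :
      ℂ) := by
  have h := integral_gauss_mul_integral (integrableOn_model_amplitude hz hH hN)
    (φ := fun y ↦ 2 * π * z.im * N ^ 2 * rexp (2 * y) - m) (by fun_prop)
    (Δ := 2 / Δ) (by positivity) 0
  have h1 : ∀ v : ℝ, exp (-(I * ((m : ℂ) * v))) * rexp (-(Δ ^ 2 * v ^ 2 / 4)) *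
      modelCorr z H N v = 16 * ((gauss (2 / Δ) 0 v : ℂ) *
      ∫ y in Ioi (0 : ℝ), ((rexp (-(1 * y)) * ‖kern H y‖ ^ 2 *
        (rexp (2 * y) * rexp (-(2 * π * z.re * N ^ 2 * rexp (2 * y)))) : ℝ) : ℂ) *
        exp (I * ((v : ℂ) * ((2 * π * z.im * N ^ 2 * rexp (2 * y) - m : ℝ) : ℂ)))) := fun v ↦ by
    rw [mul_right_comm, exp_mul_modelCorr, gauss_two_div hΔ]
    ring
  simp_rw [h1]
  rw [integral_const_mul, h]
  have h2 : ∀ y : ℝ, ((rexp (-(1 * y)) * ‖kern H y‖ ^ 2 *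
        (rexp (2 * y) * rexp (-(2 * π * z.re * N ^ 2 * rexp (2 * y)))) : ℝ) : ℂ) *
      (exp (I * (((0 : ℝ) : ℂ) * ((2 * π * z.im * N ^ 2 * rexp (2 * y) - m : ℝ) : ℂ))) *
        rexp (-((2 / Δ) ^ 2 * (2 * π * z.im * N ^ 2 * rexp (2 * y) - m) ^ 2 / 4))) =
      ((‖kern H y‖ ^ 2 * (rexp y * profile z Δ m (N * rexp y)) : ℝ) : ℂ) := fun y ↦ by
    rw [ofReal_zero, zero_mul, mul_zero, exp_zero, one_mul (ofReal _), ← ofReal_mul]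
    congr 1
    have he : (N * rexp y) ^ 2 = N ^ 2 * rexp (2 * y) := by
      rw [mul_pow, ← Real.exp_nat_mul]; norm_num
    rw [profile, he, show rexp y = rexp (-(1 * y)) * rexp (2 * y) by
      rw [← Real.exp_add]; ring_nf,
      show (2 / Δ) ^ 2 * (2 * π * z.im * N ^ 2 * rexp (2 * y) - m) ^ 2 / 4 =
        (2 * π * z.im * (N ^ 2 * rexp (2 * y)) - m) ^ 2 / Δ ^ 2 by field_simp; ring,
      show 2 * π * z.re * N ^ 2 * rexp (2 * y) = 2 * π * z.re * (N ^ 2 * rexp (2 * y)) by ring]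
    ring
  simp_rw [h2]
  rw [integral_complex_ofReal]
  have hpi : (√π : ℂ) * √π = π := by rw [← ofReal_mul, Real.mul_self_sqrt Real.pi_pos.le]
  have hΔ' : (Δ : ℂ) ≠ 0 := ofReal_ne_zero.mpr hΔ.ne'
  generalize ∫ y in Ioi (0 : ℝ), ‖kern H y‖ ^ 2 * (rexp y * profile z Δ m (N * rexp y)) = J
  push_cast
  rw [← hpi]
  field_simp
  ring

lemma norm_corr_sub_model_le {z : ℂ} (hz : 0 < z.re) (hi : 1 / 2 ≤ z.im) (hi₁ : z.im ≤ 1) {H : ℝ}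
    (hH : 1 ≤ H) {M : ℕ} (hM : 1 ≤ M) {V : ℝ} (hMV : 8 * M * V ≤ 1) (hV : V ^ 2 ≤ 2 * z.re) {v : ℝ}
    (hv : |v| ≤ V) :
    ‖corr z H M v - ∑ n ∈ Finset.range M, modelCorr z H (n + 1) v‖ ≤ 200 * H ^ 3 * harm M ^ 2 := by
  have hM' : (1 : ℝ) ≤ M := by exact_mod_cast hM
  have hH0 : 0 ≤ H := by linarith
  have hV0 : 0 ≤ V := (abs_nonneg v).trans hv
  have hV1 : V ≤ 1 := by nlinarith
  have hh := one_le_harm hM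
  have h1 := norm_corr_sub_diag_le hz hi hH (M := M) (v := v)
    ((by gcongr : 8 * (M : ℝ) * |v| ≤ 8 * M * V).trans hMV)
  set s : ℝ := √z.re with hs
  have hs0 : 0 < s := Real.sqrt_pos.mpr hz
  have hss : s ^ 2 = z.re := Real.sq_sqrt hz.le
  have hVs : V ≤ 2 * s := by
    refine (pow_le_pow_iff_left₀ hV0 (by positivity) two_ne_zero).mp ?_
    rw [mul_pow, hss]; linarith
  set C : ℝ := H ^ 3 * |v| + H ^ 2 * (v ^ 2 + |v| ^ 3 / z.re) with hC
  have hCs : C * (1 / s) ≤ 8 * H ^ 3 := by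
    rw [mul_one_div, div_le_iff₀ hs0]
    have h2 : |v| ^ 3 / z.re ≤ 4 * s := by
      rw [div_le_iff₀ hz, ← hss]
      calc |v| ^ 3 ≤ V * V ^ 2 := by rw [← pow_succ']; gcongr
        _ ≤ (2 * s) * (2 * s ^ 2) := by rw [hss]; gcongr
        _ = _ := by ring
    have h3 : v ^ 2 ≤ 2 * s := by
      rw [← sq_abs]
      calc |v| ^ 2 ≤ 1 * V := by rw [sq]; gcongr; exact hv.trans hV1
        _ ≤ _ := by linarith
    have h4 : H ^ 2 ≤ H ^ 3 := pow_le_pow_right₀ hH (by norm_num)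
    calc C ≤ H ^ 3 * (2 * s) + H ^ 3 * (2 * s + 4 * s) := by
          rw [hC]; gcongr; exact hv.trans hVs
      _ = _ := by ring
  have h2 : ‖(∑ n ∈ Finset.range M, pairCorr z H (n + 1) (n + 1) v) -
      ∑ n ∈ Finset.range M, modelCorr z H (n + 1) v‖ ≤ 2 * H ^ 3 + 64 * H ^ 3 * harm M := by
    rw [← Finset.sum_sub_distrib]
    refine (norm_sum_le _ _).trans ?_
    calc _ ≤ ∑ n ∈ Finset.range M, (16 * H ^ 2 * V + 64 * H ^ 3 * (1 / ((n : ℝ) + 1))) := by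
          refine Finset.sum_le_sum fun n _ ↦ ?_
          refine (norm_pairCorr_sub_modelCorr_le hz (abs_le.mpr ⟨by linarith, hi₁⟩) hH0
            (by positivity : (0 : ℝ) < n + 1) (hv.trans hV1)).trans ?_
          have h5 : 8 * C * (1 / (((n : ℝ) + 1) * s)) ≤ 64 * H ^ 3 * (1 / ((n : ℝ) + 1)) := by
            calc _ = 8 * (C * (1 / s)) * (1 / ((n : ℝ) + 1)) := by field_simp
              _ ≤ 8 * (8 * H ^ 3) * (1 / ((n : ℝ) + 1)) := by gcongr
              _ = _ := by ring
          refine add_le_add ?_ h5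
          gcongr
      _ = 2 * H ^ 2 * (8 * M * V) + 64 * H ^ 3 * harm M := by
          rw [Finset.sum_add_distrib, Finset.sum_const, Finset.card_range, nsmul_eq_mul, harm,
            ← Finset.mul_sum]
          ring
      _ ≤ 2 * H ^ 2 * 1 + 64 * H ^ 3 * harm M := by gcongr
      _ ≤ _ := by
          have h4 : H ^ 2 ≤ H ^ 3 := pow_le_pow_right₀ hH (by norm_num)
          linarith
  rw [← sub_add_sub_cancel _ (∑ n ∈ Finset.range M, pairCorr z H (n + 1) (n + 1) v)]
  refine (norm_add_le _ _).trans ((add_le_add h1 h2).trans ?_)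
  have h6 : harm M ≤ harm M ^ 2 := by nlinarith
  have h7 : 0 ≤ H ^ 3 := by positivity
  nlinarith [mul_le_mul_of_nonneg_left h6 h7, mul_le_mul_of_nonneg_left (hh.trans h6) h7]

lemma norm_corr_sub_model_le_of_all {z : ℂ} (hz : 0 < z.re) {H : ℝ} (hH : 0 ≤ H) (M : ℕ) (v : ℝ) :
    ‖corr z H M v - ∑ n ∈ Finset.range M, modelCorr z H (n + 1) v‖ ≤
      (waveConst * z.re ^ (-(5 / 8) : ℝ) * H) ^ 2 + 8 * H ^ 2 * (1 / √z.re) * harm M := by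
  refine (norm_sub_le _ _).trans (add_le_add (norm_corr_le hz hH M v) ?_)
  refine (norm_sum_le _ _).trans ?_
  rw [harm, Finset.mul_sum]
  refine Finset.sum_le_sum fun n _ ↦ ?_
  refine (norm_modelCorr_le hz hH (by positivity : (0 : ℝ) < n + 1) v).trans (le_of_eq ?_)
  field_simp

lemma abs_integral_gauss_norm_block_sq_sub_le {z : ℂ} (hz : 0 < z.re) (hi : 1 / 2 ≤ z.im)
    (hi₁ : z.im ≤ 1) {H : ℝ} (hH : 1 ≤ H) {M : ℕ} (hM : 1 ≤ M) {V : ℝ} (hV0 : 0 ≤ V)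
    (hMV : 8 * M * V ≤ 1) (hV : V ^ 2 ≤ 2 * z.re) {Δ : ℝ} (hΔ : 0 < Δ) (m : ℝ) :
    |(∫ t, gauss Δ m t * ‖block z H M t‖ ^ 2) - 32 * π * ∑ n ∈ Finset.range M,
      ∫ y in Ioi (0 : ℝ), ‖kern H y‖ ^ 2 * (rexp y * profile z Δ m (((n : ℝ) + 1) * rexp y))| ≤
    2 * π * (200 * H ^ 3 * harm M ^ 2) +
      3 * π * (((waveConst * z.re ^ (-(5 / 8) : ℝ) * H) ^ 2 + 8 * H ^ 2 * (1 / √z.re) * harm M) *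
        rexp (-(Δ ^ 2 * V ^ 2 / 8))) := by
  have hH0 : 0 ≤ H := by linarith
  have ha := integrable_ampExt hz hH0 M
  have h := integral_gauss_norm_sq ha hΔ m
  have hcorr : Integrable (fun v : ℝ ↦ exp (-(I * ((m : ℂ) * v))) * rexp (-(Δ ^ 2 * v ^ 2 / 4)) *
      corr z H M v) := by
    have h1 := (integrable_autocorrelation ha).bdd_mul (c := 1)
      (f := fun v : ℝ ↦ exp (-(I * ((m : ℂ) * v))) * rexp (-(Δ ^ 2 * v ^ 2 / 4)))
      (Continuous.aestronglyMeasurable (by fun_prop)) (Eventually.of_forall fun v ↦ by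
        have hn : ‖exp (-(I * ((m : ℂ) * v)))‖ = 1 := by rw [norm_exp]; simp
        rw [norm_mul, hn, one_mul, norm_real, Real.norm_of_nonneg (Real.exp_pos _).le,
          Real.exp_le_one_iff, neg_nonpos]
        positivity)
    exact h1
  have hmodel : ∀ n ∈ Finset.range M, Integrable (fun v : ℝ ↦ exp (-(I * ((m : ℂ) * v))) *
      rexp (-(Δ ^ 2 * v ^ 2 / 4)) * modelCorr z H ((n : ℝ) + 1) v) := fun n _ ↦
    integrable_exp_mul_modelCorr hz hH0 (by positivity) hΔ m
  have hkey : ((((∫ t, gauss Δ m t * ‖block z H M t‖ ^ 2) - 32 * π * ∑ n ∈ Finset.range M,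
      ∫ y in Ioi (0 : ℝ), ‖kern H y‖ ^ 2 * (rexp y * profile z Δ m (((n : ℝ) + 1) * rexp y)) : ℝ)) :
      ℂ) = √π * Δ * ∫ v : ℝ, exp (-(I * ((m : ℂ) * v))) * rexp (-(Δ ^ 2 * v ^ 2 / 4)) *
        (corr z H M v - ∑ n ∈ Finset.range M, modelCorr z H (n + 1) v) := by
    have h1 : ((∫ t, gauss Δ m t * ‖block z H M t‖ ^ 2 : ℝ) : ℂ) =
        √π * Δ * ∫ v : ℝ, exp (-(I * ((m : ℂ) * v))) * rexp (-(Δ ^ 2 * v ^ 2 / 4)) *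
          corr z H M v := by
      rw [← integral_complex_ofReal]
      refine Eq.trans ?_ h
      refine integral_congr_ae (Eventually.of_forall fun t ↦ ?_)
      simp only
      rw [block_eq_integral_ampExt]
      push_cast
      rfl
    have h2 : ((32 * π * ∑ n ∈ Finset.range M, ∫ y in Ioi (0 : ℝ),
        ‖kern H y‖ ^ 2 * (rexp y * profile z Δ m (((n : ℝ) + 1) * rexp y)) : ℝ) : ℂ) =
        √π * Δ * ∫ v : ℝ, ∑ n ∈ Finset.range M, exp (-(I * ((m : ℂ) * v))) *
          rexp (-(Δ ^ 2 * v ^ 2 / 4)) * modelCorr z H (n + 1) v := by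
      rw [integral_finsetSum _ hmodel, Finset.mul_sum, Finset.mul_sum, ofReal_sum]
      refine Finset.sum_congr rfl fun n _ ↦ ?_
      exact (integral_exp_mul_modelCorr hz hH0 (by positivity) hΔ m).symm
    rw [ofReal_sub, h1, h2, ← mul_sub, ← integral_sub hcorr (integrable_finsetSum _ hmodel)]
    congr 1
    refine integral_congr_ae (Eventually.of_forall fun v ↦ ?_)
    simp only
    rw [mul_sub, Finset.mul_sum]
  rw [← Real.norm_eq_abs, ← norm_real, hkey]
  have hh := harm_nonneg M
  refine norm_integral_gauss_window_le hΔ hV0 (by positivity) (by positivity)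
    (fun v hv ↦ norm_corr_sub_model_le hz hi hi₁ hH hM hMV hV hv)
    (fun v ↦ norm_corr_sub_model_le_of_all hz hH0 M v) m

end MeanSquareModel

section SquareTerm

open Complex MeasureTheory Set
open scoped Real

lemma sq_integral_mul_le {μ : Measure ℝ} {f w : ℝ → ℝ} (hw : Integrable w μ)
    (hfw : Integrable (fun y ↦ f y * w y) μ) (hffw : Integrable (fun y ↦ f y ^ 2 * w y) μ)
    (hw0 : ∀ y, 0 ≤ w y) (hpos : 0 < ∫ y, w y ∂μ) :
    (∫ y, f y * w y ∂μ) ^ 2 ≤ (∫ y, f y ^ 2 * w y ∂μ) * ∫ y, w y ∂μ := by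
  set B := ∫ y, w y ∂μ
  set X := ∫ y, f y * w y ∂μ
  set A := ∫ y, f y ^ 2 * w y ∂μ
  have h : 0 ≤ ∫ y, (f y - X / B) ^ 2 * w y ∂μ :=
    integral_nonneg fun y ↦ mul_nonneg (sq_nonneg _) (hw0 y)
  have h2 : ∫ y, (f y - X / B) ^ 2 * w y ∂μ = A - 2 * (X / B) * X + (X / B) ^ 2 * B := by
    rw [← integral_const_mul, ← integral_const_mul, ← integral_sub hffw (hfw.const_mul _),
      ← integral_add (f := fun y ↦ f y ^ 2 * w y - 2 * (X / B) * (f y * w y))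
        (hffw.sub (hfw.const_mul _)) (hw.const_mul _)]
    refine integral_congr_ae (Eventually.of_forall fun y ↦ ?_)
    ring
  rw [h2] at h
  have h3 : A - 2 * (X / B) * X + (X / B) ^ 2 * B = (A * B - X ^ 2) / B := by field_simp; ring
  rw [h3, le_div_iff₀ hpos] at h
  linarith

/-- The sum of the first `M` waves. -/
noncomputable def waveSum (z : ℂ) (M : ℕ) (y : ℝ) : ℂ :=
  ∑ n ∈ Finset.range M, wave z ((n : ℝ) + 1) y

lemma continuous_waveSum (z : ℂ) (M : ℕ) : Continuous (waveSum z M) := by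
  unfold waveSum
  exact continuous_finsetSum _ fun n _ ↦ continuous_wave z _

lemma exists_norm_waveSum_le {z : ℂ} (hz : 0 < z.re) (M : ℕ) :
    ∃ C, 0 ≤ C ∧ ∀ y, 0 ≤ y → ‖waveSum z M y‖ ≤ C := by
  refine ⟨∑ n ∈ Finset.range M, 4 * rexp (-(π / 2 * ((n : ℝ) + 1) ^ 2 * z.re)) *
    ((n : ℝ) + 1) ^ (-(5 / 4) : ℝ) * z.re ^ (-(5 / 8) : ℝ), Finset.sum_nonneg fun _ _ ↦ by positivity,
    fun y hy ↦ (norm_sum_le _ _).trans (Finset.sum_le_sum fun n _ ↦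
      (norm_wave_le hz (by positivity) hy).trans ?_)⟩
  exact mul_le_of_le_one_right (by positivity) (Real.exp_le_one_iff.mpr (by linarith))

lemma integrableOn_exp_neg_mul_pow_waveSum {z : ℂ} (hz : 0 < z.re) (M k : ℕ) {w : ℝ → ℝ}
    (hw : IntegrableOn w (Ioi 0)) : IntegrableOn (fun y ↦ ‖waveSum z M y‖ ^ k * w y) (Ioi 0) := by
  obtain ⟨C, hC0, hC⟩ := exists_norm_waveSum_le hz M
  refine Integrable.bdd_mul (c := C ^ k) hw
    ((continuous_waveSum z M).norm.pow k).aestronglyMeasurable ?_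
  filter_upwards [ae_restrict_mem measurableSet_Ioi] with y hy
  rw [Real.norm_of_nonneg (by positivity)]
  gcongr
  exact hC y (le_of_lt hy)

lemma pairFreq_zero_norm_ge {z : ℂ} (hi : 1 / 2 ≤ z.im) (n n' : ℕ) :
    1 / 2 * (((n : ℝ) + 1) * |(n : ℝ) - n'|) ≤ ‖pairFreq z (n + 1) (n' + 1) 0‖ := by
  refine le_trans ?_ (abs_im_le_norm _)
  rw [pairFreq_im, neg_zero, Real.exp_zero, mul_one, mul_one, abs_mul,
    abs_of_pos (by linarith : 0 < z.im), show ((n : ℝ) + 1) ^ 2 - ((n' : ℝ) + 1) ^ 2 =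
      ((n : ℝ) + 1 + (n' + 1)) * ((n : ℝ) - n') by ring, abs_mul,
    abs_of_pos (by positivity : 0 < (n : ℝ) + 1 + (n' + 1))]
  have h1 : 0 ≤ ((n' : ℝ) + 1) * |(n : ℝ) - n'| := by positivity
  have h2 : 0 ≤ ((n : ℝ) + 1) * |(n : ℝ) - n'| := by positivity
  nlinarith

lemma integral_norm_waveSum_sq_le {z : ℂ} (hz : 0 < z.re) (hi : 1 / 2 ≤ z.im) (M : ℕ) {Δ : ℝ}
    (hΔ : 2 ≤ Δ) :
    ∫ y in Ioi (0 : ℝ), ‖waveSum z M y‖ ^ 2 * rexp (-(Δ * y)) ≤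
      32 * (M / Δ) + 24 * harm M ^ 2 := by
  set F : ℕ → ℕ → ℝ → ℂ := fun n n' y ↦ rexp (-((1 + Δ) * y)) * 1 *
    (rexp (2 * y) * exp (-(π * pairFreq z ((n : ℝ) + 1) ((n' : ℝ) + 1) 0 * rexp (2 * y))))
    with hF
  have hFint : ∀ n n', IntegrableOn (F n n') (Ioi 0) := fun n n' ↦
    integrableOn_oscillatory (pairFreq_re_pos hz (by positivity) 0) continuous_const
      (P := 1) (fun _ ↦ by simp) (by linarith) le_rfl
  have hpt : ∀ y, ((‖waveSum z M y‖ ^ 2 * rexp (-(Δ * y)) : ℝ) : ℂ) =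
      ∑ n ∈ Finset.range M, ∑ n' ∈ Finset.range M, 16 * F n n' y := fun y ↦ by
    have h1 : ((‖waveSum z M y‖ ^ 2 : ℝ) : ℂ) =
        ∑ n ∈ Finset.range M, ∑ n' ∈ Finset.range M,
          wave z ((n : ℝ) + 1) y * (starRingEnd ℂ) (wave z ((n' : ℝ) + 1) y) := by
      rw [← normSq_eq_norm_sq, ← mul_conj, waveSum, map_sum, Finset.sum_mul_sum]
    rw [ofReal_mul, h1, Finset.sum_mul]
    refine Finset.sum_congr rfl fun n _ ↦ ?_
    rw [Finset.sum_mul]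
    refine Finset.sum_congr rfl fun n' _ ↦ ?_
    have h2 := wave_mul_conj_wave z ((n : ℝ) + 1) ((n' : ℝ) + 1) 0 y
    rw [zero_div, sub_zero, add_zero] at h2
    rw [h2, hF]
    simp only
    rw [show -((1 + Δ) * y) = -(1 * y) + -(Δ * y) by ring, Real.exp_add, ofReal_mul]
    ring
  have hdiag : ∀ n : ℕ, ‖∫ y in Ioi (0 : ℝ), F n n y‖ ≤ 2 / Δ := fun n ↦ by
    have hinteg : IntegrableOn (fun y ↦ rexp (-(Δ - 1) * y)) (Ioi 0) :=
      integrableOn_exp_mul_Ioi (by linarith) 0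
    calc _ ≤ ∫ y in Ioi (0 : ℝ), rexp (-(Δ - 1) * y) := by
          refine norm_integral_le_of_norm_le hinteg (Eventually.of_forall fun y ↦ ?_)
          rw [hF]
          simp only
          rw [mul_one, norm_mul, norm_exp_mul_cexp_neg_exp, norm_real,
            Real.norm_of_nonneg (Real.exp_pos _).le, ← mul_assoc, ← Real.exp_add,
            show -((1 + Δ) * y) + 2 * y = -(Δ - 1) * y by ring]
          refine mul_le_of_le_one_right (Real.exp_pos _).le (Real.exp_le_one_iff.mpr ?_)
          rw [neg_nonpos]
          have := (pairFreq_re_pos hz (by positivity : (0 : ℝ) < n + 1) (N' := n + 1) 0).le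
          positivity
      _ = 1 / (Δ - 1) := by
          rw [integral_exp_mul_Ioi (by linarith)]
          rw [mul_zero, Real.exp_zero, neg_div_neg_eq]
      _ ≤ 2 / Δ := by rw [div_le_div_iff₀ (by linarith) (by linarith)]; linarith
  have hoff : ∀ n n' : ℕ, n ≠ n' → ‖∫ y in Ioi (0 : ℝ), F n n' y‖ ≤
      3 / 4 * (1 / (((n : ℝ) + 1) * |(n : ℝ) - n'|)) := fun n n' hne ↦ by
    have h1 := norm_integral_oscillatory_le (g := fun _ ↦ 1) (g' := fun _ ↦ 0)
      (pairFreq_re_pos hz (by positivity : (0 : ℝ) < n + 1) (N' := n' + 1) 0)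
      (fun y ↦ hasDerivAt_const y 1) continuous_const (P := 1) (Q := 0) (fun _ ↦ by simp)
      (fun _ ↦ by simp) (l := 1 + Δ) (by linarith) (y₀ := 0) le_rfl
    refine h1.trans ?_
    have hgap : 0 < |(n : ℝ) - n'| := abs_pos.mpr (sub_ne_zero.mpr (by exact_mod_cast hne))
    have h2 := pairFreq_zero_norm_ge hi n n'
    have hpi := Real.pi_gt_three
    calc (2 * 1 + 0) / (2 * π * ‖pairFreq z (n + 1) (n' + 1) 0‖)
        ≤ (2 * 1 + 0) / (2 * 3 * (1 / 2 * (((n : ℝ) + 1) * |(n : ℝ) - n'|))) := by gcongr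
      _ = 2 / 3 * (1 / (((n : ℝ) + 1) * |(n : ℝ) - n'|)) := by field_simp; norm_num
      _ ≤ _ := mul_le_mul_of_nonneg_right (by norm_num) (by positivity)
  have hrow : ∀ n ∈ Finset.range M, ∑ n' ∈ Finset.range M, ‖∫ y in Ioi (0 : ℝ), F n n' y‖ ≤
      2 / Δ + ∑ n' ∈ Finset.range M, 3 / 4 * (1 / (((n : ℝ) + 1) * |(n : ℝ) - n'|)) := by
    intro n hn
    rw [← Finset.add_sum_erase _ _ hn]
    refine add_le_add (hdiag n) ((Finset.sum_le_sum fun n' hn' ↦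
      hoff n n' (Finset.ne_of_mem_erase hn').symm).trans ?_)
    exact Finset.sum_le_sum_of_subset_of_nonneg (Finset.erase_subset _ _)
      fun _ _ _ ↦ by positivity
  have hnn : 0 ≤ ∫ y in Ioi (0 : ℝ), ‖waveSum z M y‖ ^ 2 * rexp (-(Δ * y)) :=
    integral_nonneg fun y ↦ by positivity
  rw [← Real.norm_of_nonneg hnn, ← norm_real, ← integral_complex_ofReal]
  simp_rw [hpt]
  rw [integral_finsetSum _ fun n _ ↦ integrable_finsetSum _ fun n' _ ↦ (hFint n n').const_mul 16]
  calc _ ≤ ∑ n ∈ Finset.range M, ∑ n' ∈ Finset.range M, 16 * ‖∫ y in Ioi (0 : ℝ), F n n' y‖ := by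
        refine (norm_sum_le _ _).trans (Finset.sum_le_sum fun n _ ↦ ?_)
        rw [integral_finsetSum _ fun n' _ ↦ (hFint n n').const_mul 16]
        refine (norm_sum_le _ _).trans (Finset.sum_le_sum fun n' _ ↦ ?_)
        rw [integral_const_mul, norm_mul, RCLike.norm_ofNat]
    _ ≤ ∑ n ∈ Finset.range M, 16 * (2 / Δ +
          ∑ n' ∈ Finset.range M, 3 / 4 * (1 / (((n : ℝ) + 1) * |(n : ℝ) - n'|))) := by
        refine Finset.sum_le_sum fun n hn ↦ ?_
        rw [← Finset.mul_sum]
        gcongr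
        exact hrow n hn
    _ = 32 * (M / Δ) + 12 * ∑ n ∈ Finset.range M, ∑ n' ∈ Finset.range M,
          1 / (((n : ℝ) + 1) * |(n : ℝ) - n'|) := by
        simp_rw [← Finset.mul_sum, Finset.sum_add_distrib, Finset.sum_const, Finset.card_range,
          nsmul_eq_mul, ← Finset.mul_sum]
        ring
    _ ≤ _ := by linarith [sum_offDiag_inv_le M]

lemma norm_integral_gauss_block_sq_le {z : ℂ} (hz : 0 < z.re) (hi : 1 / 2 ≤ z.im) {H : ℝ}
    (hH : 0 ≤ H) (M : ℕ) {Δ : ℝ} (hΔ : 2 ≤ Δ) (m : ℝ) :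
    ‖∫ t, (gauss Δ m t : ℂ) * block z H M t ^ 2‖ ≤
      π * rexp 1 * H ^ 2 * (32 * (M / Δ) + 24 * harm M ^ 2) := by
  have hΔ0 : 0 < Δ := by linarith
  set w : ℝ → ℝ := fun y ↦ rexp (-(Δ ^ 2 * y ^ 2 / 4)) with hwdef
  have hweq : w = fun y ↦ rexp (-(Δ ^ 2 / 4) * y ^ 2) := by
    funext y; rw [hwdef]; ring_nf
  have hw : IntegrableOn w (Ioi 0) := by
    rw [hweq]; exact (integrable_exp_neg_mul_sq (by positivity)).integrableOn
  have hwI : ∫ y in Ioi (0 : ℝ), w y = √π / Δ := by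
    rw [hweq, integral_gaussian_Ioi, show π / (Δ ^ 2 / 4) = π * (2 / Δ) ^ 2 by field_simp; norm_num,
      Real.sqrt_mul Real.pi_pos.le, Real.sqrt_sq (by positivity)]
    field_simp
  have h1 := norm_integral_gauss_sq_le (integrableOn_amp hz hH M) hΔ0 m
  have hfw : IntegrableOn (fun y ↦ ‖waveSum z M y‖ * w y) (Ioi 0) := by
    simpa using integrableOn_exp_neg_mul_pow_waveSum hz M 1 hw
  have h2 : ∫ y in Ioi (0 : ℝ), ‖amp z H M y‖ * w y ≤
      H * ∫ y in Ioi (0 : ℝ), ‖waveSum z M y‖ * w y := by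
    rw [← integral_const_mul]
    refine integral_mono_of_nonneg (Eventually.of_forall fun y ↦ by
      simp only [Pi.zero_apply]; positivity) (hfw.const_mul H) (Eventually.of_forall fun y ↦ ?_)
    simp only
    rw [amp, norm_mul, ← waveSum]
    have := norm_kern_le hH y
    calc ‖waveSum z M y‖ * ‖kern H y‖ * w y ≤ ‖waveSum z M y‖ * H * w y := by gcongr
      _ = _ := by ring
  have h3 := sq_integral_mul_le hw hfw (integrableOn_exp_neg_mul_pow_waveSum hz M 2 hw)
    (fun y ↦ (Real.exp_pos _).le) (by rw [hwI]; positivity)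
  rw [hwI] at h3
  have hexp : IntegrableOn (fun y : ℝ ↦ rexp (-(Δ * y))) (Ioi 0) := by
    simpa [neg_mul] using integrableOn_exp_mul_Ioi (a := -Δ) (by linarith) 0
  have h4 : ∫ y in Ioi (0 : ℝ), ‖waveSum z M y‖ ^ 2 * w y ≤
      rexp 1 * ∫ y in Ioi (0 : ℝ), ‖waveSum z M y‖ ^ 2 * rexp (-(Δ * y)) := by
    rw [← integral_const_mul]
    refine integral_mono (integrableOn_exp_neg_mul_pow_waveSum hz M 2 hw)
      ((integrableOn_exp_neg_mul_pow_waveSum hz M 2 hexp).const_mul _) fun y ↦ ?_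
    simp only
    rw [mul_left_comm]
    gcongr
    rw [hwdef, ← Real.exp_add, Real.exp_le_exp]
    nlinarith [sq_nonneg (Δ * y / 2 - 1)]
  have h5 := integral_norm_waveSum_sq_le hz hi M hΔ
  have h0 : 0 ≤ ∫ y in Ioi (0 : ℝ), ‖amp z H M y‖ * w y := integral_nonneg fun y ↦ by positivity
  refine h1.trans ?_
  calc √π * Δ * (∫ y in Ioi 0, ‖amp z H M y‖ * rexp (-(Δ ^ 2 * y ^ 2 / 4))) ^ 2
      ≤ √π * Δ * (H * ∫ y in Ioi (0 : ℝ), ‖waveSum z M y‖ * w y) ^ 2 := by gcongr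
    _ = √π * Δ * H ^ 2 * (∫ y in Ioi (0 : ℝ), ‖waveSum z M y‖ * w y) ^ 2 := by ring
    _ ≤ √π * Δ * H ^ 2 * ((rexp 1 * (32 * (M / Δ) + 24 * harm M ^ 2)) * (√π / Δ)) := by
        gcongr
        refine h3.trans ?_
        gcongr
        exact h4.trans (by gcongr)
    _ = (√π * √π) * rexp 1 * H ^ 2 * (32 * (M / Δ) + 24 * harm M ^ 2) := by field_simp
    _ = _ := by rw [Real.mul_self_sqrt Real.pi_pos.le]

end SquareTerm

section LatticeSum

open Complex MeasureTheory Set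
open scoped Real

lemma continuous_profile (z : ℂ) (Δ m : ℝ) : Continuous (profile z Δ m) := by
  unfold profile; fun_prop

lemma profile_pos (z : ℂ) (Δ m x : ℝ) : 0 < profile z Δ m x := by
  unfold profile; positivity

lemma profile_le (z : ℂ) (Δ m x : ℝ) : profile z Δ m x ≤ rexp (-(2 * π * z.re) * x ^ 2) := by
  rw [profile, show -(2 * π * z.re * x ^ 2) = -(2 * π * z.re) * x ^ 2 by ring]
  exact mul_le_of_le_one_right (Real.exp_pos _).le
    (Real.exp_le_one_iff.mpr (neg_nonpos.mpr (by positivity)))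

lemma integrableOn_profile {z : ℂ} (hz : 0 < z.re) (Δ m : ℝ) (s : Set ℝ) :
    IntegrableOn (profile z Δ m) s := by
  refine Integrable.integrableOn ((integrable_exp_neg_mul_sq
    (b := 2 * π * z.re) (by positivity)).mono' (continuous_profile z Δ m).aestronglyMeasurable
    (Eventually.of_forall fun x ↦ ?_))
  rw [Real.norm_of_nonneg (profile_pos z Δ m x).le]
  exact profile_le z Δ m x

/-- The variation of the Gaussian `exp (-u ^ 2)` from `-∞` to `u`. -/
noncomputable def gaussVariation (u : ℝ) : ℝ :=
  if u ≤ 0 then rexp (-u ^ 2) else 2 - rexp (-u ^ 2)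

lemma gaussVariation_mem (u : ℝ) : 0 ≤ gaussVariation u ∧ gaussVariation u ≤ 2 := by
  have h1 : rexp (-u ^ 2) ≤ 1 := Real.exp_le_one_iff.mpr (neg_nonpos.mpr (sq_nonneg u))
  have h2 := Real.exp_pos (-u ^ 2)
  unfold gaussVariation
  split_ifs <;> constructor <;> linarith

lemma abs_gauss_sub_le_variation {u v : ℝ} (huv : u ≤ v) :
    |rexp (-v ^ 2) - rexp (-u ^ 2)| ≤ gaussVariation v - gaussVariation u := by
  have h1 : ∀ w : ℝ, rexp (-w ^ 2) ≤ 1 := fun w ↦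
    Real.exp_le_one_iff.mpr (neg_nonpos.mpr (sq_nonneg w))
  have hu := h1 u
  have hv := h1 v
  unfold gaussVariation
  split_ifs with h2 h3 h3
  · have : rexp (-u ^ 2) ≤ rexp (-v ^ 2) := by
      rw [Real.exp_le_exp]; nlinarith
    rw [abs_of_nonneg (by linarith)]
  · linarith
  · rw [abs_le]; constructor <;> linarith
  · have : rexp (-v ^ 2) ≤ rexp (-u ^ 2) := by
      rw [Real.exp_le_exp]; nlinarith
    rw [abs_of_nonpos (by linarith)]
    linarith

/-- A monotone majorant of the variation of `profile z Δ m`. -/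
noncomputable def profileVariation (z : ℂ) (Δ m x : ℝ) : ℝ :=
  -rexp (-(2 * π * z.re * x ^ 2)) + gaussVariation ((2 * π * z.im * x ^ 2 - m) / Δ)

lemma abs_profile_sub_le {z : ℂ} (hz : 0 ≤ z.re) (hi : 0 ≤ z.im) {Δ : ℝ} (hΔ : 0 < Δ) (m : ℝ)
    {x y : ℝ} (hx : 0 ≤ x) (hxy : x ≤ y) :
    |profile z Δ m y - profile z Δ m x| ≤ profileVariation z Δ m y - profileVariation z Δ m x := by
  have hsq : x ^ 2 ≤ y ^ 2 := by gcongr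
  have hA : rexp (-(2 * π * z.re * y ^ 2)) ≤ rexp (-(2 * π * z.re * x ^ 2)) := by
    rw [Real.exp_le_exp]; gcongr
  have hA1 : rexp (-(2 * π * z.re * x ^ 2)) ≤ 1 :=
    Real.exp_le_one_iff.mpr (neg_nonpos.mpr (by positivity))
  have hu : (2 * π * z.im * x ^ 2 - m) / Δ ≤ (2 * π * z.im * y ^ 2 - m) / Δ := by gcongr
  have hg := abs_gauss_sub_le_variation hu
  unfold profile profileVariation
  simp_rw [← div_pow]
  set A := rexp (-(2 * π * z.re * y ^ 2))
  set A' := rexp (-(2 * π * z.re * x ^ 2))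
  set u := (2 * π * z.im * x ^ 2 - m) / Δ
  set v := (2 * π * z.im * y ^ 2 - m) / Δ
  have h1 : rexp (-v ^ 2) ≤ 1 := Real.exp_le_one_iff.mpr (neg_nonpos.mpr (sq_nonneg v))
  have h2 := Real.exp_pos (-v ^ 2)
  have h3 : 0 < A' := Real.exp_pos _
  rw [show A * rexp (-v ^ 2) - A' * rexp (-u ^ 2) =
    -((A' - A) * rexp (-v ^ 2)) + A' * (rexp (-v ^ 2) - rexp (-u ^ 2)) by ring]
  refine (abs_add_le _ _).trans ?_
  rw [abs_neg, abs_of_nonneg (mul_nonneg (by linarith) h2.le), abs_mul, abs_of_pos h3]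
  have h4 : (A' - A) * rexp (-v ^ 2) ≤ A' - A := mul_le_of_le_one_right (by linarith) h1
  have h5 : A' * |rexp (-v ^ 2) - rexp (-u ^ 2)| ≤ |rexp (-v ^ 2) - rexp (-u ^ 2)| :=
    mul_le_of_le_one_left (abs_nonneg _) hA1
  linarith

lemma profileVariation_sub_le (z : ℂ) (hz : 0 ≤ z.re) (Δ m x y : ℝ) :
    profileVariation z Δ m y - profileVariation z Δ m x ≤ 3 := by
  have hA1 : rexp (-(2 * π * z.re * x ^ 2)) ≤ 1 :=
    Real.exp_le_one_iff.mpr (neg_nonpos.mpr (by positivity))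
  have := Real.exp_pos (-(2 * π * z.re * y ^ 2))
  have h1 := gaussVariation_mem ((2 * π * z.im * x ^ 2 - m) / Δ)
  have h2 := gaussVariation_mem ((2 * π * z.im * y ^ 2 - m) / Δ)
  unfold profileVariation
  linarith [h1.1, h2.2]

lemma abs_riemann_sum_sub_integral_le {q Q : ℝ → ℝ} (hq : Continuous q)
    (hQ : ∀ x y, 0 ≤ x → x ≤ y → |q y - q x| ≤ Q y - Q x) {h : ℝ} (hh : 0 ≤ h) (M : ℕ) :
    |h * ∑ n ∈ Finset.range M, q (((n : ℝ) + 1) * h) - ∫ x in (0 : ℝ)..M * h, q x| ≤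
      h * (Q (M * h) - Q 0) := by
  have hsum := intervalIntegral.sum_integral_adjacent_intervals (f := q) (μ := volume)
    (a := fun n : ℕ ↦ (n : ℝ) * h) (n := M) fun k _ ↦ hq.intervalIntegrable _ _
  simp only [Nat.cast_zero, zero_mul] at hsum
  have htel : ∑ n ∈ Finset.range M, (Q (((n : ℝ) + 1) * h) - Q (n * h)) = Q (M * h) - Q 0 := by
    have := Finset.sum_range_sub (fun n : ℕ ↦ Q (n * h)) M
    push_cast at this
    rw [this, zero_mul]
  rw [← hsum, ← htel, Finset.mul_sum, Finset.mul_sum, ← Finset.sum_sub_distrib]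
  refine (Finset.abs_sum_le_sum_abs _ _).trans (Finset.sum_le_sum fun n _ ↦ ?_)
  have hle : (n : ℝ) * h ≤ ((n : ℝ) + 1) * h := by gcongr; linarith
  have hcst : h * q (((n : ℝ) + 1) * h) = ∫ _ in (n : ℝ) * h..((n : ℝ) + 1) * h,
      q (((n : ℝ) + 1) * h) := by
    rw [intervalIntegral.integral_const, smul_eq_mul]; ring
  push_cast
  rw [hcst, ← intervalIntegral.integral_sub intervalIntegrable_const (hq.intervalIntegrable _ _),
    ← Real.norm_eq_abs]
  have hb := intervalIntegral.norm_integral_le_of_norm_le_const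
    (f := fun x ↦ q (((n : ℝ) + 1) * h) - q x) (a := (n : ℝ) * h) (b := ((n : ℝ) + 1) * h)
    (C := Q (((n : ℝ) + 1) * h) - Q (n * h)) (fun x hx ↦ by
      rw [uIoc_of_le hle] at hx
      have h0 : 0 ≤ (n : ℝ) * h := by positivity
      have h1 := hQ x _ (h0.trans hx.1.le) hx.2
      have h2 := (abs_nonneg _).trans (hQ _ x h0 hx.1.le)
      rw [Real.norm_eq_abs]
      linarith)
  refine hb.trans (le_of_eq ?_)
  rw [show ((n : ℝ) + 1) * h - n * h = h by ring, abs_of_nonneg hh, mul_comm]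

lemma integral_profile_tail_le {z : ℂ} (hz : 0 < z.re) (Δ m : ℝ) {R : ℝ} (hR : 0 ≤ R) :
    ∫ x in Ioi R, profile z Δ m x ≤ rexp (-(π * z.re * R ^ 2)) * (1 / (2 * √z.re)) := by
  have hg : Integrable (fun x : ℝ ↦ rexp (-(π * z.re) * x ^ 2)) :=
    integrable_exp_neg_mul_sq (by positivity)
  calc ∫ x in Ioi R, profile z Δ m x
      ≤ ∫ x in Ioi R, rexp (-(π * z.re * R ^ 2)) * rexp (-(π * z.re) * x ^ 2) := by
        refine setIntegral_mono_on (integrableOn_profile hz Δ m _) (hg.const_mul _).integrableOn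
          measurableSet_Ioi fun x hx ↦ (profile_le z Δ m x).trans ?_
        rw [← Real.exp_add, Real.exp_le_exp]
        have h1 : R ^ 2 ≤ x ^ 2 := by gcongr; exact le_of_lt hx
        have h2 : 0 ≤ π * z.re := by positivity
        nlinarith
    _ ≤ rexp (-(π * z.re * R ^ 2)) * ∫ x in Ioi (0 : ℝ), rexp (-(π * z.re) * x ^ 2) := by
        rw [integral_const_mul]
        exact mul_le_mul_of_nonneg_left (setIntegral_mono_set hg.integrableOn
          (Eventually.of_forall fun x ↦ (Real.exp_pos _).le)
          (Ioi_subset_Ioi hR).eventuallyLE) (Real.exp_pos _).le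
    _ = _ := by
        rw [integral_gaussian_Ioi, show π / (π * z.re) = 1 / z.re by field_simp,
          Real.sqrt_div zero_le_one, Real.sqrt_one]
        field_simp

lemma abs_lattice_sum_sub_le {z : ℂ} (hz : 0 < z.re) (hi : 0 ≤ z.im) {Δ : ℝ} (hΔ : 0 < Δ) (m : ℝ)
    (M : ℕ) {h : ℝ} (hh : 1 ≤ h) :
    |h * ∑ n ∈ Finset.range M, profile z Δ m (((n : ℝ) + 1) * h) -
      ∫ x in Ioi (0 : ℝ), profile z Δ m x| ≤
      3 * h + rexp (-(π * z.re * M ^ 2)) * (1 / (2 * √z.re)) := by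
  have hMh : (0 : ℝ) ≤ M * h := by positivity
  have h1 := abs_riemann_sum_sub_integral_le (continuous_profile z Δ m)
    (fun x y hx hxy ↦ abs_profile_sub_le hz.le hi hΔ m hx hxy) (by linarith : 0 ≤ h) M
  have h2 : h * (profileVariation z Δ m (M * h) - profileVariation z Δ m 0) ≤ 3 * h := by
    have := profileVariation_sub_le z hz.le Δ m 0 (M * h)
    nlinarith
  have h3 : ∫ x in Ioi (0 : ℝ), profile z Δ m x =
      (∫ x in (0 : ℝ)..M * h, profile z Δ m x) + ∫ x in Ioi (M * h), profile z Δ m x := by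
    rw [intervalIntegral.integral_of_le hMh, ← setIntegral_union (Ioc_disjoint_Ioi le_rfl)
      measurableSet_Ioi (integrableOn_profile hz Δ m _) (integrableOn_profile hz Δ m _),
      Ioc_union_Ioi_eq_Ioi hMh]
  have h4 : ∫ x in Ioi (M * h), profile z Δ m x ≤
      rexp (-(π * z.re * M ^ 2)) * (1 / (2 * √z.re)) := by
    refine (integral_profile_tail_le hz Δ m hMh).trans ?_
    gcongr
    exact le_mul_of_one_le_right (by positivity) hh
  have h5 : 0 ≤ ∫ x in Ioi (M * h), profile z Δ m x :=
    integral_nonneg fun x ↦ (profile_pos z Δ m x).le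
  rw [h3]
  rw [abs_le] at h1 ⊢
  constructor <;> linarith [h1.1, h1.2]

lemma integral_norm_kern_sq_tail_le {H : ℝ} (hH : 0 ≤ H) {Y : ℝ} (hY : 0 < Y) :
    ∫ y in Ioi Y, ‖kern H y‖ ^ 2 ≤ 4 / Y := by
  have hinteg : IntegrableOn (fun y : ℝ ↦ y ^ (-2 : ℝ)) (Ioi Y) :=
    integrableOn_Ioi_rpow_of_lt (by norm_num) hY
  calc ∫ y in Ioi Y, ‖kern H y‖ ^ 2 ≤ ∫ y in Ioi Y, 4 * y ^ (-2 : ℝ) := by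
        refine setIntegral_mono_on (integrable_norm_kern_sq hH).integrableOn (hinteg.const_mul 4)
          measurableSet_Ioi fun y hy ↦ ?_
        have hy0 : 0 < y := hY.trans hy
        have h1 := norm_kern_le_div H hy0.ne'
        rw [abs_of_pos hy0] at h1
        calc ‖kern H y‖ ^ 2 ≤ (2 / y) ^ 2 := by gcongr
          _ = _ := by
            rw [Real.rpow_neg hy0.le, Real.rpow_two]
            field_simp
            norm_num
    _ = 4 / Y := by
        rw [integral_const_mul, integral_Ioi_rpow_of_lt (by norm_num) hY,
          show (-2 : ℝ) + 1 = -1 by norm_num, Real.rpow_neg_one]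
        field_simp

lemma abs_sum_kern_profile_sub_le {z : ℂ} (hz : 0 < z.re) (hi : 0 ≤ z.im) {Δ : ℝ} (hΔ : 0 < Δ)
    (m : ℝ) {H : ℝ} (hH : 0 ≤ H) (M : ℕ) {Y : ℝ} (hY : 0 < Y) :
    |(∑ n ∈ Finset.range M, ∫ y in Ioi (0 : ℝ), ‖kern H y‖ ^ 2 *
        (rexp y * profile z Δ m (((n : ℝ) + 1) * rexp y))) -
      π * H * ∫ x in Ioi (0 : ℝ), profile z Δ m x| ≤
    (4 / Y + 4 / Y ^ 2 * harm M) * (∫ x in Ioi (0 : ℝ), profile z Δ m x) +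
      (3 * rexp Y + rexp (-(π * z.re * M ^ 2)) * (1 / (2 * √z.re))) * (π * H) := by
  set Iq : ℝ := ∫ x in Ioi (0 : ℝ), profile z Δ m x with hIq
  set η : ℝ := rexp (-(π * z.re * M ^ 2)) * (1 / (2 * √z.re)) with hη
  have hIq0 : 0 ≤ Iq := integral_nonneg fun x ↦ (profile_pos z Δ m x).le
  have hη0 : 0 ≤ η := by positivity
  set f : ℕ → ℝ → ℝ := fun n y ↦ rexp y * profile z Δ m (((n : ℝ) + 1) * rexp y) with hf
  have hf0 : ∀ n y, 0 ≤ f n y := fun n y ↦ mul_nonneg (Real.exp_pos _).le (profile_pos _ _ _ _).le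
  have hfi : ∀ n y₀, IntegrableOn (f n) (Ioi y₀) ∧
      ∫ y in Ioi y₀, f n y = 1 / ((n : ℝ) + 1) * ∫ x in Ioi (((n : ℝ) + 1) * rexp y₀),
        profile z Δ m x := fun n y₀ ↦
    integrableOn_exp_comp_exp (integrableOn_profile hz Δ m _) (by positivity) y₀
  have hK : Continuous fun y ↦ ‖kern H y‖ ^ 2 := (continuous_kern H).norm.pow 2
  have hKb : ∀ y, ‖kern H y‖ ^ 2 ≤ H ^ 2 := fun y ↦ by gcongr; exact norm_kern_le hH y
  have hgi : ∀ n, IntegrableOn (fun y ↦ ‖kern H y‖ ^ 2 * f n y) (Ioi 0) := fun n ↦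
    Integrable.bdd_mul (c := H ^ 2) (hfi n 0).1 hK.aestronglyMeasurable
      (Eventually.of_forall fun y ↦ by rw [Real.norm_of_nonneg (by positivity)]; exact hKb y)
  have hKi : Integrable fun y ↦ ‖kern H y‖ ^ 2 := integrable_norm_kern_sq hH
  have split : ∀ g : ℝ → ℝ, IntegrableOn g (Ioi 0) →
      ∫ y in Ioi (0 : ℝ), g y = (∫ y in Ioc 0 Y, g y) + ∫ y in Ioi Y, g y := fun g hg ↦ by
    rw [← setIntegral_union (Ioc_disjoint_Ioi le_rfl) measurableSet_Ioi
      (hg.mono_set Ioc_subset_Ioi_self) (hg.mono_set (Ioi_subset_Ioi hY.le)),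
      Ioc_union_Ioi_eq_Ioi hY.le]
  have hKsplit := split _ hKi.integrableOn
  rw [integral_norm_kern_sq hH] at hKsplit
  have hKtail := integral_norm_kern_sq_tail_le hH hY
  have hKtail0 : 0 ≤ ∫ y in Ioi Y, ‖kern H y‖ ^ 2 := integral_nonneg fun y ↦ by positivity
  have hKhead0 : 0 ≤ ∫ y in Ioc 0 Y, ‖kern H y‖ ^ 2 := integral_nonneg fun y ↦ by positivity
  have hhead : |(∑ n ∈ Finset.range M, ∫ y in Ioc 0 Y, ‖kern H y‖ ^ 2 * f n y) -
      Iq * ∫ y in Ioc 0 Y, ‖kern H y‖ ^ 2| ≤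
      (3 * rexp Y + η) * ∫ y in Ioc 0 Y, ‖kern H y‖ ^ 2 := by
    have hgi' : ∀ n ∈ Finset.range M, IntegrableOn (fun y ↦ ‖kern H y‖ ^ 2 * f n y) (Ioc 0 Y) :=
      fun n _ ↦ (hgi n).mono_set Ioc_subset_Ioi_self
    rw [← integral_finsetSum _ hgi', ← integral_const_mul, ← integral_const_mul,
      ← integral_sub (integrable_finsetSum _ hgi') (hKi.integrableOn.const_mul Iq),
      ← Real.norm_eq_abs]
    refine norm_integral_le_of_norm_le (hKi.integrableOn.const_mul _) ?_
    filter_upwards [ae_restrict_mem measurableSet_Ioc] with y hy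
    have h1 := abs_lattice_sum_sub_le hz hi hΔ m M (Real.one_le_exp hy.1.le)
    have h2 : (∑ n ∈ Finset.range M, ‖kern H y‖ ^ 2 * f n y) - Iq * ‖kern H y‖ ^ 2 =
        ‖kern H y‖ ^ 2 * (rexp y * ∑ n ∈ Finset.range M, profile z Δ m (((n : ℝ) + 1) * rexp y) -
          Iq) := by
      rw [← Finset.mul_sum, hf]
      simp only
      rw [← Finset.mul_sum]
      ring
    rw [h2, norm_mul, Real.norm_of_nonneg (by positivity), Real.norm_eq_abs, mul_comm]
    gcongr
    refine h1.trans ?_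
    gcongr
    exact hy.2
  have htail : ∀ n, ∫ y in Ioi Y, ‖kern H y‖ ^ 2 * f n y ≤
      4 / Y ^ 2 * Iq * (1 / ((n : ℝ) + 1)) := fun n ↦ by
    calc ∫ y in Ioi Y, ‖kern H y‖ ^ 2 * f n y ≤ ∫ y in Ioi Y, 4 / Y ^ 2 * f n y := by
          refine setIntegral_mono_on ((hgi n).mono_set (Ioi_subset_Ioi hY.le))
            ((hfi n Y).1.const_mul _) measurableSet_Ioi fun y hy ↦ ?_
          have hy0 : 0 < y := hY.trans hy
          have h1 := norm_kern_le_div H hy0.ne'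
          rw [abs_of_pos hy0] at h1
          refine mul_le_mul_of_nonneg_right ?_ (hf0 n y)
          calc ‖kern H y‖ ^ 2 ≤ (2 / Y) ^ 2 := by
                gcongr
                exact h1.trans (by gcongr; exact le_of_lt hy)
            _ = _ := by rw [div_pow]; norm_num
      _ = 4 / Y ^ 2 * (1 / ((n : ℝ) + 1) * ∫ x in Ioi (((n : ℝ) + 1) * rexp Y),
          profile z Δ m x) := by rw [integral_const_mul, (hfi n Y).2]
      _ ≤ 4 / Y ^ 2 * (1 / ((n : ℝ) + 1) * Iq) := by
          gcongr
          exact setIntegral_mono_set (integrableOn_profile hz Δ m _)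
            (Eventually.of_forall fun x ↦ (profile_pos z Δ m x).le)
            (Ioi_subset_Ioi (by positivity)).eventuallyLE
      _ = _ := by ring
  have htail0 : 0 ≤ ∑ n ∈ Finset.range M, ∫ y in Ioi Y, ‖kern H y‖ ^ 2 * f n y :=
    Finset.sum_nonneg fun n _ ↦ integral_nonneg fun y ↦ mul_nonneg (by positivity) (hf0 n y)
  have htailsum : ∑ n ∈ Finset.range M, ∫ y in Ioi Y, ‖kern H y‖ ^ 2 * f n y ≤
      4 / Y ^ 2 * harm M * Iq := by
    refine (Finset.sum_le_sum fun n _ ↦ htail n).trans (le_of_eq ?_)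
    rw [← Finset.mul_sum, harm]; ring
  have hS : ∑ n ∈ Finset.range M, ∫ y in Ioi (0 : ℝ), ‖kern H y‖ ^ 2 * f n y =
      (∑ n ∈ Finset.range M, ∫ y in Ioc 0 Y, ‖kern H y‖ ^ 2 * f n y) +
      ∑ n ∈ Finset.range M, ∫ y in Ioi Y, ‖kern H y‖ ^ 2 * f n y := by
    rw [← Finset.sum_add_distrib]
    exact Finset.sum_congr rfl fun n _ ↦ split _ (hgi n)
  have hle : (3 * rexp Y + η) * ∫ y in Ioc 0 Y, ‖kern H y‖ ^ 2 ≤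
      (3 * rexp Y + η) * (π * H) := by gcongr; linarith
  have hmass : Iq * ∫ y in Ioi Y, ‖kern H y‖ ^ 2 ≤ 4 / Y * Iq := by
    rw [mul_comm]; gcongr
  have hmass0 : 0 ≤ Iq * ∫ y in Ioi Y, ‖kern H y‖ ^ 2 := mul_nonneg hIq0 hKtail0
  rw [hS, hKsplit]
  rw [abs_le] at hhead ⊢
  rw [hKsplit] at hle
  constructor <;> nlinarith [hhead.1, hhead.2]

end LatticeSum

section ProfileMass

open Complex MeasureTheory Set
open scoped Real

lemma integral_gauss_compl_le {Δ : ℝ} (hΔ : 0 < Δ) (m : ℝ) {R : ℝ} (hR : 0 ≤ R) {s : Set ℝ}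
    (hs : MeasurableSet s) (h : ∀ t ∈ s, R ≤ |t - m|) :
    ∫ t in s, gauss Δ m t ≤ 2 * rexp (-(R ^ 2 / (2 * Δ ^ 2))) * (√π * Δ) := by
  have h2 : 0 < √2 * Δ := by positivity
  have hinteg := integrable_gauss h2 m
  have hb : ∀ t ∈ s, gauss Δ m t ≤ rexp (-(R ^ 2 / (2 * Δ ^ 2))) * gauss (√2 * Δ) m t := by
    intro t ht
    have h1 : R ^ 2 ≤ (t - m) ^ 2 := by
      rw [← sq_abs (t - m)]
      exact pow_le_pow_left₀ hR (h t ht) 2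
    unfold gauss
    rw [← Real.exp_add, Real.exp_le_exp, mul_pow, Real.sq_sqrt zero_le_two]
    have h3 : R ^ 2 / (2 * Δ ^ 2) ≤ (t - m) ^ 2 / (2 * Δ ^ 2) := by gcongr
    have h4 : (t - m) ^ 2 / Δ ^ 2 = 2 * ((t - m) ^ 2 / (2 * Δ ^ 2)) := by field_simp
    rw [h4]; linarith
  calc ∫ t in s, gauss Δ m t
      ≤ ∫ t in s, rexp (-(R ^ 2 / (2 * Δ ^ 2))) * gauss (√2 * Δ) m t :=
        setIntegral_mono_on (integrable_gauss hΔ m).integrableOn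
          (hinteg.const_mul _).integrableOn hs hb
    _ = rexp (-(R ^ 2 / (2 * Δ ^ 2))) * ∫ t in s, gauss (√2 * Δ) m t := integral_const_mul _ _
    _ ≤ rexp (-(R ^ 2 / (2 * Δ ^ 2))) * ∫ t, gauss (√2 * Δ) m t :=
        mul_le_mul_of_nonneg_left (setIntegral_le_integral hinteg
          (Eventually.of_forall fun t ↦ (gauss_pos _ _ _).le)) (Real.exp_pos _).le
    _ = √2 * (rexp (-(R ^ 2 / (2 * Δ ^ 2))) * (√π * Δ)) := by rw [integral_gauss h2]; ring
    _ ≤ 2 * (rexp (-(R ^ 2 / (2 * Δ ^ 2))) * (√π * Δ)) := by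
        refine mul_le_mul_of_nonneg_right ?_ (by positivity)
        rw [Real.sqrt_le_left zero_le_two]; norm_num
    _ = _ := by ring

lemma integral_gauss_interval_ge {Δ : ℝ} (hΔ : 0 < Δ) (m : ℝ) {R : ℝ} (hR : 0 ≤ R) :
    (1 - 2 * rexp (-(R ^ 2 / (2 * Δ ^ 2)))) * (√π * Δ) ≤
      ∫ t in (m - R)..(m + R), gauss Δ m t := by
  have h1 := integral_add_compl (μ := volume) (s := Ioc (m - R) (m + R)) measurableSet_Ioc
    (integrable_gauss hΔ m)
  have h2 := integral_gauss_compl_le hΔ m hR (s := (Ioc (m - R) (m + R))ᶜ)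
    measurableSet_Ioc.compl (fun t ht ↦ by
      rw [mem_compl_iff, mem_Ioc, not_and_or, not_lt, not_le] at ht
      rcases ht with ht | ht
      · rw [abs_sub_comm]; exact le_trans (by linarith) (le_abs_self _)
      · exact le_trans (by linarith) (le_abs_self _))
  rw [integral_gauss hΔ] at h1
  rw [intervalIntegral.integral_of_le (by linarith)]
  linarith

lemma integral_gauss_interval_le {Δ : ℝ} (hΔ : 0 < Δ) (m : ℝ) {a b : ℝ} (hab : a ≤ b) :
    ∫ t in a..b, gauss Δ m t ≤ √π * Δ := by
  rw [intervalIntegral.integral_of_le hab, ← integral_gauss hΔ m]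
  exact setIntegral_le_integral (integrable_gauss hΔ m)
    (Eventually.of_forall fun t ↦ (gauss_pos _ _ _).le)

/-- The density of `profile` in the variable `s = 2 π (Im z) x²`, relative to a Gaussian. -/
noncomputable def profileDensity (z : ℂ) (s : ℝ) : ℝ :=
  rexp (-(z.re / z.im * s)) / (2 * √(2 * π * z.im * s))

lemma profile_eq_density {z : ℂ} (hi : 0 < z.im) (Δ m : ℝ) {x : ℝ} (hx : 0 < x) :
    profile z Δ m x = profileDensity z (2 * π * z.im * x ^ 2) *
      (gauss Δ m (2 * π * z.im * x ^ 2) * (4 * π * z.im * x)) := by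
  unfold profile profileDensity gauss
  rw [show 2 * π * z.im * (2 * π * z.im * x ^ 2) = (2 * π * z.im * x) ^ 2 by ring,
    Real.sqrt_sq (by positivity), show z.re / z.im * (2 * π * z.im * x ^ 2) = 2 * π * z.re * x ^ 2
      by field_simp]
  field_simp
  ring

lemma profileDensity_anti {z : ℂ} (hz : 0 < z.re) (hi : 0 < z.im) {s s' : ℝ} (hs : 0 < s)
    (hss : s ≤ s') : profileDensity z s' ≤ profileDensity z s := by
  unfold profileDensity
  have h1 : z.re / z.im * s ≤ z.re / z.im * s' := by gcongr
  have h2 : √(2 * π * z.im * s) ≤ √(2 * π * z.im * s') := by gcongr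
  have h3 : 0 < √(2 * π * z.im * s) := by positivity
  exact div_le_div₀ (Real.exp_pos _).le (by rw [Real.exp_le_exp]; linarith) (by positivity)
    (by linarith)

lemma profileDensity_nonneg (z : ℂ) (s : ℝ) : 0 ≤ profileDensity z s := by
  unfold profileDensity; positivity

lemma integral_profile_bounds {z : ℂ} (hz : 0 < z.re) (hi : 0 < z.im) {Δ : ℝ} (hΔ : 0 < Δ)
    {m R : ℝ} (hR : 0 ≤ R) (hRm : R < m) :
    profileDensity z (m + R) * ((1 - 2 * rexp (-(R ^ 2 / (2 * Δ ^ 2)))) * (√π * Δ)) ≤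
        ∫ x in Ioi (0 : ℝ), profile z Δ m x ∧
      ∫ x in Ioi (0 : ℝ), profile z Δ m x ≤
        profileDensity z (m - R) * (√π * Δ) + rexp (-(R ^ 2 / Δ ^ 2)) * (1 / √z.re) := by
  have hc : 0 < 2 * π * z.im := by positivity
  set f : ℝ → ℝ := fun x ↦ 2 * π * z.im * x ^ 2 with hf
  set x₁ := √((m - R) / (2 * π * z.im)) with hx₁
  set x₂ := √((m + R) / (2 * π * z.im)) with hx₂
  have hx₁0 : 0 < x₁ := Real.sqrt_pos.mpr (div_pos (by linarith) hc)
  have hx₁₂ : x₁ ≤ x₂ := by rw [hx₁, hx₂]; gcongr; linarith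
  have hf₁ : f x₁ = m - R := by
    rw [hf, hx₁]; simp only
    rw [Real.sq_sqrt (div_nonneg (by linarith) hc.le)]; field_simp
  have hf₂ : f x₂ = m + R := by
    rw [hf, hx₂]; simp only
    rw [Real.sq_sqrt (div_nonneg (by linarith) hc.le)]; field_simp
  have hfm : ∀ x y, 0 ≤ x → x ≤ y → f x ≤ f y := fun x y hx hxy ↦ by
    simp only [hf]; gcongr
  have hd : ∀ x, HasDerivAt f (4 * π * z.im * x) x := fun x ↦ by
    have := (hasDerivAt_pow 2 x).const_mul (2 * π * z.im)
    refine this.congr_deriv ?_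
    push_cast; ring
  have hsub : ∫ x in x₁..x₂, gauss Δ m (f x) * (4 * π * z.im * x) =
      ∫ t in (m - R)..(m + R), gauss Δ m t := by
    have := intervalIntegral.integral_comp_mul_deriv (a := x₁) (b := x₂) (f := f)
      (f' := fun x ↦ 4 * π * z.im * x) (g := gauss Δ m) (fun x _ ↦ hd x)
      (by fun_prop) (continuous_gauss Δ m)
    rw [hf₁, hf₂] at this
    exact this
  have hcg := continuous_gauss Δ m
  have hii : ∀ c : ℝ, IntervalIntegrable (fun x ↦ c * (gauss Δ m (f x) * (4 * π * z.im * x)))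
      volume x₁ x₂ := fun c ↦ Continuous.intervalIntegrable (by fun_prop) _ _
  have hip := (continuous_profile z Δ m).intervalIntegrable (μ := volume) x₁ x₂
  have hmid : ∀ x ∈ Icc x₁ x₂, 0 ≤ gauss Δ m (f x) * (4 * π * z.im * x) := fun x hx ↦ by
    have := gauss_pos Δ m (f x)
    have := hx₁0.trans_le hx.1
    positivity
  have hlow : profileDensity z (m + R) * ∫ t in (m - R)..(m + R), gauss Δ m t ≤
      ∫ x in x₁..x₂, profile z Δ m x := by
    rw [← hsub, ← intervalIntegral.integral_const_mul]
    refine intervalIntegral.integral_mono_on hx₁₂ (hii _) hip fun x hx ↦ ?_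
    rw [profile_eq_density hi Δ m (hx₁0.trans_le hx.1)]
    refine mul_le_mul_of_nonneg_right ?_ (hmid x hx)
    rw [← hf₂]
    have := hx₁0.trans_le hx.1
    exact profileDensity_anti hz hi (by positivity) (hfm x x₂ this.le hx.2)
  have hupp : ∫ x in x₁..x₂, profile z Δ m x ≤
      profileDensity z (m - R) * ∫ t in (m - R)..(m + R), gauss Δ m t := by
    rw [← hsub, ← intervalIntegral.integral_const_mul]
    refine intervalIntegral.integral_mono_on hx₁₂ hip (hii _) fun x hx ↦ ?_
    rw [profile_eq_density hi Δ m (hx₁0.trans_le hx.1)]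
    refine mul_le_mul_of_nonneg_right ?_ (hmid x hx)
    rw [← hf₁]
    exact profileDensity_anti hz hi (by positivity) (hfm x₁ x hx₁0.le hx.1)
  have hsplit : (∫ x in x₁..x₂, profile z Δ m x) +
      ∫ x in Ioi 0 \ Ioc x₁ x₂, profile z Δ m x = ∫ x in Ioi (0 : ℝ), profile z Δ m x := by
    rw [intervalIntegral.integral_of_le hx₁₂, setIntegral_sdiff (s := Ioi 0) measurableSet_Ioc
      (integrableOn_profile hz Δ m _) (fun x hx ↦ hx₁0.trans hx.1)]
    ring
  have hout0 : 0 ≤ ∫ x in Ioi 0 \ Ioc x₁ x₂, profile z Δ m x :=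
    setIntegral_nonneg (measurableSet_Ioi.diff measurableSet_Ioc) fun x _ ↦ (profile_pos _ _ _ _).le
  have hg : Integrable (fun x : ℝ ↦ rexp (-(2 * π * z.re) * x ^ 2)) :=
    integrable_exp_neg_mul_sq (by positivity)
  have hout : ∫ x in Ioi 0 \ Ioc x₁ x₂, profile z Δ m x ≤
      rexp (-(R ^ 2 / Δ ^ 2)) * (1 / √z.re) := by
    calc ∫ x in Ioi 0 \ Ioc x₁ x₂, profile z Δ m x
        ≤ ∫ x in Ioi 0 \ Ioc x₁ x₂, rexp (-(R ^ 2 / Δ ^ 2)) * rexp (-(2 * π * z.re) * x ^ 2) := by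
          refine setIntegral_mono_on (integrableOn_profile hz Δ m _)
            (hg.const_mul _).integrableOn (measurableSet_Ioi.diff measurableSet_Ioc)
            fun x hx ↦ ?_
          have hx0 : 0 < x := hx.1
          have hsq : R ^ 2 ≤ (f x - m) ^ 2 := by
            rw [← sq_abs (f x - m)]
            refine pow_le_pow_left₀ hR ?_ 2
            rcases not_and_or.mp hx.2 with h | h
            · rw [not_lt] at h
              have := hfm x x₁ hx0.le h
              rw [abs_sub_comm]; exact le_trans (by linarith) (le_abs_self _)
            · rw [not_le] at h
              have := hfm x₂ x (hx₁0.le.trans hx₁₂) h.le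
              exact le_trans (by linarith) (le_abs_self _)
          unfold profile
          rw [mul_comm, neg_mul]
          refine mul_le_mul_of_nonneg_right ?_ (Real.exp_pos _).le
          rw [Real.exp_le_exp, neg_le_neg_iff]
          exact div_le_div_of_nonneg_right hsq (by positivity)
      _ = rexp (-(R ^ 2 / Δ ^ 2)) * ∫ x in Ioi 0 \ Ioc x₁ x₂, rexp (-(2 * π * z.re) * x ^ 2) :=
          integral_const_mul _ _
      _ ≤ rexp (-(R ^ 2 / Δ ^ 2)) * ∫ x in Ioi (0 : ℝ), rexp (-(2 * π * z.re) * x ^ 2) :=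
          mul_le_mul_of_nonneg_left (setIntegral_mono_set hg.integrableOn
            (Eventually.of_forall fun x ↦ (Real.exp_pos _).le) sdiff_subset.eventuallyLE)
            (Real.exp_pos _).le
      _ ≤ _ := by
          refine mul_le_mul_of_nonneg_left ?_ (Real.exp_pos _).le
          rw [integral_gaussian_Ioi, show π / (2 * π * z.re) = 1 / (2 * z.re) by field_simp,
            Real.sqrt_div zero_le_one, Real.sqrt_one, div_div]
          refine one_div_le_one_div_of_le (by positivity) ?_
          have : √z.re ≤ √(2 * z.re) := by gcongr; linarith
          linarith [Real.sqrt_nonneg z.re]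
  have hA := integral_gauss_interval_ge hΔ m hR
  have hB := integral_gauss_interval_le hΔ m (show m - R ≤ m + R by linarith)
  have hp₁ := profileDensity_nonneg z (m + R)
  have hp₂ := profileDensity_nonneg z (m - R)
  constructor
  · have := mul_le_mul_of_nonneg_left hA hp₁
    linarith
  · have := mul_le_mul_of_nonneg_left hB hp₂
    linarith

end ProfileMass

section ProfileAsymptotics

open Complex MeasureTheory Set
open scoped Real

lemma tendsto_rpow_mul_exp_neg_rpow (k : ℝ) {c ρ : ℝ} (hc : 0 < c) (hρ : 0 < ρ) :
    Tendsto (fun T : ℝ ↦ T ^ k * rexp (-(c * T ^ ρ))) atTop (𝓝 0) := by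
  have h := (tendsto_rpow_mul_exp_neg_mul_atTop_nhds_zero (k / ρ) c hc).comp
    (tendsto_rpow_atTop hρ)
  refine h.congr' ?_
  filter_upwards [eventually_gt_atTop 0] with T hT
  simp only [Function.comp]
  rw [← Real.rpow_mul hT.le, mul_div_cancel₀ _ hρ.ne', neg_mul]

lemma tendsto_rpow_neg_exponent {s : ℝ} (hs : s < 0) :
    Tendsto (fun T : ℝ ↦ T ^ s) atTop (𝓝 0) := by
  have := tendsto_rpow_neg_atTop (neg_pos.mpr hs)
  simpa using this

lemma tendsto_mul_ray_re : Tendsto (fun T : ℝ ↦ T * (ray T).re) atTop (𝓝 1) := by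
  have h := (Real.hasDerivAt_sin 0).tendsto_slope_zero
  have h2 := h.comp (tendsto_inv_atTop_nhdsGT_zero.mono_right
    (nhdsWithin_mono _ fun x (hx : 0 < x) ↦ hx.ne'))
  simp only [Real.cos_zero] at h2
  refine h2.congr fun T ↦ ?_
  simp [ray_re]

lemma tendsto_ray_im : Tendsto (fun T : ℝ ↦ (ray T).im) atTop (𝓝 1) := by
  have h := (Real.continuous_cos.tendsto 0).comp tendsto_inv_atTop_zero
  rw [Real.cos_zero] at h
  refine h.congr fun T ↦ ?_
  simp [ray_im]

lemma one_div_sqrt_ray_re_le {T : ℝ} (hT : 1 ≤ T) : 1 / √(ray T).re ≤ 2 * T ^ (1 / 2 : ℝ) := by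
  have h1 := sin_one_div_ge hT
  rw [← ray_re] at h1
  have h2 : √(1 / (4 * T)) ≤ √(ray T).re := by
    refine Real.sqrt_le_sqrt (le_trans ?_ h1)
    exact one_div_le_one_div_of_le (by linarith) (by linarith)
  have h3 : √(1 / (4 * T)) = 1 / (2 * T ^ (1 / 2 : ℝ)) := by
    rw [← Real.sqrt_eq_rpow, Real.sqrt_div zero_le_one, Real.sqrt_one,
      Real.sqrt_mul (by norm_num), show (4 : ℝ) = 2 ^ 2 by norm_num, Real.sqrt_sq zero_le_two]
  have h4 : 0 < 2 * T ^ (1 / 2 : ℝ) := by positivity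
  rw [h3] at h2
  calc 1 / √(ray T).re ≤ 1 / (1 / (2 * T ^ (1 / 2 : ℝ))) :=
        one_div_le_one_div_of_le (by positivity) h2
    _ = _ := one_div_one_div _

lemma profileDensity_mul_sqrt {z : ℂ} {s T : ℝ} (hT : 0 < T) :
    profileDensity z s * √T = rexp (-(T * z.re / z.im * (s / T))) /
      (2 * √(2 * π * z.im * (s / T))) := by
  unfold profileDensity
  rw [show 2 * π * z.im * (s / T) = 2 * π * z.im * s / T by ring, Real.sqrt_div' _ hT.le,
    show T * z.re / z.im * (s / T) = z.re / z.im * s by field_simp, div_mul_eq_mul_div, mul_div_assoc']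
  rw [div_div_eq_mul_div]

lemma exists_density_near {ε : ℝ} (hε : 0 < ε) : ∃ δ > 0, ∀ x y w : ℝ, |x - 1| < δ → |y - 1| < δ →
    |w - 1| < δ → |rexp (-(x / y * w)) / (2 * √(2 * π * y * w)) -
      rexp (-1) / (2 * √(2 * π))| < ε := by
  have hc : ContinuousAt (fun p : ℝ × ℝ × ℝ ↦ rexp (-(p.1 / p.2.1 * p.2.2)) /
      (2 * √(2 * π * p.2.1 * p.2.2))) (1, 1, 1) := by
    refine ContinuousAt.div ?_ (by fun_prop) ?_
    · refine Real.continuous_exp.continuousAt.comp ?_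
      refine ContinuousAt.neg (ContinuousAt.mul (ContinuousAt.div (by fun_prop) (by fun_prop) ?_)
        (by fun_prop))
      norm_num
    · simp only [mul_one]; positivity
  obtain ⟨δ, hδ, h⟩ := Metric.continuousAt_iff.mp hc ε hε
  refine ⟨δ, hδ, fun x y w hx hy hw ↦ ?_⟩
  have := @h (x, y, w) (by
    simp only [Prod.dist_eq, Real.dist_eq, max_lt_iff]
    exact ⟨hx, hy, hw⟩)
  simpa [Real.dist_eq] using this

lemma eventually_density {ρ : ℝ} (hρ : ρ < 1 / 4) {ε : ℝ} (hε : 0 < ε) :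
    ∀ᶠ T : ℝ in atTop, ∀ s, |s - T| ≤ 7 * T ^ (1 / 2 + 2 * ρ) →
      |profileDensity (ray T) s * √T - rexp (-1) / (2 * √(2 * π))| < ε := by
  obtain ⟨δ, hδ, h⟩ := exists_density_near hε
  have h1 := Metric.tendsto_nhds.mp tendsto_mul_ray_re δ hδ
  have h2 := Metric.tendsto_nhds.mp tendsto_ray_im δ hδ
  have h3 := Metric.tendsto_nhds.mp ((tendsto_rpow_neg_exponent
    (show 2 * ρ - 1 / 2 < 0 by linarith)).const_mul 7) δ hδ
  filter_upwards [h1, h2, h3, eventually_gt_atTop 0] with T h1 h2 h3 hT s hs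
  rw [profileDensity_mul_sqrt hT]
  refine h _ _ _ h1 h2 ?_
  rw [mul_zero, dist_zero_right, Real.norm_eq_abs, abs_of_nonneg (by positivity)] at h3
  refine lt_of_le_of_lt ?_ h3
  rw [show s / T - 1 = (s - T) / T by field_simp, abs_div, abs_of_pos hT, div_le_iff₀ hT,
    mul_assoc, ← Real.rpow_add_one hT.ne']
  rwa [show 2 * ρ - 1 / 2 + 1 = 1 / 2 + 2 * ρ by ring]

/-- The window `T ^ (1/2 + ρ)` over which second moments are smoothed. -/
noncomputable def width (ρ T : ℝ) : ℝ := T ^ (1 / 2 + ρ)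

/-- The limiting density of the smoothed mass of `profile`. -/
noncomputable def profileConst : ℝ := √π * (rexp (-1) / (2 * √(2 * π)))

lemma profileConst_pos : 0 < profileConst := by unfold profileConst; positivity

lemma eventually_integral_profile {ρ : ℝ} (hρ0 : 0 < ρ) (hρ : ρ < 1 / 4) {ε : ℝ} (hε : 0 < ε) :
    ∀ᶠ T : ℝ in atTop, ∀ m, |m - T| ≤ 6 * T ^ (1 / 2 + 2 * ρ) →
      |(∫ x in Ioi (0 : ℝ), profile (ray T) (width ρ T) m x) - profileConst * T ^ ρ| ≤
        ε * T ^ ρ := by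
  set c := rexp (-1) / (2 * √(2 * π)) with hc
  have hc0 : 0 < c := by positivity
  have hpi : 0 < √π := by positivity
  have hη : 0 < ε / (3 * √π) := by positivity
  have hd := eventually_density hρ hη
  have he1 := (tendsto_rpow_mul_exp_neg_rpow (1 / 2) one_pos hρ0).eventually
    (gt_mem_nhds (show 0 < ε / 6 by positivity))
  have he2 := (tendsto_rpow_mul_exp_neg_rpow 0 (show (0 : ℝ) < 1 / 2 by norm_num) hρ0).eventually
    (gt_mem_nhds (show 0 < ε / (6 * √π * (c + ε / (3 * √π))) by positivity))
  have hT0 := (tendsto_rpow_neg_exponent (show 2 * ρ - 1 / 2 < 0 by linarith)).eventually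
    (gt_mem_nhds (show (0 : ℝ) < 1 / 7 by norm_num))
  have him := tendsto_ray_im.eventually (lt_mem_nhds (show (0 : ℝ) < 1 by norm_num))
  filter_upwards [hd, he1, he2, hT0, him, eventually_ge_atTop 1] with T hd he1 he2 hT0 him hT m hm
  have hTp : 0 < T := by linarith
  have hΔ : 0 < width ρ T := by unfold width; positivity
  set R := T ^ (ρ / 2) * width ρ T with hR
  have hR0 : 0 ≤ R := by positivity
  have hRle : R ≤ T ^ (1 / 2 + 2 * ρ) := by
    rw [hR, width, ← Real.rpow_add hTp]
    exact Real.rpow_le_rpow_of_exponent_le hT (by linarith)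
  have hbig : 7 * T ^ (1 / 2 + 2 * ρ) < T := by
    rw [show 1 / 2 + 2 * ρ = (2 * ρ - 1 / 2) + 1 by ring, Real.rpow_add_one hTp.ne']
    nlinarith
  have hRm : R < m := by
    have := (abs_le.mp hm).1
    linarith
  have hq : R ^ 2 / width ρ T ^ 2 = T ^ ρ := by
    rw [hR, mul_pow, mul_div_cancel_right₀ _ (by positivity), ← Real.rpow_natCast,
      ← Real.rpow_mul hTp.le]
    congr 1; push_cast; ring
  have hq2 : R ^ 2 / (2 * width ρ T ^ 2) = 1 / 2 * T ^ ρ := by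
    rw [← hq]; field_simp
  obtain ⟨hlo, hup⟩ := integral_profile_bounds (ray_re_pos hT) him hΔ hR0 hRm
  rw [hq2] at hlo
  rw [hq] at hup
  have hd1 := hd (m + R) (by
    rw [show m + R - T = (m - T) + R by ring]
    refine (abs_add_le _ _).trans ?_
    rw [abs_of_nonneg hR0]; linarith)
  have hd2 := hd (m - R) (by
    rw [show m - R - T = (m - T) - R by ring]
    refine (abs_sub _ _).trans ?_
    rw [abs_of_nonneg hR0]; linarith)
  have hw : width ρ T = √T * T ^ ρ := by
    rw [width, Real.rpow_add hTp, Real.sqrt_eq_rpow]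
  set I := ∫ x in Ioi (0 : ℝ), profile (ray T) (width ρ T) m x
  have hTρ : 1 ≤ T ^ ρ := Real.one_le_rpow hT hρ0.le
  rw [hw] at hlo hup
  rw [Real.rpow_zero, one_mul] at he2
  rw [one_mul] at he1
  set e₂ := rexp (-(1 / 2 * T ^ ρ))
  have he₂ : 0 < e₂ := Real.exp_pos _
  set d₁ := profileDensity (ray T) (m + R) * √T with hd₁
  set d₂ := profileDensity (ray T) (m - R) * √T with hd₂
  have hlo' : d₁ * ((1 - 2 * e₂) * (√π * T ^ ρ)) ≤ I := by rw [hd₁]; linarith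
  have hup' : I ≤ d₂ * (√π * T ^ ρ) + rexp (-T ^ ρ) * (1 / √(ray T).re) := by
    rw [hd₂]; linarith
  have htail : rexp (-T ^ ρ) * (1 / √(ray T).re) ≤ ε / 3 * T ^ ρ := by
    have h1 := one_div_sqrt_ray_re_le hT
    have h2 := mul_le_mul_of_nonneg_left h1 (Real.exp_pos (-T ^ ρ)).le
    have h3 : ε / 3 * 1 ≤ ε / 3 * T ^ ρ := by gcongr
    linarith
  rw [abs_lt] at hd1 hd2
  have hcc : profileConst = √π * c := rfl
  have hη' : ε / (3 * √π) * √π = ε / 3 := by field_simp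
  have hd1' : d₁ * e₂ * √π ≤ ε / 6 := by
    have h1 : d₁ ≤ c + ε / (3 * √π) := by linarith
    have h2 : e₂ * (6 * √π * (c + ε / (3 * √π))) < ε := by rwa [lt_div_iff₀ (by positivity)] at he2
    have h3 : d₁ * (e₂ * √π) ≤ (c + ε / (3 * √π)) * (e₂ * √π) := by gcongr
    linarith
  rw [hcc, abs_le]
  have hTp' : 0 < T ^ ρ := by positivity
  constructor
  · have h1 : (c - ε / (3 * √π)) * √π ≤ d₁ * √π := by gcongr; linarith
    have h2 : (√π * c - ε) ≤ d₁ * ((1 - 2 * e₂) * √π) := by linarith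
    have h3 := mul_le_mul_of_nonneg_right h2 hTp'.le
    linarith
  · have h1 : d₂ * √π ≤ (c + ε / (3 * √π)) * √π := by gcongr; linarith
    have h2 : d₂ * √π ≤ √π * c + ε / 3 := by linarith
    have h3 := mul_le_mul_of_nonneg_right h2 hTp'.le
    have : 0 < ε * T ^ ρ := by positivity
    linarith

end ProfileAsymptotics

section SmoothedMoment

open Complex MeasureTheory Set
open scoped Real

/-- The number of terms of the theta series that are kept at height `T`. -/
noncomputable def blockLen (ρ T : ℝ) : ℕ := ⌈T ^ (1 / 2 + ρ / 4)⌉₊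

lemma rpow_le_blockLen (ρ T : ℝ) : T ^ (1 / 2 + ρ / 4) ≤ blockLen ρ T := Nat.le_ceil _

lemma blockLen_le {ρ T : ℝ} (hρ0 : 0 < ρ) (hT : 1 ≤ T) :
    (blockLen ρ T : ℝ) ≤ 2 * T ^ (1 / 2 + ρ / 4) := by
  have h1 : 1 ≤ T ^ (1 / 2 + ρ / 4) := Real.one_le_rpow hT (by linarith)
  have h2 := (Nat.ceil_lt_add_one (show 0 ≤ T ^ (1 / 2 + ρ / 4) by linarith)).le
  unfold blockLen
  linarith

lemma one_le_blockLen {ρ T : ℝ} (hT : 1 ≤ T) : 1 ≤ blockLen ρ T :=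
  Nat.one_le_ceil_iff.mpr (by positivity)

lemma harm_blockLen_le {ρ T : ℝ} (hρ0 : 0 < ρ) (hρ : ρ < 1 / 4) (hT : 1 ≤ T) :
    harm (blockLen ρ T) ≤ 2 + Real.log T := by
  have hTp : 0 < T := by linarith
  have h1 : (blockLen ρ T : ℝ) ≤ 2 * T := by
    refine (blockLen_le hρ0 hT).trans ?_
    have : T ^ (1 / 2 + ρ / 4) ≤ T ^ (1 : ℝ) :=
      Real.rpow_le_rpow_of_exponent_le hT (by linarith)
    rw [Real.rpow_one] at this
    linarith
  have h2 : (0 : ℝ) < blockLen ρ T := by exact_mod_cast one_le_blockLen hT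
  have h3 := Real.log_le_log h2 h1
  rw [Real.log_mul two_ne_zero hTp.ne'] at h3
  have h4 := Real.log_two_lt_d9
  linarith [harm_le (blockLen ρ T)]

lemma ray_re_mul_blockLen_sq_ge {ρ T : ℝ} (hT : 1 ≤ T) :
    1 / 2 * T ^ (ρ / 2) ≤ (ray T).re * (blockLen ρ T : ℝ) ^ 2 := by
  have hTp : 0 < T := by linarith
  have h1 := sin_one_div_ge hT
  rw [← ray_re] at h1
  have h2 : (T ^ (1 / 2 + ρ / 4)) ^ 2 ≤ (blockLen ρ T : ℝ) ^ 2 :=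
    pow_le_pow_left₀ (by positivity) (rpow_le_blockLen ρ T) 2
  have h3 : (T ^ (1 / 2 + ρ / 4)) ^ 2 = T ^ (ρ / 2) * T := by
    rw [← Real.rpow_natCast, ← Real.rpow_mul hTp.le, ← Real.rpow_add_one hTp.ne']
    congr 1; push_cast; ring
  calc 1 / 2 * T ^ (ρ / 2) = 1 / (2 * T) * (T ^ (ρ / 2) * T) := by field_simp
    _ ≤ (ray T).re * (blockLen ρ T : ℝ) ^ 2 := by
      rw [← h3]; exact mul_le_mul h1 h2 (by positivity) (ray_re_pos hT).le

lemma tendsto_log_mul_rpow {s : ℝ} (hs : 0 < s) :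
    Tendsto (fun T : ℝ ↦ (2 + Real.log T) * T ^ (-s)) atTop (𝓝 0) := by
  have h1 := (isLittleO_log_rpow_atTop hs).tendsto_div_nhds_zero
  have h2 := ((tendsto_rpow_neg_atTop hs).const_mul 2).add h1
  rw [mul_zero, add_zero] at h2
  refine h2.congr' ?_
  filter_upwards [eventually_gt_atTop 0] with T hT
  rw [Real.rpow_neg hT.le]
  ring

lemma eventually_sq_log_le {ρ : ℝ} (hρ0 : 0 < ρ) {η : ℝ} (hη : 0 < η) :
    ∀ᶠ T : ℝ in atTop, (2 + Real.log T) ^ 2 * T ^ (ρ / 2) ≤ η * T ^ ρ := by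
  have h := ((tendsto_log_mul_rpow (show 0 < ρ / 4 by linarith)).pow 2).eventually
    (gt_mem_nhds (show (0 : ℝ) ^ 2 < η by simpa using hη))
  filter_upwards [h, eventually_gt_atTop 0] with T h hT
  have h1 : T ^ (ρ / 2) = (T ^ (-(ρ / 4))) ^ 2 * T ^ ρ := by
    rw [← Real.rpow_natCast, ← Real.rpow_mul hT.le, ← Real.rpow_add hT]
    congr 1; push_cast; ring
  rw [h1, ← mul_assoc, ← mul_pow]
  gcongr

lemma eventually_log_terms_le {ρ : ℝ} (hρ0 : 0 < ρ) {η : ℝ} (hη : 0 < η) :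
    ∀ᶠ T : ℝ in atTop, 4 / (ρ / 2 * Real.log T) +
      4 / (ρ / 2 * Real.log T) ^ 2 * (2 + Real.log T) ≤ η := by
  have hinv : Tendsto (fun T : ℝ ↦ (Real.log T)⁻¹) atTop (𝓝 0) :=
    tendsto_inv_atTop_zero.comp Real.tendsto_log_atTop
  have h : Tendsto (fun T : ℝ ↦ 8 / ρ * (Real.log T)⁻¹ +
      16 / ρ ^ 2 * (2 * (Real.log T)⁻¹ ^ 2 + (Real.log T)⁻¹)) atTop
      (𝓝 (8 / ρ * 0 + 16 / ρ ^ 2 * (2 * 0 ^ 2 + 0))) :=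
    (hinv.const_mul _).add ((((hinv.pow 2).const_mul 2).add hinv).const_mul _)
  have h2 := h.eventually (gt_mem_nhds (show _ < η by simpa using hη))
  filter_upwards [h2, eventually_gt_atTop 1] with T h2 hT
  have hl : 0 < Real.log T := Real.log_pos hT
  refine le_trans (le_of_eq ?_) h2.le
  field_simp
  ring

lemma eventually_rpow_half_le {ρ : ℝ} (hρ0 : 0 < ρ) {η : ℝ} (hη : 0 < η) :
    ∀ᶠ T : ℝ in atTop, 3 * T ^ (ρ / 2) ≤ η * T ^ ρ := by
  have h := ((tendsto_rpow_neg_exponent (show -(ρ / 2) < 0 by linarith)).const_mul 3).eventually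
    (gt_mem_nhds (show 3 * (0 : ℝ) < η by simpa using hη))
  filter_upwards [h, eventually_gt_atTop 0] with T h hT
  have h1 : T ^ (ρ / 2) = T ^ (-(ρ / 2)) * T ^ ρ := by
    rw [← Real.rpow_add hT]; congr 1; ring
  rw [h1, ← mul_assoc]
  gcongr

lemma eventually_ray_im_ge : ∀ᶠ T : ℝ in atTop, 1 / 2 ≤ (ray T).im :=
  (tendsto_ray_im.eventually (lt_mem_nhds (show (1 / 2 : ℝ) < 1 by norm_num))).mono
    fun _ h ↦ h.le

lemma ray_im_le_one (T : ℝ) : (ray T).im ≤ 1 := by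
  rw [ray_im]; exact Real.cos_le_one _

lemma exp_terms_le {T : ℝ} (hT : 1 ≤ T) {H : ℝ} (hH : 1 ≤ H) (hHT : H ≤ T) {h : ℝ} (h0 : 0 ≤ h)
    (hh : h ≤ 2 + Real.log T) :
    (waveConst * (ray T).re ^ (-(5 / 8) : ℝ) * H) ^ 2 + 8 * H ^ 2 * (1 / √(ray T).re) * h ≤
      (4 * waveConst ^ 2 + 32) * T ^ (3 : ℝ) * H := by
  have hTp : 0 < T := by linarith
  have hw := waveConst_nonneg
  have h1 : waveConst * (ray T).re ^ (-(5 / 8) : ℝ) * H ≤ waveConst * (2 * T) * H := by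
    have h2 : (T : ℝ) ^ (5 / 8 : ℝ) ≤ T ^ (1 : ℝ) :=
      Real.rpow_le_rpow_of_exponent_le hT (by norm_num)
    rw [Real.rpow_one] at h2
    have h3 := ray_re_rpow_le hT
    gcongr
    linarith
  have h2 : (1 / √(ray T).re) ≤ 2 * T := by
    have h2 : (T : ℝ) ^ (1 / 2 : ℝ) ≤ T ^ (1 : ℝ) :=
      Real.rpow_le_rpow_of_exponent_le hT (by norm_num)
    rw [Real.rpow_one] at h2
    linarith [one_div_sqrt_ray_re_le hT]
  have h3 : h ≤ 2 * T := by linarith [Real.log_le_sub_one_of_pos hTp]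
  have h4 : 0 ≤ (ray T).re ^ (-(5 / 8) : ℝ) := Real.rpow_nonneg (ray_re_pos hT).le _
  calc _ ≤ (waveConst * (2 * T) * H) ^ 2 + 8 * H ^ 2 * (2 * T) * (2 * T) := by gcongr
    _ = (4 * waveConst ^ 2 + 32) * (T ^ 2 * H) * H := by ring
    _ ≤ (4 * waveConst ^ 2 + 32) * (T ^ 2 * T) * H := by gcongr
    _ = _ := by rw [show T ^ (3 : ℝ) = T ^ 3 by norm_cast]; ring

lemma eventually_gauss_norm_block_sq {ρ : ℝ} (hρ0 : 0 < ρ) (hρ : ρ < 1 / 4) {ε : ℝ} (hε : 0 < ε) :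
    ∀ᶠ T : ℝ in atTop, ∀ H m, 1 ≤ H → H ≤ T ^ (ρ / 4) → |m - T| ≤ 6 * T ^ (1 / 2 + 2 * ρ) →
      |(∫ t, gauss (width ρ T) m t * ‖block (ray T) H (blockLen ρ T) t‖ ^ 2) -
        32 * π ^ 2 * profileConst * (T ^ ρ * H)| ≤ ε * (T ^ ρ * H) := by
  have hpc := profileConst_pos
  have hpi := Real.pi_pos
  set C := 403 * π + 32 * π * (profileConst + 1) + 96 * π ^ 2 with hC
  have hC0 : 0 < C := by positivity
  set η := min 1 (ε / C) with hηd
  have hη : 0 < η := by positivity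
  have hη1 : η ≤ 1 := min_le_left _ _
  have hηC : C * η ≤ ε := by
    have : η ≤ ε / C := min_le_right _ _
    rw [le_div_iff₀ hC0] at this
    linarith
  have e2 := ((tendsto_rpow_mul_exp_neg_rpow 3 (show (0 : ℝ) < 1 / 8 by norm_num) hρ0).const_mul
    (4 * waveConst ^ 2 + 32)).eventually (gt_mem_nhds (show _ * (0 : ℝ) < η by simpa using hη))
  have e5 := (tendsto_rpow_mul_exp_neg_rpow (1 / 2) (show 0 < π / 2 by positivity)
    (show 0 < ρ / 2 by linarith)).eventually (gt_mem_nhds hη)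
  have eV := ((tendsto_rpow_neg_exponent (show -(ρ / 4) < 0 by linarith)).const_mul 16).eventually
    (gt_mem_nhds (show 16 * (0 : ℝ) < 1 by norm_num))
  filter_upwards [eventually_sq_log_le hρ0 hη, e2, eventually_log_terms_le hρ0 hη,
    eventually_rpow_half_le hρ0 hη, e5, eventually_integral_profile hρ0 hρ hη, eV,
    eventually_ray_im_ge, eventually_gt_atTop 1] with T f1 f2 f3 f4 f5 f6 fV him hT1 H m hH hHT hm
  have hT := hT1.le
  have hTp : 0 < T := by linarith
  have hz := ray_re_pos hT
  have hΔ : 0 < width ρ T := by unfold width; positivity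
  have hl := Real.log_pos hT1
  set M := blockLen ρ T with hM
  set V := T ^ (-(1 / 2) - ρ / 2) with hV
  have hV0 : 0 ≤ V := by positivity
  have hMV : 8 * M * V ≤ 1 := by
    have h1 : (M : ℝ) * V ≤ 2 * T ^ (1 / 2 + ρ / 4) * V := by
      gcongr; exact blockLen_le hρ0 hT
    have h2 : T ^ (1 / 2 + ρ / 4) * V = T ^ (-(ρ / 4)) := by
      rw [hV, ← Real.rpow_add hTp]; congr 1; ring
    have h3 : 2 * T ^ (1 / 2 + ρ / 4) * V = 2 * T ^ (-(ρ / 4)) := by rw [← h2]; ring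
    linarith
  have hV2 : V ^ 2 ≤ 2 * (ray T).re := by
    have h1 := sin_one_div_ge hT
    rw [← ray_re] at h1
    have h2 : V ^ 2 ≤ T ^ (-1 : ℝ) := by
      rw [hV, ← Real.rpow_natCast, ← Real.rpow_mul hTp.le]
      exact Real.rpow_le_rpow_of_exponent_le hT (by push_cast; linarith)
    rw [Real.rpow_neg_one] at h2
    have h3 : 2 * (1 / (2 * T)) = T⁻¹ := by field_simp
    linarith
  have hΔV : width ρ T ^ 2 * V ^ 2 / 8 = 1 / 8 * T ^ ρ := by
    rw [← mul_pow, width, hV, ← Real.rpow_add hTp, ← Real.rpow_natCast, ← Real.rpow_mul hTp.le]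
    rw [mul_comm (1 / 8 : ℝ), div_eq_mul_one_div]
    congr 2; push_cast; ring
  set Y := ρ / 2 * Real.log T with hY
  have hY0 : 0 < Y := by positivity
  have hexpY : rexp Y = T ^ (ρ / 2) := by
    rw [hY, Real.rpow_def_of_pos hTp, mul_comm]
  have hA := abs_integral_gauss_norm_block_sq_sub_le hz him (ray_im_le_one T) hH
    (one_le_blockLen (ρ := ρ) hT) hV0 hMV hV2 hΔ m
  have hB := abs_sum_kern_profile_sub_le hz (by linarith : 0 ≤ (ray T).im) hΔ m
    (by linarith : 0 ≤ H) M hY0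
  have hD := f6 m hm
  have hharm := harm_blockLen_le hρ0 hρ hT
  have hharm0 := harm_nonneg M
  rw [← hM] at hharm hA
  rw [hΔV] at hA
  rw [hexpY] at hB
  set I := ∫ x in Ioi (0 : ℝ), profile (ray T) (width ρ T) m x
  have hI0 : 0 ≤ I := setIntegral_nonneg measurableSet_Ioi fun x _ ↦ (profile_pos _ _ _ _).le
  set P := T ^ ρ with hP
  have hP1 : 1 ≤ P := Real.one_le_rpow hT hρ0.le
  have hIle : I ≤ (profileConst + 1) * P := by
    have h1 := (abs_le.mp hD).2
    have h2 : η * P ≤ 1 * P := by gcongr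
    linarith
  have hHT' : H ≤ T := hHT.trans (by
    have := Real.rpow_le_rpow_of_exponent_le hT (show ρ / 4 ≤ 1 by linarith)
    rwa [Real.rpow_one] at this)
  have hHP : H ≤ P * H := le_mul_of_one_le_left (by linarith) hP1
  have t1 : H ^ 3 * harm M ^ 2 ≤ η * (P * H) := by
    have h1 : H ^ 2 ≤ T ^ (ρ / 2) := by
      refine (pow_le_pow_left₀ (by linarith) hHT 2).trans (le_of_eq ?_)
      rw [← Real.rpow_natCast, ← Real.rpow_mul hTp.le]
      congr 1; push_cast; ring
    have h2 : harm M ^ 2 ≤ (2 + Real.log T) ^ 2 := pow_le_pow_left₀ hharm0 hharm 2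
    have h3 : harm M ^ 2 * H ^ 2 ≤ η * P :=
      (mul_le_mul h2 h1 (by positivity) (by positivity)).trans f1
    have h4 := mul_le_mul_of_nonneg_right h3 (show 0 ≤ H by linarith)
    linarith
  have t2 : ((waveConst * (ray T).re ^ (-(5 / 8) : ℝ) * H) ^ 2 +
      8 * H ^ 2 * (1 / √(ray T).re) * harm M) * rexp (-(1 / 8 * P)) ≤ η * (P * H) := by
    have h1 := mul_le_mul_of_nonneg_right (exp_terms_le hT hH hHT' hharm0 hharm)
      (Real.exp_pos (-(1 / 8 * P))).le
    have h2 := mul_le_mul_of_nonneg_right f2.le (show 0 ≤ H by linarith)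
    have h3 : η * H ≤ η * (P * H) := by gcongr
    linarith
  have t3 : (4 / Y + 4 / Y ^ 2 * harm M) * I ≤ η * (profileConst + 1) * (P * H) := by
    have h1 : 4 / Y + 4 / Y ^ 2 * harm M ≤ η := le_trans (by gcongr) f3
    calc _ ≤ η * ((profileConst + 1) * P) := mul_le_mul h1 hIle hI0 hη.le
      _ = η * (profileConst + 1) * (P * 1) := by ring
      _ ≤ _ := by gcongr
  have t5 : rexp (-(π * (ray T).re * (M : ℝ) ^ 2)) * (1 / (2 * √(ray T).re)) ≤ η * P := by
    have h1 : rexp (-(π * (ray T).re * (M : ℝ) ^ 2)) ≤ rexp (-(π / 2 * T ^ (ρ / 2))) := by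
      rw [Real.exp_le_exp, neg_le_neg_iff]
      have := mul_le_mul_of_nonneg_left (ray_re_mul_blockLen_sq_ge (ρ := ρ) hT) hpi.le
      linarith
    have h2 : 1 / (2 * √(ray T).re) ≤ T ^ (1 / 2 : ℝ) := by
      have h3 : 1 / (2 * √(ray T).re) = 1 / √(ray T).re / 2 := by
        rw [div_div, mul_comm]
      linarith [one_div_sqrt_ray_re_le hT]
    have h3 := mul_le_mul h1 h2 (by positivity) (Real.exp_pos _).le
    have h4 : η * 1 ≤ η * P := by gcongr
    linarith
  have t45 : (3 * T ^ (ρ / 2) + rexp (-(π * (ray T).re * (M : ℝ) ^ 2)) *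
      (1 / (2 * √(ray T).re))) * (π * H) ≤ 2 * π * η * (P * H) := by
    have h1 := mul_le_mul_of_nonneg_right (add_le_add f4 t5) (show 0 ≤ π * H by positivity)
    linarith
  have t6 : |π * H * I - π * profileConst * (P * H)| ≤ π * η * (P * H) := by
    rw [show π * H * I - π * profileConst * (P * H) = π * H * (I - profileConst * P) by ring,
      abs_mul, abs_of_nonneg (by positivity : 0 ≤ π * H)]
    have := mul_le_mul_of_nonneg_left hD (by positivity : 0 ≤ π * H)
    linarith
  set S := ∑ n ∈ Finset.range M, ∫ y in Ioi (0 : ℝ), ‖kern H y‖ ^ 2 *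
    (rexp y * profile (ray T) (width ρ T) m (((n : ℝ) + 1) * rexp y))
  have hBS : |S - π * profileConst * (P * H)| ≤
      η * (profileConst + 1) * (P * H) + 3 * π * η * (P * H) := by
    have h1 := abs_sub_le S (π * H * I) (π * profileConst * (P * H))
    linarith
  have hfin := abs_sub_le (∫ t, gauss (width ρ T) m t * ‖block (ray T) H M t‖ ^ 2) (32 * π * S)
    (32 * π ^ 2 * profileConst * (P * H))
  rw [show 32 * π * S - 32 * π ^ 2 * profileConst * (P * H) =
    32 * π * (S - π * profileConst * (P * H)) by ring, abs_mul,
    abs_of_nonneg (by positivity : 0 ≤ 32 * π)] at hfin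
  have g1 := mul_le_mul_of_nonneg_left hBS (by positivity : 0 ≤ 32 * π)
  have g2 := mul_le_mul_of_nonneg_left t1 (by positivity : 0 ≤ 400 * π)
  have g3 := mul_le_mul_of_nonneg_left t2 (by positivity : 0 ≤ 3 * π)
  have g4 := mul_le_mul_of_nonneg_right hηC (show 0 ≤ P * H by positivity)
  refine le_trans ?_ g4
  have g5 : C * η * (P * H) = 400 * π * (η * (P * H)) + 3 * π * (η * (P * H)) +
      32 * π * (η * (profileConst + 1) * (P * H) + 3 * π * η * (P * H)) := by rw [hC]; ring
  linarith

lemma eventually_gauss_block_sq {ρ : ℝ} (hρ0 : 0 < ρ) (hρ : ρ < 1 / 4) {ε : ℝ} (hε : 0 < ε) :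
    ∀ᶠ T : ℝ in atTop, ∀ H m, 1 ≤ H → H ≤ T ^ (ρ / 4) →
      ‖∫ t, (gauss (width ρ T) m t : ℂ) * block (ray T) H (blockLen ρ T) t ^ 2‖ ≤
        ε * (T ^ ρ * H) := by
  have hpi := Real.pi_pos
  have he := Real.exp_pos 1
  set C := π * rexp 1 * 88 with hC
  have hC0 : 0 < C := by positivity
  have hη : 0 < ε / C := by positivity
  filter_upwards [eventually_sq_log_le hρ0 hη, eventually_ray_im_ge, eventually_ge_atTop 4]
    with T f1 him hT4 H m hH hHT
  have hT : 1 ≤ T := by linarith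
  have hTp : 0 < T := by linarith
  have hl : 0 ≤ Real.log T := Real.log_nonneg hT
  have hΔ : 2 ≤ width ρ T := by
    have h1 : (2 : ℝ) = 4 ^ (1 / 2 : ℝ) := by
      rw [← Real.sqrt_eq_rpow, show (4 : ℝ) = 2 ^ 2 by norm_num, Real.sqrt_sq zero_le_two]
    rw [h1, width]
    exact (Real.rpow_le_rpow (by norm_num) hT4 (by norm_num)).trans
      (Real.rpow_le_rpow_of_exponent_le hT (by linarith))
  refine (norm_integral_gauss_block_sq_le (ray_re_pos hT) him (by linarith) _ hΔ m).trans ?_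
  have hharm := harm_blockLen_le hρ0 hρ hT
  have hharm0 := harm_nonneg (blockLen ρ T)
  have h1 : (blockLen ρ T : ℝ) / width ρ T ≤ 2 := by
    rw [div_le_iff₀ (by linarith)]
    refine (blockLen_le hρ0 hT).trans ?_
    rw [width]
    gcongr
    linarith
  have h2 : 32 * ((blockLen ρ T : ℝ) / width ρ T) + 24 * harm (blockLen ρ T) ^ 2 ≤
      88 * (2 + Real.log T) ^ 2 := by
    have h3 : harm (blockLen ρ T) ^ 2 ≤ (2 + Real.log T) ^ 2 := pow_le_pow_left₀ hharm0 hharm 2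
    nlinarith
  have h3 : H ≤ T ^ (ρ / 2) := hHT.trans (Real.rpow_le_rpow_of_exponent_le hT (by linarith))
  calc _ ≤ π * rexp 1 * H ^ 2 * (88 * (2 + Real.log T) ^ 2) := by gcongr
    _ = C * ((2 + Real.log T) ^ 2 * H) * H := by rw [hC]; ring
    _ ≤ C * (ε / C * T ^ ρ) * H := by
        refine mul_le_mul_of_nonneg_right (mul_le_mul_of_nonneg_left
          (le_trans ?_ f1) hC0.le) (by linarith)
        gcongr
    _ = _ := by field_simp

end SmoothedMoment

section Window

open Complex MeasureTheory Set
open scoped Real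

lemma continuous_block {z : ℂ} (hz : 0 < z.re) {H : ℝ} (hH : 0 ≤ H) (M : ℕ) :
    Continuous (block z H M) := by
  have hinteg := integrableOn_amp hz hH M
  have hmul : ∀ t : ℝ, ∀ y : ℝ, ‖amp z H M y * exp (I * ((t : ℂ) * y))‖ = ‖amp z H M y‖ :=
    fun t y ↦ by rw [norm_mul, norm_exp_I_mul, mul_one]
  refine continuous_of_dominated (bound := fun y ↦ ‖amp z H M y‖) (fun t ↦ ?_) (fun t ↦ ?_)
    hinteg.norm (Eventually.of_forall fun y ↦ by fun_prop)
  · exact hinteg.aestronglyMeasurable.mul (Continuous.aestronglyMeasurable (by fun_prop))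
  · exact Eventually.of_forall fun y ↦ (hmul t y).le

/-- The square of the main term of the short average of the Hardy–Littlewood function. -/
noncomputable def mainSq (ρ T H t : ℝ) : ℝ :=
  (rayRoot T * block (ray T) H (blockLen ρ T) t).re ^ 2

lemma mainSq_nonneg (ρ T H t : ℝ) : 0 ≤ mainSq ρ T H t := sq_nonneg _

lemma continuous_mainSq (ρ : ℝ) {T : ℝ} (hT : 1 ≤ T) {H : ℝ} (hH : 0 ≤ H) :
    Continuous (mainSq ρ T H) := by
  have := continuous_block (ray_re_pos hT) hH (blockLen ρ T)
  unfold mainSq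
  fun_prop

lemma mainSq_le (ρ : ℝ) {T : ℝ} (hT : 1 ≤ T) {H : ℝ} (hH : 0 ≤ H) (t : ℝ) :
    mainSq ρ T H t ≤ (2 * waveConst * T ^ (5 / 8 : ℝ) * H) ^ 2 := by
  unfold mainSq
  rw [← sq_abs]
  refine pow_le_pow_left₀ (abs_nonneg _) ((abs_re_le_norm _).trans ?_) 2
  rw [norm_mul, norm_rayRoot, one_mul]
  exact norm_block_le hT hH _ t

lemma re_sq_eq (w : ℂ) : w.re ^ 2 = 1 / 2 * ‖w‖ ^ 2 + 1 / 2 * (w ^ 2).re := by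
  rw [← normSq_eq_norm_sq, normSq_apply, sq w, mul_re]; ring

lemma integrable_gauss_mul {Δ : ℝ} (hΔ : 0 < Δ) (m : ℝ) {E : Type*} [NormedRing E]
    [NormedAlgebra ℝ E] {f : ℝ → E} (hf : Continuous f) {K : ℝ} (hK : ∀ t, ‖f t‖ ≤ K) :
    Integrable fun t ↦ gauss Δ m t • f t :=
  (integrable_gauss hΔ m).smul_bdd K hf.aestronglyMeasurable (Eventually.of_forall hK)

lemma eventually_gauss_mainSq {ρ : ℝ} (hρ0 : 0 < ρ) (hρ : ρ < 1 / 4) {ε : ℝ} (hε : 0 < ε) :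
    ∀ᶠ T : ℝ in atTop, ∀ H m, 1 ≤ H → H ≤ T ^ (ρ / 4) → |m - T| ≤ 6 * T ^ (1 / 2 + 2 * ρ) →
      |(∫ t, gauss (width ρ T) m t * mainSq ρ T H t) -
        16 * π ^ 2 * profileConst * (T ^ ρ * H)| ≤ ε * (T ^ ρ * H) := by
  filter_upwards [eventually_gauss_norm_block_sq hρ0 hρ hε, eventually_gauss_block_sq hρ0 hρ hε,
    eventually_ge_atTop 1] with T h1 h2 hT H m hH hHT hm
  replace h1 := h1 H m hH hHT hm
  replace h2 := h2 H m hH hHT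
  have hTp : 0 < T := by linarith
  have hΔ : 0 < width ρ T := by unfold width; positivity
  have hH0 : 0 ≤ H := by linarith
  set B := block (ray T) H (blockLen ρ T) with hB
  have hcB : Continuous B := continuous_block (ray_re_pos hT) hH0 _
  set K := 2 * waveConst * T ^ (5 / 8 : ℝ) * H
  have hK : ∀ t, ‖B t‖ ≤ K := fun t ↦ norm_block_le hT hH0 _ t
  have hi1 : Integrable fun t ↦ gauss (width ρ T) m t * ‖B t‖ ^ 2 := by
    refine integrable_gauss_mul hΔ m (f := fun t ↦ ‖B t‖ ^ 2) (by fun_prop) (K := K ^ 2) fun t ↦ ?_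
    rw [norm_pow, norm_norm]
    exact pow_le_pow_left₀ (norm_nonneg _) (hK t) 2
  have hi2 : Integrable fun t ↦ (gauss (width ρ T) m t : ℂ) * B t ^ 2 := by
    have := integrable_gauss_mul hΔ m (f := fun t ↦ B t ^ 2) (by fun_prop) (K := K ^ 2) fun t ↦ by
      rw [norm_pow]
      exact pow_le_pow_left₀ (norm_nonneg _) (hK t) 2
    simpa only [real_smul] using this
  have hpt : ∀ t, gauss (width ρ T) m t * mainSq ρ T H t =
      1 / 2 * (gauss (width ρ T) m t * ‖B t‖ ^ 2) +
        1 / 2 * (rayRoot T ^ 2 * ((gauss (width ρ T) m t : ℂ) * B t ^ 2)).re := fun t ↦ by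
    have h3 : rayRoot T ^ 2 * ((gauss (width ρ T) m t : ℂ) * B t ^ 2) =
        (gauss (width ρ T) m t : ℂ) * (rayRoot T * B t) ^ 2 := by ring
    rw [h3, re_ofReal_mul, mainSq, re_sq_eq, norm_mul, norm_rayRoot, one_mul]
    ring
  have hre : ∫ t, (rayRoot T ^ 2 * ((gauss (width ρ T) m t : ℂ) * B t ^ 2)).re =
      (rayRoot T ^ 2 * ∫ t, (gauss (width ρ T) m t : ℂ) * B t ^ 2).re := by
    rw [← integral_const_mul]
    exact integral_re (𝕜 := ℂ) (hi2.const_mul _)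
  have hre_le : |(rayRoot T ^ 2 * ∫ t, (gauss (width ρ T) m t : ℂ) * B t ^ 2).re| ≤
      ε * (T ^ ρ * H) := by
    refine (abs_re_le_norm _).trans ?_
    rwa [norm_mul, norm_pow, norm_rayRoot, one_pow, one_mul]
  simp_rw [hpt]
  have hi3 : Integrable fun t ↦
      (rayRoot T ^ 2 * ((gauss (width ρ T) m t : ℂ) * B t ^ 2)).re := (hi2.const_mul _).re
  rw [integral_add (hi1.const_mul _) (hi3.const_mul _), integral_const_mul,
    integral_const_mul, hre]
  rw [abs_le] at h1 hre_le ⊢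
  constructor <;> linarith

lemma gauss_comm (Δ m t : ℝ) : gauss Δ m t = gauss Δ t m := by
  unfold gauss; congr 3; ring

lemma continuous_gauss_uncurry (Δ : ℝ) : Continuous fun p : ℝ × ℝ ↦ gauss Δ p.1 p.2 := by
  unfold gauss; fun_prop

lemma intervalIntegral_swap_of_continuous {F : ℝ → ℝ → ℝ}
    (hF : Continuous fun p : ℝ × ℝ ↦ F p.1 p.2) (a b c d : ℝ) :
    ∫ x in a..b, ∫ y in c..d, F x y = ∫ y in c..d, ∫ x in a..b, F x y := by
  refine intervalIntegral_intervalIntegral_swap ?_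
  exact (hF.continuousOn.integrableOn_compact
    (isCompact_uIcc.prod isCompact_uIcc)).mono_set (prod_mono uIoc_subset_uIcc uIoc_subset_uIcc)

lemma integral_window_le {f : ℝ → ℝ} (hf : Continuous f) (hf0 : ∀ t, 0 ≤ f t) {K : ℝ}
    (hK : ∀ t, f t ≤ K) {Δ : ℝ} (hΔ : 0 < Δ) {T U R J : ℝ} (hU : 0 ≤ U) (hR : 0 ≤ R)
    (hJ : ∀ m ∈ Icc (T - R) (T + U + R), ∫ t, gauss Δ m t * f t ≤ J) :
    (1 - 2 * rexp (-(R ^ 2 / (2 * Δ ^ 2)))) * (√π * Δ) * ∫ t in T..(T + U), f t ≤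
      (U + 2 * R) * J := by
  have hcg := continuous_gauss_uncurry Δ
  have hnf : ∀ t, ‖f t‖ ≤ K := fun t ↦ by rw [Real.norm_of_nonneg (hf0 t)]; exact hK t
  have hinteg : ∀ m, Integrable fun t ↦ gauss Δ m t * f t := fun m ↦ integrable_gauss_mul hΔ m hf hnf
  have hTU : T ≤ T + U := by linarith
  have hm : T - R ≤ T + U + R := by linarith
  have hcont : Continuous fun p : ℝ × ℝ ↦ gauss Δ p.1 p.2 * f p.2 := by fun_prop
  have hcm : Continuous fun m ↦ ∫ t in T..(T + U), gauss Δ m t * f t :=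
    intervalIntegral.continuous_parametric_intervalIntegral_of_continuous' hcont _ _
  have hct : Continuous fun t ↦ ∫ m in (T - R)..(T + U + R), gauss Δ m t * f t :=
    intervalIntegral.continuous_parametric_intervalIntegral_of_continuous'
      (f := fun t m ↦ gauss Δ m t * f t) (hcont.comp continuous_swap) _ _
  have hup : ∫ m in (T - R)..(T + U + R), ∫ t in T..(T + U), gauss Δ m t * f t ≤
      (U + 2 * R) * J := by
    have h1 : ∫ m in (T - R)..(T + U + R), ∫ t in T..(T + U), gauss Δ m t * f t ≤
        ∫ _ in (T - R)..(T + U + R), J := by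
      refine intervalIntegral.integral_mono_on hm (hcm.intervalIntegrable _ _)
        intervalIntegrable_const fun m hmI ↦ (le_trans ?_ (hJ m hmI))
      rw [intervalIntegral.integral_of_le hTU]
      exact setIntegral_le_integral (hinteg m)
        (Eventually.of_forall fun t ↦ mul_nonneg (gauss_pos _ _ _).le (hf0 t))
    rw [intervalIntegral.integral_const, smul_eq_mul] at h1
    refine h1.trans (le_of_eq (by ring))
  rw [intervalIntegral_swap_of_continuous (F := fun m t ↦ gauss Δ m t * f t) hcont] at hup
  refine le_trans ?_ hup
  rw [← intervalIntegral.integral_const_mul]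
  refine intervalIntegral.integral_mono_on hTU ((hf.intervalIntegrable _ _).const_mul _)
    (hct.intervalIntegrable _ _) fun t ht ↦ ?_
  rw [intervalIntegral.integral_mul_const]
  refine mul_le_mul_of_nonneg_right ((integral_gauss_interval_ge hΔ t hR).trans ?_) (hf0 t)
  simp_rw [gauss_comm Δ _ t]
  exact intervalIntegral.integral_mono_interval (by linarith [ht.1]) (by linarith)
    (by linarith [ht.2]) (Eventually.of_forall fun m ↦ (gauss_pos _ _ _).le)
    ((continuous_gauss Δ t).intervalIntegrable _ _)

lemma le_integral_window {f : ℝ → ℝ} (hf : Continuous f) (hf0 : ∀ t, 0 ≤ f t) {K : ℝ}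
    (hK : ∀ t, f t ≤ K) {Δ : ℝ} (hΔ : 0 < Δ) {T U R J : ℝ} (hR : 0 ≤ R) (hRU : 2 * R ≤ U)
    (hJ : ∀ m ∈ Icc (T + R) (T + U - R), J ≤ ∫ t, gauss Δ m t * f t) :
    (U - 2 * R) * (J - K * (2 * rexp (-(R ^ 2 / (2 * Δ ^ 2))) * (√π * Δ))) ≤
      √π * Δ * ∫ t in T..(T + U), f t := by
  have hcg := continuous_gauss_uncurry Δ
  have hK0 : 0 ≤ K := (hf0 0).trans (hK 0)
  have hnf : ∀ t, ‖f t‖ ≤ K := fun t ↦ by rw [Real.norm_of_nonneg (hf0 t)]; exact hK t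
  have hinteg : ∀ m, Integrable fun t ↦ gauss Δ m t * f t := fun m ↦ integrable_gauss_mul hΔ m hf hnf
  have hTU : T ≤ T + U := by linarith
  have hm : T + R ≤ T + U - R := by linarith
  have hcont : Continuous fun p : ℝ × ℝ ↦ gauss Δ p.1 p.2 * f p.2 := by fun_prop
  have hcm : Continuous fun m ↦ ∫ t in T..(T + U), gauss Δ m t * f t :=
    intervalIntegral.continuous_parametric_intervalIntegral_of_continuous' hcont _ _
  have hct : Continuous fun t ↦ ∫ m in (T + R)..(T + U - R), gauss Δ m t * f t :=
    intervalIntegral.continuous_parametric_intervalIntegral_of_continuous'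
      (f := fun t m ↦ gauss Δ m t * f t) (hcont.comp continuous_swap) _ _
  set τ := K * (2 * rexp (-(R ^ 2 / (2 * Δ ^ 2))) * (√π * Δ)) with hτ
  have hlow : (U - 2 * R) * (J - τ) ≤
      ∫ m in (T + R)..(T + U - R), ∫ t in T..(T + U), gauss Δ m t * f t := by
    have h1 : ∫ _ in (T + R)..(T + U - R), (J - τ) ≤
        ∫ m in (T + R)..(T + U - R), ∫ t in T..(T + U), gauss Δ m t * f t := by
      refine intervalIntegral.integral_mono_on hm intervalIntegrable_const
        (hcm.intervalIntegrable _ _) fun m hmI ↦ ?_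
      have h2 := integral_add_compl (μ := volume) (s := Ioc T (T + U)) measurableSet_Ioc (hinteg m)
      have h3 : ∫ t in (Ioc T (T + U))ᶜ, gauss Δ m t * f t ≤ τ := by
        calc ∫ t in (Ioc T (T + U))ᶜ, gauss Δ m t * f t
            ≤ ∫ t in (Ioc T (T + U))ᶜ, gauss Δ m t * K :=
              setIntegral_mono_on (hinteg m).integrableOn
                ((integrable_gauss hΔ m).mul_const _).integrableOn measurableSet_Ioc.compl
                fun t _ ↦ mul_le_mul_of_nonneg_left (hK t) (gauss_pos _ _ _).le
          _ = K * ∫ t in (Ioc T (T + U))ᶜ, gauss Δ m t := by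
              rw [integral_mul_const, mul_comm]
          _ ≤ τ := by
              rw [hτ]
              refine mul_le_mul_of_nonneg_left (integral_gauss_compl_le hΔ m hR
                measurableSet_Ioc.compl fun t ht ↦ ?_) hK0
              rw [mem_compl_iff, mem_Ioc, not_and_or, not_lt, not_le] at ht
              rcases ht with ht | ht
              · rw [abs_sub_comm]; exact le_trans (by linarith [hmI.1]) (le_abs_self _)
              · exact le_trans (by linarith [hmI.2]) (le_abs_self _)
      rw [intervalIntegral.integral_of_le hTU]
      linarith [hJ m hmI]
    rw [intervalIntegral.integral_const, smul_eq_mul] at h1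
    refine le_trans (le_of_eq (by ring)) h1
  rw [intervalIntegral_swap_of_continuous (F := fun m t ↦ gauss Δ m t * f t) hcont] at hlow
  refine hlow.trans ?_
  rw [← intervalIntegral.integral_const_mul]
  refine intervalIntegral.integral_mono_on hTU (hct.intervalIntegrable _ _)
    ((hf.intervalIntegrable _ _).const_mul _) fun t ht ↦ ?_
  rw [intervalIntegral.integral_mul_const]
  refine mul_le_mul_of_nonneg_right ?_ (hf0 t)
  simp_rw [gauss_comm Δ _ t]
  exact integral_gauss_interval_le hΔ t hm

end Window

section ShortWindow

open Complex MeasureTheory Set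
open scoped Real

lemma window_upper {c η E R U x G : ℝ} (hc : 0 < c) (hη : 0 < η) (hη4 : η ≤ 1 / 4) (hE : E ≤ η)
    (hR : R ≤ η * U) (hU : 0 < U) (hx : 0 < x) (hG0 : 0 ≤ G)
    (hG : (1 - 2 * E) * G ≤ (U + 2 * R) * ((c + η) * x)) :
    G ≤ (c + (8 * c + 3) * η) * (U * x) := by
  have h1 : (1 - 2 * η) * G ≤ (1 - 2 * E) * G := by gcongr
  have h2 : (U + 2 * R) * ((c + η) * x) ≤ ((1 + 2 * η) * U) * ((c + η) * x) := by
    gcongr; linarith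
  have h3 : (1 - 2 * η) * G ≤ (1 + 2 * η) * (c + η) * (U * x) := by linarith
  have h4 : (1 + 2 * η) * (c + η) ≤ (1 - 2 * η) * (c + (8 * c + 3) * η) := by
    have : 0 ≤ η * (c * (4 - 16 * η) + (2 - 8 * η)) := by
      refine mul_nonneg hη.le (add_nonneg (mul_nonneg hc.le ?_) ?_) <;> linarith
    linarith
  have h5 := mul_le_mul_of_nonneg_right h4 (show 0 ≤ U * x by positivity)
  have h6 : 0 < 1 - 2 * η := by linarith
  refine le_of_mul_le_mul_left (h3.trans (h5.trans (le_of_eq (by ring)))) h6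

lemma window_lower {c η R U x k G : ℝ} (hc : 0 < c) (hη : 0 < η) (hη4 : η ≤ 1 / 4)
    (hηc : η ≤ c / 2) (hR : R ≤ η * U) (hU : 0 < U) (hx : 0 < x) (hk : k ≤ η * x)
    (hG : (U - 2 * R) * ((c - η) * x - k) ≤ G) :
    (c - (8 * c + 3) * η) * (U * x) ≤ G := by
  have h1 : (c - 2 * η) * x ≤ (c - η) * x - k := by linarith
  have h2 : (1 - 2 * η) * U ≤ U - 2 * R := by linarith
  have h3 : 0 ≤ (c - 2 * η) * x := mul_nonneg (by linarith) hx.le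
  have h4 : 0 ≤ (1 - 2 * η) * U := mul_nonneg (by linarith) hU.le
  have h5 := (mul_le_mul h2 h1 h3 (h4.trans h2)).trans hG
  refine le_trans ?_ h5
  rw [show (1 - 2 * η) * U * ((c - 2 * η) * x) = ((1 - 2 * η) * (c - 2 * η)) * (U * x) by ring]
  refine mul_le_mul_of_nonneg_right ?_ (by positivity)
  have : 0 ≤ η * (6 * c + 1 + 4 * η) := by positivity
  linarith

/-- The density of the main term of the second moment, before the weight is restored. -/
noncomputable def mainConst : ℝ := 8 * π ^ 2 * rexp (-1) / √(2 * π)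

lemma eventually_integral_mainSq {ρ : ℝ} (hρ0 : 0 < ρ) (hρ : ρ < 1 / 4) {ε : ℝ} (hε : 0 < ε) :
    ∀ᶠ T : ℝ in atTop, ∀ H U, 1 ≤ H → H ≤ T ^ (ρ / 4) → T ^ (1 / 2 + 2 * ρ) ≤ U →
      U ≤ 4 * T ^ (1 / 2 + 2 * ρ) →
      |√T * (∫ t in T..(T + U), mainSq ρ T H t) - mainConst * (U * H)| ≤ ε * (U * H) := by
  have hpi := Real.pi_pos
  have hsp : 0 < √π := Real.sqrt_pos.mpr hpi
  have hpc := profileConst_pos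
  set c := 16 * π ^ 2 * profileConst with hc
  have hc0 : 0 < c := by positivity
  set C := (8 * c + 3) / √π with hC
  have hC0 : 0 < C := by positivity
  set η := min (min (1 / 4) (c / 2)) (ε / C) with hηd
  have hη : 0 < η := by positivity
  have hη4 : η ≤ 1 / 4 := (min_le_left _ _).trans (min_le_left _ _)
  have hηc : η ≤ c / 2 := (min_le_left _ _).trans (min_le_right _ _)
  have hηC : C * η ≤ ε := by
    have : η ≤ ε / C := min_le_right _ _
    rw [le_div_iff₀ hC0] at this
    linarith
  have eE := (tendsto_rpow_mul_exp_neg_rpow 0 (show (0 : ℝ) < 1 / 2 by norm_num) hρ0).eventually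
    (gt_mem_nhds hη)
  have eR := (tendsto_rpow_neg_exponent (show -(ρ / 2) < 0 by linarith)).eventually
    (gt_mem_nhds hη)
  have eK := ((tendsto_rpow_mul_exp_neg_rpow 4 (show (0 : ℝ) < 1 / 2 by norm_num) hρ0).const_mul
    (8 * waveConst ^ 2 * √π)).eventually (gt_mem_nhds (show _ * (0 : ℝ) < η by simpa using hη))
  filter_upwards [eventually_gauss_mainSq hρ0 hρ hη, eE, eR, eK, eventually_ge_atTop 1]
    with T hJ eE eR eK hT H U hH hHT hU hU4
  have hTp : 0 < T := by linarith
  have hH0 : 0 ≤ H := by linarith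
  have hb : 0 < T ^ (1 / 2 + 2 * ρ) := by positivity
  have hU0 : 0 < U := by linarith
  set P := T ^ ρ with hP
  have hP1 : 1 ≤ P := Real.one_le_rpow hT hρ0.le
  have hP0 : 0 < P := by linarith
  have hw : width ρ T = √T * P := by rw [width, Real.rpow_add hTp, Real.sqrt_eq_rpow]
  have hΔ : 0 < width ρ T := by unfold width; positivity
  set R := T ^ (ρ / 2) * width ρ T with hR
  have hR0 : 0 ≤ R := by positivity
  have hReq : R = T ^ (-(ρ / 2)) * T ^ (1 / 2 + 2 * ρ) := by
    rw [hR, width, ← Real.rpow_add hTp, ← Real.rpow_add hTp]; congr 1; ring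
  have hRU : R ≤ η * U := by
    rw [hReq]; exact mul_le_mul eR.le hU hb.le hη.le
  have hRb : R ≤ T ^ (1 / 2 + 2 * ρ) := by
    rw [hReq]
    exact mul_le_of_le_one_left hb.le (by linarith)
  have hq : R ^ 2 / (2 * width ρ T ^ 2) = 1 / 2 * P := by
    have h1 : R ^ 2 = P * width ρ T ^ 2 := by
      rw [hR, mul_pow, ← Real.rpow_natCast (T ^ (ρ / 2)), ← Real.rpow_mul hTp.le]
      congr 2; push_cast; ring
    rw [h1]; field_simp
  rw [Real.rpow_zero, one_mul] at eE
  have hcf := continuous_mainSq ρ hT hH0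
  have hf0 := mainSq_nonneg ρ T H
  have hfK := mainSq_le ρ hT hH0
  set K := (2 * waveConst * T ^ (5 / 8 : ℝ) * H) ^ 2 with hK
  set x := P * H with hx
  have hx0 : 0 < x := by positivity
  set F := ∫ t in T..(T + U), mainSq ρ T H t with hF
  have hF0 : 0 ≤ F := intervalIntegral.integral_nonneg (by linarith) fun t _ ↦ hf0 t
  have hup := integral_window_le hcf hf0 hfK hΔ (T := T) hU0.le hR0 (J := (c + η) * x) fun m hm ↦ by
    have := (abs_le.mp (hJ H m hH hHT (by
      rw [abs_le]; constructor <;> linarith [hm.1, hm.2]))).2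
    linarith
  have hlo := le_integral_window hcf hf0 hfK hΔ hR0 (T := T) (U := U) (J := (c - η) * x)
    (by nlinarith) fun m hm ↦ by
      have := (abs_le.mp (hJ H m hH hHT (by
        rw [abs_le]; constructor <;> linarith [hm.1, hm.2]))).1
      linarith
  rw [hq] at hup hlo
  have hk : K * (2 * rexp (-(1 / 2 * P)) * (√π * width ρ T)) ≤ η * x := by
    have hHT' : H ≤ T := hHT.trans (by
      have := Real.rpow_le_rpow_of_exponent_le hT (show ρ / 4 ≤ 1 by linarith)
      rwa [Real.rpow_one] at this)
    have h1 : T ^ (5 / 8 : ℝ) ≤ T := by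
      have := Real.rpow_le_rpow_of_exponent_le hT (show (5 / 8 : ℝ) ≤ 1 by norm_num)
      rwa [Real.rpow_one] at this
    have h2 : width ρ T ≤ T := by
      have := Real.rpow_le_rpow_of_exponent_le hT (show 1 / 2 + ρ ≤ 1 by linarith)
      rwa [Real.rpow_one] at this
    have hw := waveConst_nonneg
    have h3 : K ≤ (2 * waveConst * T * H) * (2 * waveConst * T * T) := by
      rw [hK, sq]
      gcongr
    calc K * (2 * rexp (-(1 / 2 * P)) * (√π * width ρ T))
        ≤ ((2 * waveConst * T * H) * (2 * waveConst * T * T)) *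
          (2 * rexp (-(1 / 2 * P)) * (√π * T)) := by gcongr
      _ = 8 * waveConst ^ 2 * √π * (T ^ (4 : ℝ) * rexp (-(1 / 2 * P))) * H := by
          rw [show T ^ (4 : ℝ) = T ^ 4 by norm_cast]; ring
      _ ≤ η * H := by gcongr
      _ ≤ η * x := by gcongr; exact le_mul_of_one_le_left hH0 hP1
  have g1 := window_upper hc0 hη hη4 eE.le hRU hU0 hx0
    (G := √π * width ρ T * F) (by positivity) (by linarith)
  have g2 := window_lower hc0 hη hη4 hηc hRU hU0 hx0 hk hlo
  have hfac : √π * width ρ T * F = √π * P * (√T * F) := by rw [hw]; ring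
  have hcm : c = √π * mainConst := by
    rw [hc, profileConst, mainConst]
    field_simp
    norm_num
  have hCe : (8 * c + 3) * η ≤ √π * ε := by
    have : √π * (C * η) ≤ √π * ε := by gcongr
    rwa [hC, ← mul_assoc, mul_div_cancel₀ _ hsp.ne'] at this
  have hPi : 0 < √π * P := by positivity
  have hUx : 0 ≤ U * x := by positivity
  have g3 := mul_le_mul_of_nonneg_right hCe hUx
  rw [hfac] at g1 g2
  rw [abs_le]
  constructor
  · refine le_of_mul_le_mul_left ?_ hPi
    have : √π * P * -(ε * (U * H)) = -(√π * ε * (U * x)) := by rw [hx]; ring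
    rw [this]
    have : √π * P * (√T * F - mainConst * (U * H)) = √π * P * (√T * F) - c * (U * x) := by
      rw [hx, hcm]; ring
    rw [this]; linarith
  · refine le_of_mul_le_mul_left ?_ hPi
    have : √π * P * (ε * (U * H)) = √π * ε * (U * x) := by rw [hx]; ring
    rw [this]
    have : √π * P * (√T * F - mainConst * (U * H)) = √π * P * (√T * F) - c * (U * x) := by
      rw [hx, hcm]; ring
    rw [this]; linarith

end ShortWindow

section ShortAverage

open Complex MeasureTheory Set
open scoped Real

lemma intervalIntegrable_XHL {a b : ℝ} (ha : 0 < a) (hb : 0 < b) :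
    IntervalIntegrable XHL volume a b :=
  (continuousOn_XHL.mono fun _ hx ↦ lt_of_lt_of_le (lt_min ha hb) hx.1).intervalIntegrable

lemma continuousOn_shortIntegral {A B H : ℝ} (hA : 0 < A) (hAB : A ≤ B) (hH : 0 ≤ H) :
    ContinuousOn (fun t ↦ ∫ u in t..(t + H), XHL u) (Icc A B) := by
  have hG : ContinuousOn (fun x ↦ ∫ u in A..x, XHL u) (Icc A (B + H)) := by
    have := intervalIntegral.continuousOn_primitive_interval' (a := A)
      (intervalIntegrable_XHL hA (show 0 < B + H by linarith)) left_mem_uIcc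
    rwa [uIcc_of_le (by linarith)] at this
  have h1 : ContinuousOn (fun t ↦ (∫ u in A..(t + H), XHL u) - ∫ u in A..t, XHL u) (Icc A B) :=
    (hG.comp (by fun_prop) fun t ht ↦ ⟨by linarith [ht.1], by linarith [ht.2]⟩).sub
      (hG.mono (Icc_subset_Icc_right (by linarith)))
  refine h1.congr fun t ht ↦ ?_
  have ht0 : 0 < t := hA.trans_le ht.1
  exact (intervalIntegral.integral_interval_sub_left
    (intervalIntegrable_XHL hA (by linarith)) (intervalIntegrable_XHL hA ht0)).symm

lemma abs_sq_sub_sq_le {s g e η : ℝ} (hη : 0 < η) (hs : |s - g| ≤ e) :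
    |s ^ 2 - g ^ 2| ≤ η * g ^ 2 + (1 + 1 / η) * e ^ 2 := by
  have h1 : (s - g) ^ 2 ≤ e ^ 2 := by
    rw [← sq_abs (s - g)]; exact pow_le_pow_left₀ (abs_nonneg _) hs 2
  have h2 : |2 * g * (s - g)| ≤ η * g ^ 2 + 1 / η * (s - g) ^ 2 := by
    have h3 : 0 ≤ (η * |g| - |s - g|) ^ 2 / η := by positivity
    have h4 : (η * |g| - |s - g|) ^ 2 / η = η * |g| ^ 2 + 1 / η * |s - g| ^ 2 -
        2 * |g| * |s - g| := by field_simp; ring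
    rw [h4, sq_abs, sq_abs] at h3
    rw [abs_mul, abs_mul, abs_two]
    linarith
  have h5 : 1 / η * (s - g) ^ 2 ≤ 1 / η * e ^ 2 := by gcongr
  rw [show s ^ 2 - g ^ 2 = 2 * g * (s - g) + (s - g) ^ 2 by ring]
  refine (abs_add_le _ _).trans ?_
  rw [abs_of_nonneg (sq_nonneg (s - g))]
  linarith

lemma weight_self_sq {T : ℝ} (hT : 0 < T) : weight T T ^ 2 = rexp 1 / 4 * √T := by
  have h1 : (T ^ (1 / 4 : ℝ)) ^ 2 = √T := by
    rw [← Real.rpow_natCast, ← Real.rpow_mul hT.le, Real.sqrt_eq_rpow]; norm_num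
  have h2 : rexp (T / (2 * T)) ^ 2 = rexp 1 := by
    rw [← Real.exp_nat_mul]; congr 1; push_cast; field_simp
  rw [weight, mul_pow, mul_pow, h1, h2]
  ring

lemma eventually_weight_sq {ρ : ℝ} (hρ0 : 0 < ρ) (hρ : ρ < 1 / 4) {η : ℝ} (hη : 0 < η) :
    ∀ᶠ T : ℝ in atTop, ∀ t, T ≤ t → t ≤ T + 4 * T ^ (1 / 2 + 2 * ρ) →
      |weight T t ^ 2 - rexp 1 / 4 * √T| ≤ η * √T := by
  have h1 := ((tendsto_rpow_neg_exponent (show 2 * ρ - 1 / 2 < 0 by linarith)).const_mul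
    160).eventually (gt_mem_nhds (show 160 * (0 : ℝ) < min η 1 by simpa using hη))
  filter_upwards [h1, eventually_ge_atTop 1] with T h1 hT t ht htU
  have hTp : 0 < T := by linarith
  have h1η := h1.le.trans (min_le_left _ _)
  have h11 := h1.le.trans (min_le_right _ _)
  have hb : T ^ (1 / 2 + 2 * ρ) = T ^ (2 * ρ - 1 / 2) * T := by
    rw [← Real.rpow_add_one hTp.ne']; congr 1; ring
  have ht3 : t ≤ 3 * T := by nlinarith
  have hw := abs_weight_sub_le hT le_rfl ht ht3
  have hwt := weight_le hTp (by linarith : 0 ≤ t) ht3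
  have hwT := weight_le hTp hTp.le (by linarith : T ≤ 3 * T)
  have hwt0 := weight_nonneg T (by linarith : 0 ≤ t)
  have hwT0 := weight_nonneg T hTp.le
  rw [← weight_self_sq hTp, sq_sub_sq, abs_mul, mul_comm,
    abs_of_nonneg (add_nonneg hwt0 hwT0)]
  calc |weight T t - weight T T| * (weight T t + weight T T)
      ≤ 4 * T ^ (-(3 / 4) : ℝ) * (4 * T ^ (1 / 2 + 2 * ρ)) *
        (5 * T ^ (1 / 4 : ℝ) + 5 * T ^ (1 / 4 : ℝ)) := by
        refine mul_le_mul (hw.trans ?_) (by linarith) (by positivity) (by positivity)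
        gcongr
        linarith
    _ = 160 * (T ^ (-(3 / 4) : ℝ) * T ^ (1 / 2 + 2 * ρ) * T ^ (1 / 4 : ℝ)) := by ring
    _ = 160 * T ^ (2 * ρ - 1 / 2) * √T := by
        rw [Real.sqrt_eq_rpow, mul_assoc 160, ← Real.rpow_add hTp, ← Real.rpow_add hTp,
          ← Real.rpow_add hTp]
        congr 2; ring
    _ ≤ η * √T := by gcongr

lemma exp_one_mul_mainConst : rexp 1 / 4 * mainConst = √(2 * π ^ 3) := by
  have hpi := Real.pi_pos
  have h1 : √(2 * π ^ 3) = π * √(2 * π) := by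
    rw [show 2 * π ^ 3 = π ^ 2 * (2 * π) by ring, Real.sqrt_mul (by positivity),
      Real.sqrt_sq hpi.le]
  have h2 : √(2 * π) ^ 2 = 2 * π := Real.sq_sqrt (by positivity)
  have h3 : rexp 1 * rexp (-1) = 1 := by rw [← Real.exp_add]; simp
  have h4 : 0 < √(2 * π) := by positivity
  rw [h1, mainConst, div_mul_div_comm, div_eq_iff (by positivity)]
  linear_combination (8 * π ^ 2) * h3 - 4 * π * h2

lemma mainConst_pos : 0 < mainConst := by unfold mainConst; positivity

lemma eventually_short_window {ρ : ℝ} (hρ0 : 0 < ρ) (hρ : ρ < 1 / 4) {ε : ℝ} (hε : 0 < ε) :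
    ∀ᶠ T : ℝ in atTop, ∀ H U, 1 ≤ H → H ≤ T ^ (ρ / 4) → T ^ (1 / 2 + 2 * ρ) ≤ U →
      U ≤ 4 * T ^ (1 / 2 + 2 * ρ) →
      |(∫ t in T..(T + U), (∫ u in t..(t + H), XHL u) ^ 2) - √(2 * π ^ 3) * (U * H)| ≤
        ε * (U * H) := by
  have hc := mainConst_pos
  have hwc := waveConst_nonneg
  set C := 3 * mainConst + 5 with hC
  have hC0 : 0 < C := by positivity
  set η := min 1 (ε / C) with hηd
  have hη : 0 < η := by positivity
  have hη1 : η ≤ 1 := min_le_left _ _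
  have hηC : C * η ≤ ε := by
    have : η ≤ ε / C := min_le_right _ _
    rw [le_div_iff₀ hC0] at this
    linarith
  have eE := ((tendsto_rpow_neg_exponent (show 3 * ρ / 4 - 1 / 4 < 0 by linarith)).const_mul
    ((18 * waveConst + 18) ^ 2 * 2)).eventually
    (gt_mem_nhds (show _ * (0 : ℝ) < η ^ 2 by simpa using pow_pos hη 2))
  have eM := (tendsto_rpow_mul_exp_neg_rpow 2 (show 0 < π / 4 by positivity)
    (show 0 < ρ / 2 by linarith)).eventually (gt_mem_nhds one_pos)
  have eU := ((tendsto_rpow_neg_exponent (show 2 * ρ - 1 / 2 < 0 by linarith)).const_mul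
    4).eventually (gt_mem_nhds (show 4 * (0 : ℝ) < 1 by norm_num))
  filter_upwards [eventually_integral_mainSq hρ0 hρ hη, eventually_weight_sq hρ0 hρ hη, eE, eM, eU,
    eventually_ge_atTop 1] with T hF hw eE eM eU hT H U hH hHT hU hU4
  replace hF := hF H U hH hHT hU hU4
  have hTp : 0 < T := by linarith
  have hsT : 0 < √T := Real.sqrt_pos.mpr hTp
  have hU0 : 0 < U := lt_of_lt_of_le (by positivity) hU
  have hb : T ^ (1 / 2 + 2 * ρ) = T ^ (2 * ρ - 1 / 2) * T := by
    rw [← Real.rpow_add_one hTp.ne']; congr 1; ring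
  have hUT : U ≤ T := by nlinarith
  have hHT' : H ≤ T := hHT.trans (by
    have := Real.rpow_le_rpow_of_exponent_le hT (show ρ / 4 ≤ 1 by linarith)
    rwa [Real.rpow_one] at this)
  have hM : rexp (-(π / 2 * (blockLen ρ T : ℝ) ^ 2 * (ray T).re)) ≤ 1 / T ^ 2 := by
    rw [le_div_iff₀ (by positivity), mul_comm]
    refine le_trans ?_ eM.le
    rw [show T ^ (2 : ℝ) = T ^ 2 by norm_cast]
    refine mul_le_mul_of_nonneg_left ?_ (by positivity)
    rw [Real.exp_le_exp, neg_le_neg_iff]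
    have := mul_le_mul_of_nonneg_left (ray_re_mul_blockLen_sq_ge (ρ := ρ) hT)
      (show 0 ≤ π / 2 by positivity)
    linarith
  set e := (18 * waveConst + 18) * H ^ 2 * T ^ (-(1 / 8) : ℝ) with he
  have he2 : (1 + 1 / η) * e ^ 2 ≤ η * H := by
    have h1 : e ^ 2 * 2 ≤ η ^ 2 * H := by
      have h2 : H ^ 3 ≤ T ^ (3 * ρ / 4) := by
        refine (pow_le_pow_left₀ (by linarith) hHT 3).trans (le_of_eq ?_)
        rw [← Real.rpow_natCast, ← Real.rpow_mul hTp.le]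
        congr 1; push_cast; ring
      have h3 : (T ^ (-(1 / 8) : ℝ)) ^ 2 = T ^ (-(1 / 4) : ℝ) := by
        rw [← Real.rpow_natCast, ← Real.rpow_mul hTp.le]; norm_num
      calc e ^ 2 * 2 = (18 * waveConst + 18) ^ 2 * 2 * (H ^ 3 * T ^ (-(1 / 4) : ℝ)) * H := by
            rw [he, mul_pow, mul_pow, h3]; ring
        _ ≤ (18 * waveConst + 18) ^ 2 * 2 * (T ^ (3 * ρ / 4) * T ^ (-(1 / 4) : ℝ)) * H := by
            gcongr
        _ = (18 * waveConst + 18) ^ 2 * 2 * T ^ (3 * ρ / 4 - 1 / 4) * H := by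
            rw [← Real.rpow_add hTp, ← sub_eq_add_neg]
        _ ≤ η ^ 2 * H := by gcongr
    have h4 : 1 + 1 / η ≤ 2 / η := by
      rw [show (2 : ℝ) / η = 1 / η + 1 / η by ring]
      have := one_le_one_div hη hη1
      linarith
    calc (1 + 1 / η) * e ^ 2 ≤ 2 / η * e ^ 2 := by gcongr
      _ = e ^ 2 * 2 / η := by ring
      _ ≤ η ^ 2 * H / η := by gcongr
      _ = η * H := by field_simp
  have hcf := continuous_mainSq ρ hT (show 0 ≤ H by linarith)
  have hS : IntervalIntegrable (fun t ↦ (∫ u in t..(t + H), XHL u) ^ 2) volume T (T + U) := by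
    have := (continuousOn_shortIntegral hTp (show T ≤ T + U by linarith)
      (show 0 ≤ H by linarith)).pow 2
    exact ContinuousOn.intervalIntegrable (by rwa [uIcc_of_le (by linarith)])
  have he4 : rexp 1 / 4 ≤ 1 := by linarith [Real.exp_one_lt_d9]
  have hpt : ∀ t ∈ Ioc T (T + U), ‖(∫ u in t..(t + H), XHL u) ^ 2 -
      rexp 1 / 4 * √T * mainSq ρ T H t‖ ≤ 3 * η * √T * mainSq ρ T H t + η * H := by
    intro t ht
    have h1 := abs_integral_XHL_sub_le hT hH hM ht.1.le (by linarith [ht.2])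
    have h2 := abs_sq_sub_sq_le hη h1
    have h3 := hw t ht.1.le (by linarith [ht.2])
    rw [mul_pow, show (rayRoot T * block (ray T) H (blockLen ρ T) t).re ^ 2 = mainSq ρ T H t
      from rfl] at h2
    have hm0 := mainSq_nonneg ρ T H t
    set q := mainSq ρ T H t
    set v := weight T t ^ 2
    set S := ∫ u in t..(t + H), XHL u
    have h4 : v ≤ 2 * √T := by
      have h5 := (abs_le.mp h3).2
      have h6 : η * √T ≤ 1 * √T := by gcongr
      have h7 : rexp 1 / 4 * √T ≤ 1 * √T := by gcongr
      linarith
    have h5 : |v * q - rexp 1 / 4 * √T * q| ≤ η * √T * q := by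
      rw [← sub_mul, abs_mul, abs_of_nonneg hm0]
      gcongr
    have h6 : η * (v * q) ≤ η * (2 * √T * q) := by gcongr
    rw [Real.norm_eq_abs]
    have h7 := abs_sub_le (S ^ 2) (v * q) (rexp 1 / 4 * √T * q)
    linarith
  have hinteg := intervalIntegral.norm_integral_le_of_norm_le (μ := volume) (show T ≤ T + U by linarith)
    (Eventually.of_forall hpt) (Continuous.intervalIntegrable (by fun_prop) _ _)
  rw [intervalIntegral.integral_sub hS (Continuous.intervalIntegrable (by fun_prop) _ _),
    intervalIntegral.integral_add (Continuous.intervalIntegrable (by fun_prop) _ _)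
      intervalIntegrable_const, intervalIntegral.integral_const_mul,
    intervalIntegral.integral_const_mul, intervalIntegral.integral_const, smul_eq_mul,
    Real.norm_eq_abs] at hinteg
  set F := ∫ t in T..(T + U), mainSq ρ T H t
  set G := ∫ t in T..(T + U), (∫ u in t..(t + H), XHL u) ^ 2
  have hUH : 0 < U * H := by positivity
  rw [← exp_one_mul_mainConst]
  have hF2 : |rexp 1 / 4 * √T * F - rexp 1 / 4 * mainConst * (U * H)| ≤ η * (U * H) := by
    rw [show rexp 1 / 4 * √T * F - rexp 1 / 4 * mainConst * (U * H) =
      rexp 1 / 4 * (√T * F - mainConst * (U * H)) by ring, abs_mul,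
      abs_of_nonneg (by positivity)]
    calc _ ≤ 1 * (η * (U * H)) := by gcongr
      _ = _ := one_mul _
  have hF3 : 3 * η * √T * F ≤ 3 * η * ((mainConst + 1) * (U * H)) := by
    have h1 := (abs_le.mp hF).2
    have h2 : η * (U * H) ≤ 1 * (U * H) := by gcongr
    have h3 : √T * F ≤ (mainConst + 1) * (U * H) := by linarith
    have := mul_le_mul_of_nonneg_left h3 (show 0 ≤ 3 * η by positivity)
    linarith
  have h1 := abs_sub_le G (rexp 1 / 4 * √T * F) (rexp 1 / 4 * mainConst * (U * H))
  have h2 := mul_le_mul_of_nonneg_right hηC hUH.le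
  have h3 : C * η * (U * H) = 3 * η * ((mainConst + 1) * (U * H)) + 2 * η * (U * H) := by
    rw [hC]; ring
  linarith

end ShortAverage

section LongWindow

open Complex MeasureTheory Set
open scoped Real

theorem intervalIntegrable_shortIntegral_sq {A B H : ℝ} (hA : 0 < A) (hAB : A ≤ B) (hH : 0 ≤ H) :
    IntervalIntegrable (fun t ↦ (∫ u in t..(t + H), XHL u) ^ 2) volume A B :=
  ContinuousOn.intervalIntegrable
    (by rw [uIcc_of_le hAB]; exact (continuousOn_shortIntegral hA hAB hH).pow 2)

theorem eventually_rpow_le_half {b : ℝ} (hb : b < 1) : ∀ᶠ V : ℝ in atTop, V ^ b ≤ V / 2 := by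
  filter_upwards [(tendsto_rpow_atTop (show 0 < 1 - b by linarith)).eventually_ge_atTop 2,
    eventually_gt_atTop 0] with V h hV
  have h1 : V ^ b * V ^ (1 - b) = V := by
    rw [← Real.rpow_add hV]; simp
  have h2 := mul_le_mul_of_nonneg_left h (Real.rpow_nonneg hV.le b)
  linarith

/-- Mean square of the short integrals over windows of arbitrary length at least `T ^ (1/2 + 2 * ρ)`,
obtained from short windows by repeated bisection. -/
theorem eventually_long_window {ρ ε : ℝ} (hρ0 : 0 < ρ) (hρ : ρ < 1 / 4) (hε : 0 < ε) :
    ∀ᶠ T : ℝ in atTop, ∀ H U : ℝ, 1 ≤ H → H ≤ T ^ (ρ / 4) → T ^ (1 / 2 + 2 * ρ) ≤ U →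
      |(∫ t in T..(T + U), (∫ u in t..(t + H), XHL u) ^ 2) - √(2 * π ^ 3) * (U * H)| ≤
        ε * (U * H) := by
  obtain ⟨V₀, hV₀⟩ := eventually_atTop.mp
    (eventually_rpow_le_half (show 1 / 2 + 2 * ρ < 1 by linarith))
  obtain ⟨T₀, hT₀⟩ := eventually_atTop.mp ((eventually_short_window hρ0 hρ hε).and
    (((tendsto_rpow_atTop (show 0 < 1 / 2 + 2 * ρ by linarith)).eventually_ge_atTop V₀).and
      (eventually_gt_atTop (0 : ℝ))))
  have key : ∀ n : ℕ, ∀ T : ℝ, T₀ ≤ T → ∀ H U : ℝ, 1 ≤ H → H ≤ T ^ (ρ / 4) →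
      T ^ (1 / 2 + 2 * ρ) ≤ U → U ≤ 2 ^ n * (4 * T ^ (1 / 2 + 2 * ρ)) →
      |(∫ t in T..(T + U), (∫ u in t..(t + H), XHL u) ^ 2) - √(2 * π ^ 3) * (U * H)| ≤
        ε * (U * H) := by
    intro n
    induction n with
    | zero =>
      intro T hT H U hH hHT hU hU4
      exact (hT₀ T hT).1 H U hH hHT hU (by simpa using hU4)
    | succ n ih =>
      intro T hT H U hH hHT hU hU4
      obtain ⟨hshort, hV, hT0⟩ := hT₀ T hT
      rcases le_or_gt U (4 * T ^ (1 / 2 + 2 * ρ)) with h | h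
      · exact hshort H U hH hHT hU h
      have hTb : 0 < T ^ (1 / 2 + 2 * ρ) := Real.rpow_pos_of_pos hT0 _
      have hhalf := hV₀ (U / 2) (by linarith)
      have hTT : T ≤ T + U / 2 := by linarith
      have hmono : T ^ (1 / 2 + 2 * ρ) ≤ (T + U / 2) ^ (1 / 2 + 2 * ρ) :=
        Real.rpow_le_rpow hT0.le hTT (by linarith)
      have hsub : (T + U / 2) ^ (1 / 2 + 2 * ρ) ≤ U / 2 :=
        (Real.rpow_add_le_add_rpow hT0.le (by linarith) (by linarith) (by linarith)).trans
          (by linarith)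
      have hU4' : U / 2 ≤ 2 ^ n * (4 * T ^ (1 / 2 + 2 * ρ)) := by
        rw [pow_succ] at hU4; linarith
      have h1 := ih T hT H (U / 2) hH hHT (by linarith) hU4'
      have h2 := ih (T + U / 2) (hT.trans hTT) H (U / 2) hH
        (hHT.trans (Real.rpow_le_rpow hT0.le hTT (by linarith))) hsub
        (hU4'.trans (by gcongr))
      rw [show T + U / 2 + U / 2 = T + U by ring] at h2
      rw [← intervalIntegral.integral_add_adjacent_intervals
        (intervalIntegrable_shortIntegral_sq hT0 hTT (by linarith))
        (intervalIntegrable_shortIntegral_sq (by linarith) (show T + U / 2 ≤ T + U by linarith)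
          (by linarith))]
      rw [abs_le] at h1 h2 ⊢
      constructor <;> linarith [h1.1, h1.2, h2.1, h2.2]
  filter_upwards [eventually_ge_atTop T₀] with T hT H U hH hHT hU
  have hTb : 0 < T ^ (1 / 2 + 2 * ρ) := Real.rpow_pos_of_pos (hT₀ T hT).2.2 _
  obtain ⟨n, hn⟩ := pow_unbounded_of_one_lt (U / (4 * T ^ (1 / 2 + 2 * ρ))) one_lt_two
  exact key n T hT H U hH hHT hU ((div_le_iff₀ (by positivity)).mp hn.le)

end LongWindow

end HardyLittlewood

/-- For fixed `a > 1/2`, `α > 0`: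
`∫_{τ^{1/a}}^{τ^{1/a}+τ} (∫_t^{t+a^{−α}(ln τ)^α} X(u) du)² dt
  = (1+o(1))·√(2π³)·a^{−α}·τ·(ln τ)^α`. -/
theorem hardy_littlewood_substituted (a α : ℝ) (ha : 1/2 < a) (hα : 0 < α) :
    Filter.Tendsto
      (fun τ : ℝ =>
        (∫ t in (τ ^ ((1:ℝ)/a))..(τ ^ ((1:ℝ)/a) + τ),
            (∫ u in t..(t + a ^ (-α) * (Real.log τ) ^ α), XHL u) ^ 2) /
          (Real.sqrt (2 * Real.pi ^ 3) * a ^ (-α) * τ * (Real.log τ) ^ α))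
      Filter.atTop (𝓝 1) := by
  have ha0 : 0 < a := by linarith
  obtain ⟨ρ, hρ0, hρ, hρa⟩ : ∃ ρ : ℝ, 0 < ρ ∧ ρ < 1 / 4 ∧ 1 / 2 + 2 * ρ ≤ a :=
    ⟨min (1 / 8) ((a - 1 / 2) / 2), lt_min (by norm_num) (by linarith),
      (min_le_left _ _).trans_lt (by norm_num),
      by linarith [min_le_right (1 / 8) ((a - 1 / 2) / 2)]⟩
  have hlim : Tendsto (fun τ : ℝ ↦ τ ^ (1 / a)) atTop atTop :=
    tendsto_rpow_atTop (by positivity)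
  have hlogpow : ∀ᶠ T : ℝ in atTop, Real.log T ^ α ≤ T ^ (ρ / 4) := by
    filter_upwards [(isLittleO_log_rpow_rpow_atTop α (show 0 < ρ / 4 by linarith)).bound
      one_pos, eventually_ge_atTop 1] with T h hT
    simpa [Real.norm_eq_abs, abs_of_nonneg, Real.rpow_nonneg, Real.log_nonneg hT,
      (zero_le_one.trans hT)] using h
  rw [Metric.tendsto_nhds]
  intro ε hε
  have hc : 0 < √(2 * Real.pi ^ 3) := by positivity
  filter_upwards [hlim.eventually (HardyLittlewood.eventually_long_window hρ0 hρ
      (show 0 < √(2 * Real.pi ^ 3) * (ε / 2) by positivity)), hlim.eventually hlogpow,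
    hlim.eventually (Real.tendsto_log_atTop.eventually_ge_atTop 1),
    hlim.eventually (eventually_ge_atTop 1), eventually_gt_atTop 0] with τ h hlp hl1 hT1 hτ
  have hHeq : a ^ (-α) * Real.log τ ^ α = Real.log (τ ^ (1 / a)) ^ α := by
    rw [Real.log_rpow hτ] at hl1 ⊢
    have hlog : 0 < Real.log τ :=
      (pos_iff_pos_of_mul_pos (by linarith)).mp (show 0 < 1 / a by positivity)
    rw [Real.mul_rpow (by positivity) hlog.le, one_div, Real.inv_rpow ha0.le, Real.rpow_neg ha0.le]
  have hH1 : 1 ≤ a ^ (-α) * Real.log τ ^ α := by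
    rw [hHeq]
    exact Real.one_le_rpow hl1 hα.le
  have hU : (τ ^ (1 / a)) ^ (1 / 2 + 2 * ρ) ≤ τ :=
    calc (τ ^ (1 / a)) ^ (1 / 2 + 2 * ρ) ≤ (τ ^ (1 / a)) ^ a :=
          Real.rpow_le_rpow_of_exponent_le hT1 hρa
      _ = τ := by rw [← Real.rpow_mul hτ.le, one_div_mul_cancel ha0.ne', Real.rpow_one]
  have hb := h _ τ hH1 (hHeq.le.trans hlp) hU
  rw [show √(2 * Real.pi ^ 3) * a ^ (-α) * τ * Real.log τ ^ α =
    √(2 * Real.pi ^ 3) * (τ * (a ^ (-α) * Real.log τ ^ α)) by ring]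
  generalize a ^ (-α) * Real.log τ ^ α = H at hb hH1 ⊢
  have hUH : 0 < √(2 * Real.pi ^ 3) * (τ * H) := by positivity
  rw [Real.dist_eq, div_sub_one hUH.ne', abs_div, abs_of_pos hUH, div_lt_iff₀ hUH]
  calc _ ≤ √(2 * Real.pi ^ 3) * (ε / 2) * (τ * H) := hb
    _ = ε / 2 * (√(2 * Real.pi ^ 3) * (τ * H)) := by ring
    _ < ε * (√(2 * Real.pi ^ 3) * (τ * H)) := by gcongr; linarith
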